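/- Let A and B be nontrivial left-orderable groups. Then the free product G = A ∗ B has normal rank greater than one: for every element w ∈ G, the normal closure ⟨⟨w⟩⟩ of w in G is a proper subgroup of G. -/

import Mathlib

/-- A group is left-orderable if there is a strict total order on it invariant
under left multiplication. -/
def IsLeftOrderable (H : Type*) [Group H] : Prop :=
  ∃ lt : H → H → Prop, IsStrictTotalOrder H lt ∧ ∀ f g h : H, lt f g → lt (h * f) (h * g)

set_option linter.unusedSectionVars false

/-! ### Counting classes of equivalence relations and cycles of permutations -/

namespace OneRelator

open Equiv Equiv.Perm

variable {D : Type*}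

/-- The number of classes of `r` meeting `Y`. -/
noncomputable def cls (r : Setoid D) (Y : Set D) : ℕ := ((Quotient.mk r) '' Y).ncard

/-- The equivalence relation obtained from `r` by merging the classes of `x` and `y`. -/
def merge (r : Setoid D) (x y : D) : Setoid D where
  r a b := r a b ∨ (r a x ∨ r a y) ∧ (r b x ∨ r b y)
  iseqv :=
    { refl := fun a => Or.inl (r.refl a)
      symm := by
        rintro a b (h | ⟨h, h'⟩)
        · exact Or.inl (r.symm h)
        · exact Or.inr ⟨h', h⟩
      trans := by
        rintro a b c (h | ⟨h, h'⟩) (k | ⟨k, k'⟩)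
        · exact Or.inl (r.trans h k)
        · exact Or.inr ⟨k.imp (r.trans h) (r.trans h), k'⟩
        · exact Or.inr ⟨h, h'.imp (r.trans (r.symm k)) (r.trans (r.symm k))⟩
        · exact Or.inr ⟨h, k'⟩ }

theorem le_merge (r : Setoid D) (x y : D) : r ≤ merge r x y := fun _ _ h => Or.inl h

theorem merge_rel (r : Setoid D) (x y : D) : merge r x y x y :=
  Or.inr ⟨Or.inl (r.refl x), Or.inr (r.refl y)⟩

theorem merge_le {r s : Setoid D} {x y : D} (h : r ≤ s) (hxy : s x y) : merge r x y ≤ s := by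
  have key : ∀ a, r a x ∨ r a y → s a x := by
    rintro a (h' | h')
    · exact h h'
    · exact s.trans (h h') (s.symm hxy)
  rintro a b (h' | ⟨h1, h2⟩)
  · exact h h'
  · exact s.trans (key a h1) (s.symm (key b h2))

section Counting

variable [Finite D]

theorem cls_le_of_rel {r s : Setoid D} {Y : Set D}
    (h : ∀ a ∈ Y, ∀ b ∈ Y, r a b → s a b) : cls s Y ≤ cls r Y := by
  classical
  have : ∀ q ∈ (Quotient.mk s) '' Y, ∃ q' ∈ (Quotient.mk r) '' Y, ∃ a ∈ Y,
      Quotient.mk s a = q ∧ Quotient.mk r a = q' := by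
    rintro _ ⟨a, ha, rfl⟩
    exact ⟨_, ⟨a, ha, rfl⟩, a, ha, rfl, rfl⟩
  have : ∀ q : Quotient s, ∃ q' : Quotient r, q ∈ (Quotient.mk s) '' Y →
      q' ∈ (Quotient.mk r) '' Y ∧ ∃ a ∈ Y, Quotient.mk s a = q ∧ Quotient.mk r a = q' := by
    intro q
    by_cases hq : q ∈ (Quotient.mk s) '' Y
    · obtain ⟨q', h'⟩ := this q hq
      exact ⟨q', fun _ => h'⟩
    · exact ⟨Quotient.mk r q.out, fun h' => absurd h' hq⟩
  choose g hg using this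
  refine Set.ncard_le_ncard_of_injOn g (fun q hq => (hg q hq).1) ?_
  intro q hq q' hq' hqq
  obtain ⟨-, a, ha, h1, h2⟩ := hg q hq
  obtain ⟨-, b, hb, h3, h4⟩ := hg q' hq'
  rw [← h1, ← h3]
  exact Quotient.sound (h a ha b hb (Quotient.exact (h2.trans (hqq.trans h4.symm))))

theorem cls_anti {r s : Setoid D} (h : r ≤ s) (Y : Set D) : cls s Y ≤ cls r Y :=
  cls_le_of_rel fun _ _ _ _ hab => h hab

theorem cls_le_ncard (r : Setoid D) (Y : Set D) : cls r Y ≤ Y.ncard := Set.ncard_image_le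

theorem cls_union {r : Setoid D} {Y Z : Set D} (h : ∀ a ∈ Y, ∀ b ∈ Z, ¬ r a b) :
    cls r (Y ∪ Z) = cls r Y + cls r Z := by
  rw [cls, Set.image_union, Set.ncard_union_eq]
  · rfl
  · rw [Set.disjoint_left]
    rintro _ ⟨a, ha, rfl⟩ ⟨b, hb, hab⟩
    exact h a ha b hb (r.symm (Quotient.exact hab))

theorem cls_le_one {r : Setoid D} {Y : Set D} (h : ∀ a ∈ Y, ∀ b ∈ Y, r a b) : cls r Y ≤ 1 := by
  rw [cls, Set.ncard_le_one]
  rintro _ ⟨a, ha, rfl⟩ _ ⟨b, hb, rfl⟩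
  exact Quotient.sound (h a ha b hb)

theorem cls_pos {r : Setoid D} {Y : Set D} {x : D} (hx : x ∈ Y) : 1 ≤ cls r Y :=
  (Set.ncard_pos (s := (Quotient.mk r) '' Y)).2 ⟨_, x, hx, rfl⟩

theorem cls_le_merge (r : Setoid D) (x y : D) (Y : Set D) :
    cls r Y ≤ cls (merge r x y) Y + 1 := by
  have h1 := Set.ncard_le_ncard_sdiff_add_ncard ((Quotient.mk r) '' Y) {Quotient.mk r y}
  rw [Set.ncard_singleton] at h1
  refine h1.trans (Nat.add_le_add_right ?_ 1)
  have hle : r ≤ merge r x y := le_merge r x y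
  let g : Quotient r → Quotient (merge r x y) :=
    Quotient.map id (fun a b (h : r a b) => (hle h : merge r x y a b))
  refine Set.ncard_le_ncard_of_injOn g ?_ ?_
  · rintro _ ⟨⟨a, ha, rfl⟩, -⟩
    exact ⟨a, ha, rfl⟩
  · rintro _ ⟨⟨a, ha, rfl⟩, hay⟩ _ ⟨⟨b, hb, rfl⟩, hby⟩ hab
    have hay' : ¬ r a y := fun h => hay (Quotient.sound h)
    have hby' : ¬ r b y := fun h => hby (Quotient.sound h)
    have : merge r x y a b := Quotient.exact hab
    apply Quotient.sound
    rcases this with h | ⟨h | h, h' | h'⟩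
    · exact h
    · exact r.trans h (r.symm h')
    · exact absurd h' hby'
    · exact absurd h hay'
    · exact absurd h hay'

theorem cls_merge_lt {r : Setoid D} {x y : D} {Y : Set D} (hx : x ∈ Y) (hy : y ∈ Y)
    (h : ¬ r x y) : cls (merge r x y) Y + 1 ≤ cls r Y := by
  have h1 := Set.ncard_sdiff_singleton_add_one
    (s := (Quotient.mk r) '' Y) (a := Quotient.mk r y) ⟨y, hy, rfl⟩
  rw [cls, cls, ← h1]
  refine Nat.add_le_add_right ?_ 1
  have hle : r ≤ merge r x y := le_merge r x y
  let g : Quotient r → Quotient (merge r x y) :=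
    Quotient.map id (fun a b (h : r a b) => (hle h : merge r x y a b))
  have : (Quotient.mk (merge r x y)) '' Y ⊆
      g '' ((Quotient.mk r) '' Y \ {Quotient.mk r y}) := by
    rintro _ ⟨a, ha, rfl⟩
    by_cases hay : r a y
    · refine ⟨Quotient.mk r x, ⟨⟨x, hx, rfl⟩, fun hh => h (Quotient.exact hh)⟩, ?_⟩
      exact Quotient.sound (Or.inr ⟨Or.inl (r.refl x), Or.inr hay⟩)
    · exact ⟨Quotient.mk r a, ⟨⟨a, ha, rfl⟩, fun hh => hay (Quotient.exact hh)⟩, rfl⟩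
  exact (Set.ncard_le_ncard this).trans Set.ncard_image_le

/-- The setoid of cycles of a permutation. -/
abbrev sc (f : Perm D) : Setoid D := SameCycle.setoid f

omit [Finite D] in
theorem sc_self (f : Perm D) (a : D) : sc f a (f a) := ⟨1, by simp⟩

omit [Finite D] in
theorem sc_le {f : Perm D} {r : Setoid D} (h : ∀ a, r a (f a)) : sc f ≤ r := by
  rintro a b ⟨i, rfl⟩
  induction i using Int.induction_on with
  | zero => simp
  | succ i ih =>
    rw [add_comm, zpow_add, zpow_one, Perm.mul_apply]
    exact r.trans ih (h _)
  | pred i ih =>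
    refine r.trans ih (r.symm ?_)
    have := h ((f ^ (-(i : ℤ) - 1)) a)
    rw [← Perm.mul_apply, ← zpow_one_add] at this
    convert this using 3
    ring

theorem mem_of_sc {f : Perm D} {Y : Set D} (h : ∀ d ∈ Y, f d ∈ Y) {a b : D} (ha : a ∈ Y)
    (hab : sc f a b) : b ∈ Y := by
  obtain ⟨i, rfl⟩ := SameCycle.exists_nat_pow_eq hab
  induction i with
  | zero => simpa using ha
  | succ i ih =>
    rw [pow_succ', Perm.mul_apply]
    exact h _ (ih ⟨i, by simp⟩)

theorem inv_mem {f : Perm D} {Y : Set D} (h : ∀ d ∈ Y, f d ∈ Y) {a : D} (ha : a ∈ Y) :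
    f⁻¹ a ∈ Y := mem_of_sc h ha ⟨-1, by simp⟩

variable [DecidableEq D]

theorem sc_mul_swap_of_not {f : Perm D} {x y : D} (h : ¬ sc f x y) :
    sc (f * swap x y) x y := by
  by_contra h'
  have hx : sc (f * swap x y) x (f y) := by
    have := sc_self (f * swap x y) x
    simpa using this
  have hcl : ∀ d ∈ {d | sc f y d ∧ sc (f * swap x y) x d},
      f d ∈ {d | sc f y d ∧ sc (f * swap x y) x d} := by
    rintro d ⟨hd1, hd2⟩
    refine ⟨(sc f).trans hd1 (sc_self f d), ?_⟩
    have hdx : d ≠ x := by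
      rintro rfl
      exact h ((sc f).symm hd1)
    have hdy : d ≠ y := by
      rintro rfl
      exact h' hd2
    have := sc_self (f * swap x y) d
    rw [Perm.mul_apply, swap_apply_of_ne_of_ne hdx hdy] at this
    exact (sc _).trans hd2 this
  have : y ∈ {d | sc f y d ∧ sc (f * swap x y) x d} :=
    mem_of_sc hcl (a := f y) ⟨sc_self f y, hx⟩ ((sc f).symm (sc_self f y))
  exact h' this.2

theorem not_sc_mul_swap {f : Perm D} {x y : D} (h : sc f x y) (hxy : x ≠ y) :
    ¬ sc (f * swap x y) x y := by
  intro h'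
  have hex : ∃ k : ℕ, (f ^ k) x = y := SameCycle.exists_nat_pow_eq h
  classical
  let k := Nat.find hex
  have hk : (f ^ k) x = y := Nat.find_spec hex
  have hmin : ∀ j < k, (f ^ j) x ≠ y := fun j hj => Nat.find_min hex hj
  have hret : ∀ j, 0 < j → j ≤ k → (f ^ j) x ≠ x := by
    intro j hj hjk hx
    apply hmin (k - j) (by omega)
    have : (f ^ (k - j)) ((f ^ j) x) = y := by
      rw [← Perm.mul_apply, ← pow_add, Nat.sub_add_cancel hjk, hk]
    rwa [hx] at this
  have hk0 : 0 < k := by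
    rcases Nat.eq_zero_or_pos k with h0 | h0
    · rw [h0] at hk
      exact absurd hk hxy
    · exact h0
  let S : Set D := {d | ∃ j, 0 < j ∧ j ≤ k ∧ (f ^ j) x = d}
  have hS : ∀ d ∈ S, (f * swap x y) d ∈ S := by
    rintro d ⟨j, hj, hjk, rfl⟩
    rcases hjk.eq_or_lt with rfl | hlt
    · refine ⟨1, one_pos, hj, ?_⟩
      rw [hk]
      simp
    · refine ⟨j + 1, Nat.succ_pos _, hlt, ?_⟩
      rw [Perm.mul_apply, swap_apply_of_ne_of_ne (hret j hj hjk) (hmin j hlt), pow_succ',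
        Perm.mul_apply]
  have : x ∈ S := mem_of_sc hS (a := y) ⟨k, hk0, le_rfl, hk⟩ ((sc _).symm h')
  obtain ⟨j, hj, hjk, hx⟩ := this
  exact hret j hj hjk hx

omit [Finite D] in
theorem sc_mul_swap_le (f : Perm D) (x y : D) : sc (f * swap x y) ≤ merge (sc f) x y := by
  apply sc_le
  intro a
  rw [Perm.mul_apply]
  by_cases hax : a = x
  · subst hax
    rw [swap_apply_left]
    exact Or.inr ⟨Or.inl ((sc f).refl a), Or.inr ((sc f).symm (sc_self f y))⟩
  by_cases hay : a = y
  · subst hay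
    rw [swap_apply_right]
    exact Or.inr ⟨Or.inr ((sc f).refl a), Or.inl ((sc f).symm (sc_self f x))⟩
  rw [swap_apply_of_ne_of_ne hax hay]
  exact Or.inl (sc_self f a)

omit [Finite D] in
theorem sc_le_of_mul_swap {f : Perm D} {x y : D} (h : sc (f * swap x y) x y) :
    sc f ≤ sc (f * swap x y) := by
  have h1 := sc_mul_swap_le (f * swap x y) x y
  rw [mul_assoc, swap_mul_self, mul_one] at h1
  exact h1.trans (merge_le le_rfl h)

theorem cls_mul_swap_of_not {f : Perm D} {x y : D} {Y : Set D} (hx : x ∈ Y) (hy : y ∈ Y)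
    (h : ¬ sc f x y) : cls (sc (f * swap x y)) Y + 1 = cls (sc f) Y := by
  have h' := sc_mul_swap_of_not h
  have heq : sc (f * swap x y) = merge (sc f) x y :=
    le_antisymm (sc_mul_swap_le f x y) (merge_le (sc_le_of_mul_swap h') h')
  rw [heq]
  exact le_antisymm (cls_merge_lt hx hy h) (cls_le_merge _ _ _ _)

theorem cls_mul_swap {f : Perm D} {x y : D} {Y : Set D} (hx : x ∈ Y) (hy : y ∈ Y)
    (h : sc f x y) (hxy : x ≠ y) : cls (sc (f * swap x y)) Y = cls (sc f) Y + 1 := by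
  have := cls_mul_swap_of_not hx hy (not_sc_mul_swap h hxy)
  rw [mul_assoc, swap_mul_self, mul_one] at this
  exact this.symm

omit [Finite D] in
theorem swap_mul_eq (f : Perm D) (x y : D) : swap x y * f = f * swap (f⁻¹ x) (f⁻¹ y) := by
  rw [Equiv.swap_apply_apply, inv_inv]
  group

theorem cls_swap_mul {f : Perm D} {x y : D} {Y : Set D} (hf : ∀ d ∈ Y, f d ∈ Y) (hx : x ∈ Y)
    (hy : y ∈ Y) (h : sc f x y) (hxy : x ≠ y) :
    cls (sc (swap x y * f)) Y = cls (sc f) Y + 1 := by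
  rw [swap_mul_eq]
  refine cls_mul_swap (inv_mem hf hx) (inv_mem hf hy) ?_ (fun h => hxy (f⁻¹.injective h))
  have h1 : sc f (f⁻¹ x) x := by simpa using sc_self f (f⁻¹ x)
  have h2 : sc f (f⁻¹ y) y := by simpa using sc_self f (f⁻¹ y)
  exact (sc f).trans h1 ((sc f).trans h ((sc f).symm h2))

theorem cls_swap_mul_of_not {f : Perm D} {x y : D} {Y : Set D} (hf : ∀ d ∈ Y, f d ∈ Y)
    (hx : x ∈ Y) (hy : y ∈ Y) (h : ¬ sc f x y) :
    cls (sc (swap x y * f)) Y + 1 = cls (sc f) Y ∧ sc (swap x y * f) x y := by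
  have h1 : sc f (f⁻¹ x) x := by simpa using sc_self f (f⁻¹ x)
  have h2 : sc f (f⁻¹ y) y := by simpa using sc_self f (f⁻¹ y)
  have hne : ¬ sc f (f⁻¹ x) (f⁻¹ y) := fun h3 =>
    h ((sc f).trans ((sc f).symm h1) ((sc f).trans h3 h2))
  rw [swap_mul_eq]
  refine ⟨cls_mul_swap_of_not (inv_mem hf hx) (inv_mem hf hy) hne, ?_⟩
  have h3 := sc_mul_swap_of_not hne
  have hle := sc_le_of_mul_swap h3
  exact (sc _).trans (hle ((sc f).symm h1)) ((sc _).trans h3 (hle h2))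

/-- Orbits of the group generated by two permutations. -/
abbrev gen (a f : Perm D) : Setoid D := sc a ⊔ sc f

omit [Finite D] [DecidableEq D] in
theorem gen_left (a f : Perm D) (d : D) : gen a f d (a d) :=
  (le_sup_left : sc a ≤ gen a f) (sc_self a d)

omit [Finite D] [DecidableEq D] in
theorem gen_right (a f : Perm D) (d : D) : gen a f d (f d) :=
  (le_sup_right : sc f ≤ gen a f) (sc_self f d)

omit [Finite D] [DecidableEq D] in
theorem gen_le {a f : Perm D} {r : Setoid D} (h : ∀ d, r d (a d)) (h' : ∀ d, r d (f d)) :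
    gen a f ≤ r := sup_le (sc_le h) (sc_le h')

omit [Finite D] [DecidableEq D] in
theorem sc_mul_le_gen (a f : Perm D) : sc (a * f) ≤ gen a f :=
  sc_le fun d => (gen a f).trans (gen_right a f d) (gen_left a f (f d))

omit [DecidableEq D] in
theorem mem_of_gen {a f : Perm D} {Y : Set D} (ha : ∀ d ∈ Y, a d ∈ Y) (hf : ∀ d ∈ Y, f d ∈ Y)
    {d e : D} (hd : d ∈ Y) (h : gen a f d e) : e ∈ Y := by
  have : gen a f ≤ Setoid.ker (· ∈ Y) := by
    apply gen_le
    · intro d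
      refine propext ⟨ha d, fun h => ?_⟩
      simpa using inv_mem ha h
    · intro d
      refine propext ⟨hf d, fun h => ?_⟩
      simpa using inv_mem hf h
  have h2 : (d ∈ Y) = (e ∈ Y) := this h
  rwa [← h2]

/-- Euler's inequality for a pair of permutations. -/
theorem euler (f : Perm D) (Y : Set D) (hf : ∀ d ∈ Y, f d ∈ Y) (a : Perm D)
    (ha : ∀ d ∈ Y, a d ∈ Y) :
    cls (sc a) Y + cls (sc f) Y + cls (sc (a * f)) Y ≤ Y.ncard + 2 * cls (gen a f) Y := by
  induction hN : {d ∈ Y | a d ≠ d}.ncard using Nat.strong_induction_on generalizing a with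
  | _ N ih =>
  have haf : ∀ d ∈ Y, (a * f) d ∈ Y := fun d hd => ha _ (hf d hd)
  by_cases hfix : ∀ d ∈ Y, a d = d
  · have hstep : ∀ g : Perm D, (∀ d ∈ Y, g d ∈ Y) → (∀ d ∈ Y, g d = f d) →
        cls (sc g) Y ≤ cls (gen a f) Y := by
      intro g hg hgf
      apply cls_le_of_rel
      intro d hd e he hde
      have hle : gen a f ≤ ({ r := fun d e => (d ∈ Y ↔ e ∈ Y) ∧ (d ∈ Y → sc g d e)
                              iseqv := ⟨fun d => ⟨Iff.rfl, fun _ => (sc g).refl d⟩,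
                                fun h => ⟨h.1.symm, fun hd => (sc g).symm (h.2 (h.1.2 hd))⟩,
                                fun h h' => ⟨h.1.trans h'.1,
                                  fun hd => (sc g).trans (h.2 hd) (h'.2 (h.1.1 hd))⟩⟩ } :
                              Setoid D) := by
        apply gen_le
        · intro d
          refine ⟨⟨ha d, fun h => by simpa using inv_mem ha h⟩, fun hd => ?_⟩
          rw [hfix d hd]
        · intro d
          refine ⟨⟨hf d, fun h => by simpa using inv_mem hf h⟩, fun hd => ?_⟩
          rw [← hgf d hd]
          exact sc_self g d
      exact (hle hde).2 hd
    have h1 := hstep f hf (fun _ _ => rfl)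
    have h2 := hstep (a * f) haf (fun d hd => hfix _ (hf d hd))
    have h3 := cls_le_ncard (sc a) Y
    omega
  push Not at hfix
  obtain ⟨x, hx, hax⟩ := hfix
  have hy := ha x hx
  set y := a x with hy_def
  have hxy : x ≠ y := fun h => hax h.symm
  let a' := swap x y * a
  have ha'x : a' x = x := by simp [a', ← hy_def]
  have hswap : ∀ d ∈ Y, swap x y d ∈ Y := by
    intro d hd
    rw [swap_apply_def]
    split_ifs <;> assumption
  have ha' : ∀ d ∈ Y, a' d ∈ Y := fun d hd => hswap _ (ha d hd)
  have hlt : {d ∈ Y | a' d ≠ d}.ncard < N := by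
    rw [← hN]
    refine Set.ncard_lt_ncard ⟨?_, ?_⟩ (Set.toFinite _)
    · rintro d ⟨hd, hd'⟩
      refine ⟨hd, fun h => hd' ?_⟩
      have h1 : d ≠ x := by
        rintro rfl
        exact hax h
      have h2 : d ≠ y := by
        rintro rfl
        exact h1 (a.injective h)
      show swap x y (a d) = d
      rw [h, swap_apply_of_ne_of_ne h1 h2]
    · intro h
      exact (h ⟨hx, hax⟩ : x ∈ Y ∧ a' x ≠ x).2 ha'x
  have hIH := ih _ hlt a' ha' rfl
  have hca : cls (sc a') Y = cls (sc a) Y + 1 :=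
    cls_swap_mul ha hx hy (sc_self a x) hxy
  have ha'a : ∀ d, a d = swap x y (a' d) := fun d => by simp [a']
  have hmerge : gen a f ≤ merge (gen a' f) x y := by
    apply gen_le
    · intro d
      rw [ha'a]
      have h1 := le_merge (gen a' f) x y (gen_left a' f d)
      refine (merge _ x y).trans h1 ?_
      rw [swap_apply_def]
      split_ifs with h2 h3
      · rw [h2]
        exact merge_rel _ _ _
      · rw [h3]
        exact (merge _ x y).symm (merge_rel _ _ _)
      · exact (merge _ x y).refl _
    · intro d
      exact le_merge _ _ _ (gen_right a' f d)
  by_cases hsc : sc (a * f) x y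
  · have h1 : cls (sc (a' * f)) Y = cls (sc (a * f)) Y + 1 := by
      have := cls_swap_mul haf hx hy hsc hxy
      rwa [← mul_assoc] at this
    have h2 := cls_le_merge (gen a' f) x y Y
    have h3 := cls_anti hmerge Y
    omega
  · have h1 := cls_swap_mul_of_not haf hx hy hsc
    rw [← mul_assoc] at h1
    have h2 : gen a f ≤ gen a' f :=
      hmerge.trans (merge_le le_rfl (sc_mul_le_gen a' f h1.2))
    have h3 := cls_anti h2 Y
    have h4 := h1.1
    change cls (sc (a' * f)) Y + 1 = _ at h4
    omega

omit [DecidableEq D] in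
theorem ncard_le_two_mul_cls {a : Perm D} {Y : Set D} (h : ∀ d, a (a d) = d) :
    Y.ncard ≤ 2 * cls (sc a) Y := by
  classical
  have hY : Y.Finite := Y.toFinite
  rw [Set.ncard_eq_toFinset_card Y hY]
  have hc : cls (sc a) Y = (hY.toFinset.image (Quotient.mk (sc a))).card := by
    rw [cls, ← Set.ncard_coe_finset]
    simp
  rw [hc]
  apply Finset.card_le_mul_card_image
  intro q hq
  obtain ⟨x, hx, rfl⟩ := Finset.mem_image.1 hq
  have : (hY.toFinset.filter fun d => Quotient.mk (sc a) d = Quotient.mk (sc a) x) ⊆ {x, a x} := by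
    intro d hd
    have hd' : sc a x d := (sc a).symm (Quotient.exact (Finset.mem_filter.1 hd).2)
    have : d ∈ ({x, a x} : Set D) := by
      refine mem_of_sc (Y := {x, a x}) ?_ (Or.inl rfl) hd'
      rintro e (rfl | rfl)
      · exact Or.inr rfl
      · exact Or.inl (h x)
    simpa using this
  exact (Finset.card_le_card this).trans Finset.card_le_two

end Counting

end OneRelator

/-! ### Planar pictures over a free product, relative to a cyclic word -/

namespace OneRelator

open Equiv Equiv.Perm

/-- A cyclically alternating word in a group with two distinguished subgroups. -/
structure CyclicWord (G : Type*) [Group G] where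
  P : Bool → Subgroup G
  n : ℕ
  n_ne : NeZero n
  x : ZMod n → G
  par : ZMod n → Bool
  par_succ : ∀ p, par (p + 1) = !par p
  mem : ∀ p, x p ∈ P (par p)
  free : ∀ l : List (Bool × G), l ≠ [] → (∀ e ∈ l, e.2 ∈ P e.1) →
    l.IsChain (fun e e' => e.1 ≠ e'.1) → (l.map Prod.snd).prod = 1 → ∃ e ∈ l, e.2 = 1

attribute [instance] CyclicWord.n_ne

/-- A combinatorial map with labelled corners and a potential; `φ` is the face permutation,
`α` the edge involution. -/
structure Picture (D G : Type*) (n : ℕ) where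
  φ : Perm D
  α : Perm D
  ℓ : D → G
  t : D → G
  τ : D → Bool
  pos : D → ZMod n
  sg : D → Bool

variable {D G : Type*} [Group G] {w : CyclicWord G}

namespace Picture

variable {n : ℕ}

/-- The vertex permutation. -/
def σ (S : Picture D G n) : Perm D := S.α * S.φ

theorem σ_apply (S : Picture D G n) (d : D) : S.σ d = S.α (S.φ d) := rfl

/-- A corner where the potential is not compatible with the label. -/
def Defect (S : Picture D G n) (d : D) : Prop := S.t (S.σ d) ≠ S.t d * S.ℓ d

/-- `d₀` is the only defect in `Y`. -/
def Sole (S : Picture D G n) (Y : Set D) (d₀ : D) : Prop :=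
  d₀ ∈ Y ∧ S.Defect d₀ ∧ ∀ d ∈ Y, S.Defect d → d = d₀

/-- `Y` lies in one component. -/
def Conn (S : Picture D G n) (Y : Set D) : Prop := ∀ a ∈ Y, ∀ b ∈ Y, gen S.α S.φ a b

/-- `Y` is closed under the structure maps. -/
def Closed (S : Picture D G n) (Y : Set D) : Prop := (∀ d ∈ Y, S.φ d ∈ Y) ∧ ∀ d ∈ Y, S.α d ∈ Y

/-- The Euler characteristic of `Y` is at least two. -/
def Planar (S : Picture D G n) (Y : Set D) : Prop :=
  Y.ncard + 4 ≤ 2 * (cls (sc S.φ) Y + cls (sc S.σ) Y)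

/-- Cut and reglue at the corners `x` and `y`. -/
def cut [DecidableEq D] (S : Picture D G n) (x y : D) : Picture D G n :=
  { S with
    φ := S.φ * swap x y
    ℓ := Function.update (Function.update S.ℓ x (S.ℓ x * S.ℓ y)) y 1 }

theorem Closed.σ_mem {S : Picture D G n} {Y : Set D} (h : S.Closed Y) {d : D} (hd : d ∈ Y) :
    S.σ d ∈ Y := h.2 _ (h.1 _ hd)

section Topology

variable [Finite D] [DecidableEq D] {S : Picture D G n} {Y : Set D} {x y : D}

omit [Finite D] in
theorem cut_σ : (S.cut x y).σ = S.σ * swap x y := (mul_assoc _ _ _).symm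

omit [Finite D] in
theorem cut_σ_left : (S.cut x y).σ x = S.σ y := by simp [cut_σ]

omit [Finite D] in
theorem cut_σ_right : (S.cut x y).σ y = S.σ x := by simp [cut_σ]

omit [Finite D] in
theorem cut_σ_of_ne {d : D} (hx : d ≠ x) (hy : d ≠ y) : (S.cut x y).σ d = S.σ d := by
  simp [cut_σ, swap_apply_of_ne_of_ne hx hy]

omit [Finite D] in
theorem cut_φ_of_ne {d : D} (hx : d ≠ x) (hy : d ≠ y) : (S.cut x y).φ d = S.φ d := by
  simp [cut, swap_apply_of_ne_of_ne hx hy]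

omit [Finite D] [DecidableEq D] in
theorem sc_σ_le_gen (S : Picture D G n) : sc S.σ ≤ gen S.α S.φ := sc_mul_le_gen _ _

omit [Finite D] in
theorem Closed.cut (h : S.Closed Y) (hx : x ∈ Y) (hy : y ∈ Y) : (S.cut x y).Closed Y := by
  refine ⟨fun d hd => ?_, h.2⟩
  change S.φ (swap x y d) ∈ Y
  apply h.1
  rw [swap_apply_def]
  split_ifs <;> assumption

omit [Finite D] in
theorem gen_le_cut (h : gen (S.cut x y).α (S.cut x y).φ x y) :
    gen S.α S.φ ≤ gen (S.cut x y).α (S.cut x y).φ := by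
  have hr := gen_right (S.cut x y).α (S.cut x y).φ
  have hsymm : ∀ {a b}, gen (S.cut x y).α (S.cut x y).φ a b → _ :=
    (gen (S.cut x y).α (S.cut x y).φ).symm
  have htrans : ∀ {a b c}, gen (S.cut x y).α (S.cut x y).φ a b →
    gen (S.cut x y).α (S.cut x y).φ b c → _ := (gen (S.cut x y).α (S.cut x y).φ).trans
  refine gen_le (gen_left (S.cut x y).α _) fun d => ?_
  by_cases hdx : d = x
  · subst hdx
    have := hr y
    simp only [Picture.cut, Perm.mul_apply, swap_apply_right] at this
    exact htrans h this
  by_cases hdy : d = y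
  · subst hdy
    have := hr x
    simp only [Picture.cut, Perm.mul_apply, swap_apply_left] at this
    exact htrans (hsymm h) this
  have := hr d
  rwa [cut_φ_of_ne hdx hdy] at this

omit [Finite D] in
theorem Conn.cut (hc : S.Conn Y) (h : gen (S.cut x y).α (S.cut x y).φ x y) :
    (S.cut x y).Conn Y := fun a ha b hb => gen_le_cut h (hc a ha b hb)

theorem conn_planar_cut_of_not_face (hc : S.Conn Y) (hp : S.Planar Y) (hx : x ∈ Y) (hy : y ∈ Y)
    (hxy : x ≠ y) (hφ : ¬ sc S.φ x y) (hσ : sc S.σ x y) :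
    (S.cut x y).Conn Y ∧ (S.cut x y).Planar Y := by
  constructor
  · exact hc.cut ((le_sup_right : sc _ ≤ gen _ _) (sc_mul_swap_of_not hφ))
  · have h1 := cls_mul_swap_of_not hx hy hφ
    have h2 := cls_mul_swap hx hy hσ hxy
    unfold Planar at hp ⊢
    rw [cut_σ]
    change _ ≤ 2 * (cls (sc (S.φ * swap x y)) Y + _)
    omega

theorem conn_planar_cut_of_not_vertex (hc : S.Conn Y) (hp : S.Planar Y) (hx : x ∈ Y)
    (hy : y ∈ Y) (hxy : x ≠ y) (hφ : sc S.φ x y) (hσ : ¬ sc S.σ x y) :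
    (S.cut x y).Conn Y ∧ (S.cut x y).Planar Y := by
  constructor
  · refine hc.cut (sc_σ_le_gen (S.cut x y) ?_)
    rw [cut_σ]
    exact sc_mul_swap_of_not hσ
  · have h1 := cls_mul_swap hx hy hφ hxy
    have h2 := cls_mul_swap_of_not hx hy hσ
    unfold Planar at hp ⊢
    rw [cut_σ]
    change _ ≤ 2 * (cls (sc (S.φ * swap x y)) Y + _)
    omega

theorem euler (hY : S.Closed Y) (hα : ∀ d, S.α (S.α d) = d) :
    2 * (cls (sc S.φ) Y + cls (sc S.σ) Y) ≤ Y.ncard + 4 * cls (gen S.α S.φ) Y := by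
  have h1 := OneRelator.euler S.φ Y hY.1 S.α hY.2
  have h2 := ncard_le_two_mul_cls (Y := Y) hα
  change _ + _ + cls (sc S.σ) Y ≤ _ at h1
  omega

theorem split (hY : S.Closed Y) (hα : ∀ d, S.α (S.α d) = d) (hc : S.Conn Y) (hp : S.Planar Y)
    (hx : x ∈ Y) (hy : y ∈ Y) (hxy : x ≠ y) (hφ : sc S.φ x y) (hσ : sc S.σ x y) :
    ∃ Y₁ Y₂ : Set D, Y = Y₁ ∪ Y₂ ∧ Disjoint Y₁ Y₂ ∧ x ∈ Y₁ ∧ y ∈ Y₂ ∧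
      (S.cut x y).Closed Y₁ ∧ (S.cut x y).Closed Y₂ ∧ (S.cut x y).Conn Y₁ ∧
      (S.cut x y).Conn Y₂ ∧ (S.cut x y).Planar Y₁ ∧ (S.cut x y).Planar Y₂ := by
  have h1 : cls (sc (S.cut x y).φ) Y = _ := cls_mul_swap hx hy hφ hxy
  have h2 := cls_mul_swap hx hy hσ hxy
  rw [← cut_σ] at h2
  have hY' := hY.cut hx hy
  set S' := S.cut x y with hS'
  set r := gen S'.α S'.φ with hr
  have hE : _ ≤ Y.ncard + 4 * cls r Y := euler (S := S') hY' hα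
  unfold Planar at hp
  have hle : ∀ a ∈ Y, r x a ∨ r y a := by
    have : gen S.α S.φ ≤ merge r x y := by
      refine gen_le (fun d => le_merge _ _ _ (gen_left S'.α _ d)) fun d => ?_
      have hm : ∀ {a b c}, merge r x y a b → merge r x y b c → _ := (merge r x y).trans
      have hrr : ∀ d, r d (S'.φ d) := gen_right S'.α S'.φ
      have hφ' : S.φ d = S'.φ (swap x y d) := by simp [hS', cut]
      rw [hφ']
      refine hm ?_ (le_merge _ _ _ (hrr _))
      rw [swap_apply_def]
      split_ifs with h3 h4
      · rw [h3]
        exact merge_rel _ _ _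
      · rw [h4]
        exact (merge r x y).symm (merge_rel _ _ _)
      · exact (merge r x y).refl _
    intro a ha
    rcases this (hc x hx a ha) with h | ⟨-, h | h⟩
    · exact Or.inl h
    · exact Or.inl (r.symm h)
    · exact Or.inr (r.symm h)
  have hnot : ¬ r x y := by
    intro h
    have : cls r Y ≤ 1 := by
      apply cls_le_one
      have : ∀ a ∈ Y, r x a := fun a ha => (hle a ha).elim id (r.trans h)
      exact fun a ha b hb => r.trans (r.symm (this a ha)) (this b hb)
    omega
  have hU : Y = {d ∈ Y | r x d} ∪ {d ∈ Y | r y d} := by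
    ext d
    simp only [Set.mem_union, Set.mem_ofPred_eq, ← and_or_left]
    exact ⟨fun h => ⟨h, hle d h⟩, fun h => h.1⟩
  have hdisj : ∀ a ∈ {d ∈ Y | r x d}, ∀ b ∈ {d ∈ Y | r y d}, ¬ r a b :=
    fun a ha b hb h => hnot (r.trans ha.2 (r.trans h (r.symm hb.2)))
  have hcl : ∀ z, S'.Closed {d ∈ Y | r z d} := fun z =>
    ⟨fun d hd => ⟨hY'.1 d hd.1, r.trans hd.2 (gen_right _ _ d)⟩,
      fun d hd => ⟨hY'.2 d hd.1, r.trans hd.2 (gen_left _ _ d)⟩⟩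
  have hcon : ∀ z, S'.Conn {d ∈ Y | r z d} := fun z a ha b hb => r.trans (r.symm ha.2) hb.2
  have hD : Disjoint {d ∈ Y | r x d} {d ∈ Y | r y d} := by
    rw [Set.disjoint_left]
    exact fun a ha hb => hdisj a ha a hb (r.refl a)
  have e1 := euler (S := S') (hcl x) hα
  have e2 := euler (S := S') (hcl y) hα
  have c1 := cls_le_one (hcon x)
  have c2 := cls_le_one (hcon y)
  have u1 := cls_union (r := sc S'.φ) fun a ha b hb h =>
    hdisj a ha b hb ((le_sup_right : _ ≤ gen S'.α S'.φ) h)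
  have u2 := cls_union (r := sc S'.σ) fun a ha b hb h => hdisj a ha b hb (sc_σ_le_gen S' h)
  have u3 := Set.ncard_union_eq hD
  rw [← hU] at u1 u2 u3
  refine ⟨_, _, hU, hD, ⟨hx, r.refl x⟩, ⟨hy, r.refl y⟩, hcl x, hcl y, hcon x, hcon y, ?_, ?_⟩ <;>
  · unfold Planar
    omega

end Topology

end Picture

end OneRelator

/-! ### Cutting a planar picture at a defect -/

namespace OneRelator

open Equiv Equiv.Perm

variable {D G : Type*} [Group G] {w : CyclicWord G}

namespace Picture

/-- The darts of `W` bound faces reading the cyclic word, in one of the two directions. -/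
structure Reads (w : CyclicWord G) (S : Picture D G w.n) (W : Set D) : Prop where
  φ_mem : ∀ d ∈ W, S.φ d ∈ W
  sg_φ : ∀ d ∈ W, S.sg (S.φ d) = S.sg d
  pos_of_true : ∀ d ∈ W, S.sg d = true → S.pos (S.φ d) = S.pos d + 1
  pos_of_false : ∀ d ∈ W, S.sg d = false → S.pos (S.φ d) + 1 = S.pos d
  ℓ_of_true : ∀ d ∈ W, S.sg d = true → S.ℓ d = w.x (S.pos d)
  ℓ_of_false : ∀ d ∈ W, S.sg d = false → S.ℓ d = (w.x (S.pos (S.φ d)))⁻¹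
  τ_of_true : ∀ d ∈ W, S.sg d = true → S.τ d = w.par (S.pos d)
  τ_of_false : ∀ d ∈ W, S.sg d = false → S.τ d = w.par (S.pos (S.φ d))
  period : ∀ d ∈ W, (S.φ ^ w.n) d = d

/-- The basic structure of a picture on the set of darts `Y` in which the darts of `W` read the
cyclic word. -/
structure Base (w : CyclicWord G) (S : Picture D G w.n) (Y W : Set D) : Prop where
  closed : S.Closed Y
  αα : ∀ d, S.α (S.α d) = d
  αne : ∀ d, S.α d ≠ d
  τφ : ∀ d, S.τ (S.φ d) = !S.τ d
  τα : ∀ d, S.τ (S.α d) = !S.τ d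
  mem : ∀ d, S.ℓ d ∈ w.P (S.τ d)
  reads : S.Reads w W

theorem Reads.congr {S S' : Picture D G w.n} {W W' : Set D} (h : S.Reads w W) (hW : W' ⊆ W)
    (hτ : S'.τ = S.τ) (hpos : S'.pos = S.pos) (hsg : S'.sg = S.sg)
    (hφ : ∀ d ∈ W', S'.φ d = S.φ d) (hℓ : ∀ d ∈ W', S'.ℓ d = S.ℓ d)
    (hcl : ∀ d ∈ W', S.φ d ∈ W') : S'.Reads w W' where
  φ_mem d hd := by
    rw [hφ d hd]
    exact hcl d hd
  sg_φ d hd := by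
    rw [hφ d hd, hsg]
    exact h.sg_φ d (hW hd)
  pos_of_true d hd := by
    rw [hφ d hd, hsg, hpos]
    exact h.pos_of_true d (hW hd)
  pos_of_false d hd := by
    rw [hφ d hd, hsg, hpos]
    exact h.pos_of_false d (hW hd)
  ℓ_of_true d hd := by
    rw [hℓ d hd, hsg, hpos]
    exact h.ℓ_of_true d (hW hd)
  ℓ_of_false d hd := by
    rw [hℓ d hd, hφ d hd, hsg, hpos]
    exact h.ℓ_of_false d (hW hd)
  τ_of_true d hd := by
    rw [hτ, hsg, hpos]
    exact h.τ_of_true d (hW hd)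
  τ_of_false d hd := by
    rw [hφ d hd, hτ, hsg, hpos]
    exact h.τ_of_false d (hW hd)
  period d hd := by
    have : ∀ i : ℕ, (S'.φ ^ i) d = (S.φ ^ i) d ∧ (S.φ ^ i) d ∈ W' := by
      intro i
      induction i with
      | zero => exact ⟨rfl, hd⟩
      | succ i ih =>
        rw [pow_succ', pow_succ', Perm.mul_apply, Perm.mul_apply, ih.1]
        exact ⟨hφ _ ih.2, hcl _ ih.2⟩
    rw [(this _).1]
    exact h.period d (hW hd)

theorem Base.restrict {S : Picture D G w.n} {Y Y' W : Set D} (h : S.Base w Y W)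
    (h' : S.Closed Y') : S.Base w Y' W := { h with closed := h' }

theorem Base.cut [DecidableEq D] {S : Picture D G w.n} {Y W W' : Set D} {x y : D}
    (h : S.Base w Y W) (hx : x ∈ Y) (hy : y ∈ Y) (hτ : S.τ x = S.τ y) (hW : W' ⊆ W)
    (hxW : x ∉ W') (hyW : y ∉ W') (hcl : ∀ d ∈ W', S.φ d ∈ W') :
    (S.cut x y).Base w Y W' where
  closed := h.closed.cut hx hy
  αα := h.αα
  αne := h.αne
  τφ d := by
    change S.τ (S.φ (swap x y d)) = !S.τ d
    rw [h.τφ, swap_apply_def]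
    split_ifs with h1 h2
    · rw [h1, hτ]
    · rw [h2, hτ]
    · rfl
  τα := h.τα
  mem d := by
    simp only [Picture.cut, Function.update_apply]
    split_ifs with h1 h2
    · exact one_mem _
    · rw [h2]
      exact mul_mem (h.mem x) (hτ ▸ h.mem y)
    · exact h.mem d
  reads := by
    refine h.reads.congr hW rfl rfl rfl (fun d hd => cut_φ_of_ne ?_ ?_) (fun d hd => ?_) hcl
    · rintro rfl
      exact hxW hd
    · rintro rfl
      exact hyW hd
    · simp only [Picture.cut]
      rw [Function.update_of_ne, Function.update_of_ne]
      · rintro rfl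
        exact hxW hd
      · rintro rfl
        exact hyW hd

section Defects

variable [DecidableEq D] {n : ℕ} {S : Picture D G n} {Y : Set D} {x y d₀ : D}

theorem defect_cut_left (hxy : x ≠ y) :
    (S.cut x y).Defect x ↔ S.t (S.σ y) ≠ S.t x * S.ℓ x * S.ℓ y := by
  rw [Defect, cut_σ_left]
  simp [cut, Function.update_of_ne hxy, mul_assoc]

theorem defect_cut_right : (S.cut x y).Defect y ↔ S.t (S.σ x) ≠ S.t y := by
  rw [Defect, cut_σ_right]
  simp [cut]

theorem defect_cut_of_ne {d : D} (hx : d ≠ x) (hy : d ≠ y) :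
    (S.cut x y).Defect d ↔ S.Defect d := by
  rw [Defect, Defect, cut_σ_of_ne hx hy]
  simp [cut, Function.update_of_ne hx, Function.update_of_ne hy]

theorem Sole.cut (h : S.Sole Y d₀) (hx : x ∈ Y) (hy : y ∈ Y) (hxy : x ≠ y)
    (ht : S.t (S.σ x) = S.t y) : ∃ d, (S.cut x y).Sole Y d := by
  obtain ⟨hd, hdef, huniq⟩ := h
  have hr : ¬ (S.cut x y).Defect y := by rw [defect_cut_right, ht]; simp
  have hl := defect_cut_left (S := S) hxy
  have hx' := huniq x hx
  have hy' := huniq y hy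
  simp only [Defect] at hx' hy'
  by_cases h0 : d₀ = x ∨ d₀ = y
  · refine ⟨x, hx, ?_, fun d hd' hdd => ?_⟩
    · rw [hl]
      rcases h0 with rfl | rfl
      · have : S.t (S.σ y) = S.t y * S.ℓ y := by
          by_contra hne
          exact hxy (hy' hne).symm
        rw [this, ← ht]
        exact fun h => hdef (mul_right_cancel h)
      · have : S.t (S.σ x) = S.t x * S.ℓ x := by
          by_contra hne
          exact hxy (hx' hne)
        rw [← this, ht]
        exact hdef
    · by_contra hdx
      have hdy : d ≠ y := by
        rintro rfl
        exact hr hdd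
      rw [defect_cut_of_ne hdx hdy] at hdd
      have := huniq d hd' hdd
      rcases h0 with rfl | rfl <;> contradiction
  · push Not at h0
    refine ⟨d₀, hd, (defect_cut_of_ne h0.1 h0.2).2 hdef, fun d hd' hdd => ?_⟩
    by_cases hdy : d = y
    · exact absurd hdd (hdy ▸ hr)
    by_cases hdx : d = x
    · subst hdx
      exfalso
      have h1 : S.t (S.σ d) = S.t d * S.ℓ d := by
        by_contra hne
        exact h0.1 (hx' hne).symm
      have h2 : S.t (S.σ y) = S.t y * S.ℓ y := by
        by_contra hne
        exact h0.2 (hy' hne).symm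
      rw [hl, h2, ← h1, ht] at hdd
      exact hdd rfl
    · exact huniq d hd' ((defect_cut_of_ne hdx hdy).1 hdd)

theorem Sole.split {Y₁ Y₂ : Set D} (h : S.Sole Y d₀) (hY : Y = Y₁ ∪ Y₂) (hd : Disjoint Y₁ Y₂)
    (hx : x ∈ Y₁) (hy : y ∈ Y₂) :
    (∃ d, (S.cut x y).Sole Y₁ d) ∨ ∃ d, (S.cut x y).Sole Y₂ d := by
  have hxy : x ≠ y := by
    rintro rfl
    exact Set.disjoint_left.1 hd hx hy
  have hl := defect_cut_left (S := S) hxy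
  have hr := defect_cut_right (S := S) (x := x) (y := y)
  obtain ⟨hd0, hdef, huniq⟩ := h
  have hx' : S.Defect x → x = d₀ := huniq x (hY ▸ Or.inl hx)
  have hy' : S.Defect y → y = d₀ := huniq y (hY ▸ Or.inr hy)
  have hother : ∀ d ∈ Y, d ≠ x → d ≠ y → (S.cut x y).Defect d → d = d₀ := fun d hd h1 h2 h3 =>
    huniq d hd ((defect_cut_of_ne h1 h2).1 h3)
  have hyY₁ : ∀ d ∈ Y₁, d ≠ y := by
    rintro d h1 rfl
    exact Set.disjoint_left.1 hd h1 hy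
  have hxY₂ : ∀ d ∈ Y₂, d ≠ x := by
    rintro d h1 rfl
    exact Set.disjoint_left.1 hd hx h1
  have hY₁ : Y₁ ⊆ Y := hY ▸ Set.subset_union_left
  have hY₂ : Y₂ ⊆ Y := hY ▸ Set.subset_union_right
  simp only [Defect] at hx' hy'
  have hone : ∀ e, (e = x ∨ e = y) → d₀ = e →
      (S.cut x y).Defect x ∨ (S.cut x y).Defect y := by
    rintro e he rfl
    rw [hl, hr]
    by_contra! hcon
    obtain ⟨h1, h2⟩ := hcon
    rcases he with rfl | rfl
    · have : S.t (S.σ y) = S.t y * S.ℓ y := by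
        by_contra hne
        exact hxy (hy' hne).symm
      rw [this] at h1
      exact hdef (h2.trans (mul_right_cancel h1))
    · have : S.t (S.σ x) = S.t x * S.ℓ x := by
        by_contra hne
        exact hxy (hx' hne)
      rw [← this, h2] at h1
      exact hdef h1
  by_cases h0 : d₀ = x ∨ d₀ = y
  · have hoth : ∀ d ∈ Y, d ≠ x → d ≠ y → ¬ (S.cut x y).Defect d := fun d hd h1 h2 h3 => by
      have := hother d hd h1 h2 h3
      rcases h0 with rfl | rfl <;> contradiction
    have : (S.cut x y).Defect x ∨ (S.cut x y).Defect y :=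
      h0.elim (hone x (Or.inl rfl)) (hone y (Or.inr rfl))
    rcases this with h1 | h1
    · refine Or.inl ⟨x, hx, h1, fun d hd' hdd => ?_⟩
      by_contra hne
      exact hoth d (hY₁ hd') hne (hyY₁ d hd') hdd
    · refine Or.inr ⟨y, hy, h1, fun d hd' hdd => ?_⟩
      by_contra hne
      exact hoth d (hY₂ hd') (hxY₂ d hd') hne hdd
  · push Not at h0
    have h1 : S.t (S.σ x) = S.t x * S.ℓ x := by
      by_contra hne
      exact h0.1 (hx' hne).symm
    have h2 : S.t (S.σ y) = S.t y * S.ℓ y := by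
      by_contra hne
      exact h0.2 (hy' hne).symm
    have hd0' : (S.cut x y).Defect d₀ := (defect_cut_of_ne h0.1 h0.2).2 hdef
    have hiff : (S.cut x y).Defect x ↔ (S.cut x y).Defect y := by
      rw [hl, hr, h2, h1]
      constructor
      · intro h h'
        exact h (by rw [h'])
      · intro h h'
        exact h (mul_right_cancel h').symm
    by_cases hxd : (S.cut x y).Defect x
    · have hyd := hiff.1 hxd
      rw [hY] at hd0
      rcases hd0 with hd0 | hd0
      · refine Or.inr ⟨y, hy, hyd, fun d hd' hdd => ?_⟩
        by_contra hne
        have := hother d (hY₂ hd') (hxY₂ d hd') hne hdd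
        subst this
        exact Set.disjoint_left.1 hd hd0 hd'
      · refine Or.inl ⟨x, hx, hxd, fun d hd' hdd => ?_⟩
        by_contra hne
        have := hother d (hY₁ hd') hne (hyY₁ d hd') hdd
        subst this
        exact Set.disjoint_left.1 hd hd' hd0
    · have hyd : ¬ (S.cut x y).Defect y := fun h => hxd (hiff.2 h)
      have hall : ∀ d ∈ Y, (S.cut x y).Defect d → d = d₀ := by
        intro d hd' hdd
        by_cases h3 : d = x
        · exact absurd (h3 ▸ hdd) hxd
        by_cases h4 : d = y
        · exact absurd (h4 ▸ hdd) hyd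
        exact hother d hd' h3 h4 hdd
      rw [hY] at hd0
      rcases hd0 with hd0 | hd0
      · exact Or.inl ⟨d₀, hd0, hd0', fun d hd' => hall d (hY₁ hd')⟩
      · exact Or.inr ⟨d₀, hd0, hd0', fun d hd' => hall d (hY₂ hd')⟩

open Classical in
/-- Translate the potential on the vertex of `y`. -/
noncomputable def shift (S : Picture D G n) (g : G) (y : D) : Picture D G n :=
  { S with t := fun d => if sc S.σ y d then g * S.t d else S.t d }

open Classical in
omit [DecidableEq D] in
theorem defect_shift (g : G) (d : D) : (S.shift g y).Defect d ↔ S.Defect d := by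
  change (if sc S.σ y (S.σ d) then g * S.t (S.σ d) else S.t (S.σ d)) ≠
    (if sc S.σ y d then g * S.t d else S.t d) * S.ℓ d ↔ _
  have : sc S.σ y (S.σ d) ↔ sc S.σ y d :=
    ⟨fun h => (sc S.σ).trans h ((sc S.σ).symm (sc_self S.σ d)),
      fun h => (sc S.σ).trans h (sc_self S.σ d)⟩
  by_cases h : sc S.σ y d
  · rw [if_pos h, if_pos (this.2 h), mul_assoc, Ne, mul_left_cancel_iff]
    rfl
  · rw [if_neg h, if_neg (mt this.1 h)]
    rfl

end Defects

end Picture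

end OneRelator

/-! ### Removing a digon -/

namespace OneRelator

open Equiv Equiv.Perm

variable {D G : Type*} [Group G] {w : CyclicWord G}

namespace Picture

variable [Finite D] [DecidableEq D]

/-- Remove the digon with corners `p` and `q`, gluing its two neighbours to each other. -/
def undigon {n : ℕ} (S : Picture D G n) (p q : D) : Picture D G n :=
  { S with α := swap (S.α p) q * S.α * swap (S.α p) q }

set_option maxHeartbeats 1000000 in
theorem digon {S : Picture D G w.n} {Y W : Set D} {p q d₀ : D} (hB : S.Base w Y W)
    (hc : S.Conn Y) (hp : S.Planar Y) (hs : S.Sole Y d₀) (hpY : p ∈ Y) (hqY : q ∈ Y)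
    (hpq : S.φ p = q) (hqp : S.φ q = p) (hℓp : S.ℓ p = 1) (hℓq : S.ℓ q = 1) :
    (S.undigon p q).Base w (Y \ {p, q}) W ∧ (S.undigon p q).Conn (Y \ {p, q}) ∧
      (S.undigon p q).Planar (Y \ {p, q}) ∧ ∃ d, (S.undigon p q).Sole (Y \ {p, q}) d := by
  have hαα := hB.αα
  have hne : p ≠ q := by
    intro h
    have := hB.τφ p
    rw [hpq, ← h] at this
    simp at this
  -- the two sides of the digon are not glued to each other
  have hαpq : S.α p ≠ q := by
    intro h
    have hαq : S.α q = p := by rw [← h, hαα]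
    have hY : ∀ d, gen S.α S.φ p d → d ∈ ({p, q} : Set D) := by
      intro d hd
      refine mem_of_gen (a := S.α) (f := S.φ) ?_ ?_ (Or.inl rfl) hd
      · rintro d (rfl | rfl)
        · exact Or.inr h
        · exact Or.inl hαq
      · rintro d (rfl | rfl)
        · exact Or.inr hpq
        · exact Or.inl hqp
    obtain ⟨hd, hdef, -⟩ := hs
    rcases hY d₀ (hc p hpY d₀ hd) with rfl | rfl
    · apply hdef
      rw [σ_apply, hpq, hαq, hℓp, mul_one]
    · apply hdef
      rw [σ_apply, hqp, h, hℓq, mul_one]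
  obtain ⟨p', hp'⟩ : ∃ p', p' = S.α p := ⟨_, rfl⟩
  obtain ⟨q', hq'⟩ : ∃ q', q' = S.α q := ⟨_, rfl⟩
  have hαp' : S.α p' = p := by rw [hp', hαα]
  have hαq' : S.α q' = q := by rw [hq', hαα]
  have h1 : p' ≠ p := hp' ▸ hB.αne p
  have h2 : p' ≠ q := hp' ▸ hαpq
  have h3 : q' ≠ q := hq' ▸ hB.αne q
  have h4 : q' ≠ p := by
    rintro rfl
    exact h2 (by rw [hp', hαq'])
  have h5 : p' ≠ q' := by
    intro h
    exact hne (by rw [← hαp', h, hαq'])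
  obtain ⟨u, hu⟩ : ∃ u, S.φ u = p' := S.φ.surjective p'
  obtain ⟨v, hv⟩ : ∃ v, S.φ v = q' := S.φ.surjective q'
  have huv : u ≠ v := by
    rintro rfl
    exact h5 (hu ▸ hv)
  have hup : u ≠ p := by
    rintro rfl
    exact h2 (by rw [← hu, hpq])
  have huq : u ≠ q := by
    rintro rfl
    exact h1 (by rw [← hu, hqp])
  have hvp : v ≠ p := by
    rintro rfl
    exact h3 (by rw [← hv, hpq])
  have hvq : v ≠ q := by
    rintro rfl
    exact h4 (by rw [← hv, hqp])
  have hp'Y : p' ∈ Y := hp' ▸ hB.closed.2 _ hpY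
  have hq'Y : q' ∈ Y := hq' ▸ hB.closed.2 _ hqY
  have hmemφ : ∀ {d}, S.φ d ∈ Y → d ∈ Y := fun h => by
    simpa using inv_mem hB.closed.1 h
  have huY : u ∈ Y := hmemφ (hu ▸ hp'Y)
  have hvY : v ∈ Y := hmemφ (hv ▸ hq'Y)
  have hα' : ∀ d, (S.undigon p q).α d = swap p' q (S.α (swap p' q d)) := fun d => by
    rw [hp']
    rfl
  have hα'p' : (S.undigon p q).α p' = q' := by
    rw [hα', swap_apply_left, ← hq', swap_apply_of_ne_of_ne h5.symm h3]
  have hα'q' : (S.undigon p q).α q' = p' := by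
    rw [hα', swap_apply_of_ne_of_ne h5.symm h3, hαq', swap_apply_right]
  have hα'o : ∀ d, d ≠ p → d ≠ q → d ≠ p' → d ≠ q' → (S.undigon p q).α d = S.α d := by
    intro d e1 e2 e3 e4
    rw [hα', swap_apply_of_ne_of_ne e3 e2, swap_apply_of_ne_of_ne]
    · intro h
      exact e1 (by rw [← hαα d, h, hαp'])
    · intro h
      exact e4 (by rw [← hαα d, h, hq'])
  have hαmem : ∀ d, S.α d = p ∨ S.α d = q → d = p' ∨ d = q' := by
    rintro d (h | h)
    · exact Or.inl (by rw [← hαα d, h, hp'])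
    · exact Or.inr (by rw [← hαα d, h, hq'])
  have hφmem : ∀ d, S.φ d = p ∨ S.φ d = q → d = q ∨ d = p := by
    rintro d (h | h)
    · exact Or.inl (S.φ.injective (h.trans hqp.symm))
    · exact Or.inr (S.φ.injective (h.trans hpq.symm))
  have hclosed : (S.undigon p q).Closed (Y \ {p, q}) := by
    constructor
    · rintro d ⟨hd, hd'⟩
      refine ⟨hB.closed.1 d hd, fun h => hd' (hφmem d h).symm⟩
    · rintro d ⟨hd, hd'⟩
      by_cases e3 : d = p'
      · subst e3
        rw [hα'p']
        exact ⟨hq'Y, fun h => h.elim h4 h3⟩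
      by_cases e4 : d = q'
      · subst e4
        rw [hα'q']
        exact ⟨hp'Y, fun h => h.elim h1 h2⟩
      rw [hα'o d (fun h => hd' (Or.inl h)) (fun h => hd' (Or.inr h)) e3 e4]
      exact ⟨hB.closed.2 d hd, fun h => (hαmem d h).elim e3 e4⟩
  have hσ : (S.undigon p q).σ = S.σ * swap q v * swap u p := by
    have e1 : S.α * swap q' p = swap q p' * S.α := by
      rw [mul_swap_eq_swap_mul, hαq', ← hp']
    have e2 : S.φ * swap q v = swap p q' * S.φ := by
      rw [mul_swap_eq_swap_mul, hqp, hv]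
    have e3 : S.φ * swap u p = swap p' q * S.φ := by
      rw [mul_swap_eq_swap_mul, hpq, hu]
    calc (S.undigon p q).σ = swap p' q * S.α * swap p' q * S.φ := by rw [hp']; rfl
      _ = (swap q p' * S.α) * (swap p' q * S.φ) := by rw [swap_comm q p']; group
      _ = S.α * (swap p q' * (S.φ * swap u p)) := by
        rw [← e1, ← e3, swap_comm q' p]; group
      _ = S.α * (swap p q' * S.φ) * swap u p := by group
      _ = _ := by
        rw [← e2]
        rfl
  have hσu : (S.undigon p q).σ u = S.σ p := by
    rw [hσ]
    simp [swap_apply_of_ne_of_ne hne hvp.symm]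
  have hσv : (S.undigon p q).σ v = S.σ q := by
    rw [hσ]
    simp [swap_apply_of_ne_of_ne huv.symm hvp]
  have hσo : ∀ d, d ≠ p → d ≠ q → d ≠ u → d ≠ v → (S.undigon p q).σ d = S.σ d := by
    intro d e1 e2 e3 e4
    rw [hσ]
    simp [swap_apply_of_ne_of_ne e3 e1, swap_apply_of_ne_of_ne e2 e4]
  have hσu' : S.σ u = p := by rw [σ_apply, hu, hαp']
  have hσv' : S.σ v = q := by rw [σ_apply, hv, hαq']
  refine ⟨⟨hclosed, ?_, ?_, hB.τφ, ?_, hB.mem, hB.reads.congr subset_rfl rfl rfl rfl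
    (fun _ _ => rfl) (fun _ _ => rfl) hB.reads.φ_mem⟩, ?_, ?_, ?_⟩
  · intro d
    rw [hα', hα', swap_apply_self, hαα, swap_apply_self]
  · intro d h
    rw [hα'] at h
    have := congrArg (swap p' q) h
    rw [swap_apply_self] at this
    exact hB.αne _ this
  · intro d
    have hτ : S.τ p' = S.τ q := by rw [hp', hB.τα, ← hpq, hB.τφ]
    have hsw : ∀ d, S.τ (swap p' q d) = S.τ d := by
      intro d
      rw [swap_apply_def]
      split_ifs with e1 e2
      · rw [e1, hτ]
      · rw [e2, hτ]
      · rfl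
    change S.τ ((S.undigon p q).α d) = !S.τ d
    rw [hα', hsw, hB.τα, hsw]
  · -- connectedness
    set r := gen (S.undigon p q).α (S.undigon p q).φ with hr
    let π : D → D := fun d => if d = p ∨ d = q then p' else d
    have hπp : π p = p' := if_pos (Or.inl rfl)
    have hπq : π q = p' := if_pos (Or.inr rfl)
    have hπ : ∀ d, d ≠ p → d ≠ q → π d = d := fun d e1 e2 => if_neg (not_or.2 ⟨e1, e2⟩)
    have hp'q' : r p' q' := hα'p' ▸ gen_left (S.undigon p q).α (S.undigon p q).φ p'
    have hle : gen S.α S.φ ≤ r.comap π := by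
      apply gen_le
      · intro d
        change r (π d) (π (S.α d))
        by_cases e1 : d = p
        · subst e1
          rw [← hp', hπp, hπ p' h1 h2]
        by_cases e2 : d = q
        · subst e2
          rw [← hq', hπq, hπ q' h4 h3]
          exact hp'q'
        by_cases e3 : d = p'
        · subst e3
          rw [hαp', hπp, hπ d h1 h2]
        by_cases e4 : d = q'
        · subst e4
          rw [hαq', hπq, hπ d h4 h3]
          exact r.symm hp'q'
        have := gen_left (S.undigon p q).α (S.undigon p q).φ d
        rw [hα'o d e1 e2 e3 e4] at this
        rw [hπ d e1 e2, hπ (S.α d)]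
        · exact this
        · exact fun h => (hαmem d (Or.inl h)).elim e3 e4
        · exact fun h => (hαmem d (Or.inr h)).elim e3 e4
      · intro d
        change r (π d) (π (S.φ d))
        by_cases e1 : d = p
        · subst e1
          rw [hpq, hπp, hπq]
        by_cases e2 : d = q
        · subst e2
          rw [hqp, hπp, hπq]
        rw [hπ d e1 e2, hπ (S.φ d)]
        · exact gen_right _ _ d
        · exact fun h => (hφmem d (Or.inl h)).elim e2 e1
        · exact fun h => (hφmem d (Or.inr h)).elim e2 e1
    rintro a ⟨ha, ha'⟩ b ⟨hb, hb'⟩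
    have : r (π a) (π b) := hle (hc a ha b hb)
    rwa [hπ a (fun h => ha' (Or.inl h)) (fun h => ha' (Or.inr h)),
      hπ b (fun h => hb' (Or.inl h)) (fun h => hb' (Or.inr h))] at this
  · -- planarity
    have hU : Y = (Y \ {p, q}) ∪ {p, q} := by
      rw [Set.sdiff_union_of_subset]
      rintro d (rfl | rfl) <;> assumption
    have hcl2 : ∀ f : Perm D, (∀ d ∈ ({p, q} : Set D), f d ∈ ({p, q} : Set D)) →
        cls (sc f) Y = cls (sc f) (Y \ {p, q}) + cls (sc f) {p, q} := by
      intro f hf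
      have := cls_union (r := sc f) (Y := Y \ {p, q}) (Z := {p, q}) (fun a ha b hb h =>
        ha.2 (mem_of_sc hf hb ((sc f).symm h)))
      rwa [← hU] at this
    have c1 := hcl2 S.φ (by rintro d (rfl | rfl) <;> simp [hpq, hqp])
    have hσp : (S.undigon p q).σ p = p := by
      change (S.undigon p q).α (S.φ p) = p
      rw [hpq, hα', swap_apply_right, hαp', swap_apply_of_ne_of_ne h1.symm hne]
    have hσq : (S.undigon p q).σ q = q := by
      change (S.undigon p q).α (S.φ q) = q
      rw [hqp, hα', swap_apply_of_ne_of_ne h1.symm hne, ← hp', swap_apply_left]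
    have c2 := hcl2 (S.undigon p q).σ (by rintro d (rfl | rfl) <;> simp [hσp, hσq])
    have c3 : cls (sc S.φ) {p, q} ≤ 1 := by
      have : sc S.φ p q := hpq ▸ sc_self S.φ p
      apply cls_le_one
      rintro a (rfl | rfl) b (rfl | rfl)
      · exact (sc S.φ).refl _
      · exact this
      · exact (sc S.φ).symm this
      · exact (sc S.φ).refl _
    have c4 : cls (sc (S.undigon p q).σ) {p, q} ≤ 2 :=
      (cls_le_ncard _ _).trans (Set.ncard_pair hne).le
    have c5 : cls (sc (S.undigon p q).σ) Y = cls (sc S.σ) Y + 1 + 1 := by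
      have e1 : sc S.σ q v := (sc S.σ).symm (hσv' ▸ sc_self S.σ v)
      rw [hσ, cls_mul_swap huY hpY _ hup, cls_mul_swap hqY hvY e1 hvq.symm]
      have := sc_self (S.σ * swap q v) u
      rw [Perm.mul_apply, swap_apply_of_ne_of_ne huq huv, hσu'] at this
      exact this
    have c6 : Y.ncard = (Y \ {p, q}).ncard + 2 := by
      rw [← Set.ncard_pair hne, ← Set.ncard_union_eq Set.disjoint_sdiff_left, ← hU]
    unfold Planar at hp ⊢
    change _ ≤ 2 * (cls (sc S.φ) _ + _)
    omega
  · -- the defect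
    obtain ⟨hd, hdef, huniq⟩ := hs
    have hxu := huniq u huY
    have hxv := huniq v hvY
    have hxp := huniq p hpY
    have hxq := huniq q hqY
    have hDu : (S.undigon p q).Defect u ↔ S.t (S.σ p) ≠ S.t u * S.ℓ u := by
      rw [Defect, hσu]
      rfl
    have hDv : (S.undigon p q).Defect v ↔ S.t (S.σ q) ≠ S.t v * S.ℓ v := by
      rw [Defect, hσv]
      rfl
    have hDo : ∀ d, d ≠ p → d ≠ q → d ≠ u → d ≠ v →
        ((S.undigon p q).Defect d ↔ S.Defect d) := by
      intro d e1 e2 e3 e4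
      rw [Defect, hσo d e1 e2 e3 e4]
      rfl
    have hSu : S.Defect u ↔ S.t p ≠ S.t u * S.ℓ u := by rw [Defect, hσu']
    have hSv : S.Defect v ↔ S.t q ≠ S.t v * S.ℓ v := by rw [Defect, hσv']
    have hSp : S.Defect p ↔ S.t (S.σ p) ≠ S.t p := by rw [Defect, hℓp, mul_one]
    have hSq : S.Defect q ↔ S.t (S.σ q) ≠ S.t q := by rw [Defect, hℓq, mul_one]
    have hu' : (S.undigon p q).Defect u ↔ (d₀ = u ∨ d₀ = p) := by
      by_cases e1 : S.Defect u
      · have e2 : ¬ S.Defect p := fun h => hup ((hxu e1).trans (hxp h).symm)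
        rw [hSp, not_not] at e2
        rw [hDu, e2, ← hSu]
        simp [e1, (hxu e1).symm]
      · by_cases e2 : S.Defect p
        · rw [hSu, not_not] at e1
          rw [hDu, ← e1, ← hSp]
          simp [e2, (hxp e2).symm]
        · have e3 : d₀ ≠ u := fun h => e1 (h ▸ hdef)
          have e4 : d₀ ≠ p := fun h => e2 (h ▸ hdef)
          rw [hSu, not_not] at e1
          rw [hSp, not_not] at e2
          simp [hDu, e1, e2, e3, e4]
    have hv' : (S.undigon p q).Defect v ↔ (d₀ = v ∨ d₀ = q) := by
      by_cases e1 : S.Defect v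
      · have e2 : ¬ S.Defect q := fun h => hvq ((hxv e1).trans (hxq h).symm)
        rw [hSq, not_not] at e2
        rw [hDv, e2, ← hSv]
        simp [e1, (hxv e1).symm]
      · by_cases e2 : S.Defect q
        · rw [hSv, not_not] at e1
          rw [hDv, ← e1, ← hSq]
          simp [e2, (hxq e2).symm]
        · have e3 : d₀ ≠ v := fun h => e1 (h ▸ hdef)
          have e4 : d₀ ≠ q := fun h => e2 (h ▸ hdef)
          rw [hSv, not_not] at e1
          rw [hSq, not_not] at e2
          simp [hDv, e1, e2, e3, e4]
    have hmem : ∀ d ∈ Y \ {p, q}, d ∈ Y ∧ d ≠ p ∧ d ≠ q := fun d hd =>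
      ⟨hd.1, fun h => hd.2 (Or.inl h), fun h => hd.2 (Or.inr h)⟩
    by_cases k1 : d₀ = u ∨ d₀ = p
    · refine ⟨u, ⟨huY, fun h => h.elim hup huq⟩, hu'.2 k1, fun d hd hdd => ?_⟩
      obtain ⟨m1, m2, m3⟩ := hmem d hd
      by_contra hdu
      by_cases hdv : d = v
      · have hdd' := hv'.1 (hdv ▸ hdd)
        exact k1.elim
          (fun h => hdd'.elim (fun h' => huv (h.symm.trans h')) fun h' => huq (h.symm.trans h'))
          (fun h => hdd'.elim (fun h' => hvp (h'.symm.trans h)) fun h' => hne (h.symm.trans h'))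
      · have := huniq d m1 ((hDo d m2 m3 hdu hdv).1 hdd)
        exact k1.elim (fun h => hdu (this.trans h)) fun h => m2 (this.trans h)
    by_cases k2 : d₀ = v ∨ d₀ = q
    · refine ⟨v, ⟨hvY, fun h => h.elim hvp hvq⟩, hv'.2 k2, fun d hd hdd => ?_⟩
      obtain ⟨m1, m2, m3⟩ := hmem d hd
      by_contra hdv
      by_cases hdu : d = u
      · exact k1 (hu'.1 (hdu ▸ hdd))
      · have := huniq d m1 ((hDo d m2 m3 hdu hdv).1 hdd)
        exact k2.elim (fun h => hdv (this.trans h)) fun h => m3 (this.trans h)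
    · have k3 : d₀ ≠ p ∧ d₀ ≠ q ∧ d₀ ≠ u ∧ d₀ ≠ v :=
        ⟨fun h => k1 (Or.inr h), fun h => k2 (Or.inr h), fun h => k1 (Or.inl h),
          fun h => k2 (Or.inl h)⟩
      refine ⟨d₀, ⟨hd, fun h => h.elim k3.1 k3.2.1⟩,
        (hDo d₀ k3.1 k3.2.1 k3.2.2.1 k3.2.2.2).2 hdef, fun d hd hdd => ?_⟩
      obtain ⟨m1, m2, m3⟩ := hmem d hd
      by_cases hdu : d = u
      · exact absurd (hu'.1 (hdu ▸ hdd)) k1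
      by_cases hdv : d = v
      · exact absurd (hv'.1 (hdv ▸ hdd)) k2
      exact huniq d m1 ((hDo d m2 m3 hdu hdv).1 hdd)

end Picture

end OneRelator

/-! ### Faces without defects and the freeness of the two subgroups -/

namespace OneRelator

open Equiv Equiv.Perm

variable {D G : Type*} [Group G] {w : CyclicWord G}

namespace Picture

/-- The list `L` enumerates, in cyclic order, one face with boundary label `1`, which is the only
face of `Y` outside `W`. -/
structure Hole {n : ℕ} (S : Picture D G n) (Y W : Set D) (L : List D) : Prop where
  nodup : L.Nodup
  cover : ∀ d ∈ Y, d ∉ W → d ∈ L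
  mem : ∀ d ∈ L, d ∈ Y ∧ d ∉ W
  map_φ : L.map S.φ = L.rotate 1
  prod : (L.map S.ℓ).prod = 1

theorem Hole.rotate {n : ℕ} {S : Picture D G n} {Y W : Set D} {L : List D}
    (h : S.Hole Y W L) (i : ℕ) : S.Hole Y W (L.rotate i) where
  nodup := List.nodup_rotate.2 h.nodup
  cover d hd hd' := List.mem_rotate.2 (h.cover d hd hd')
  mem d hd := h.mem d (List.mem_rotate.1 hd)
  map_φ := by rw [List.map_rotate, h.map_φ, List.rotate_rotate, List.rotate_rotate, add_comm]
  prod := by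
    rw [List.map_rotate]
    exact List.prod_rotate_eq_one_of_prod_eq_one h.prod i

theorem chain_of_map_rotate {φ : D → D} {L : List D} (h : L.map φ = L.rotate 1) :
    L.IsChain (fun a b => φ a = b) := by
  rw [List.isChain_iff_getElem]
  intro i hi
  have h1 : (L.map φ)[i]? = (L.rotate 1)[i]? := by rw [h]
  have hi' : i < L.length := by omega
  rw [List.getElem?_rotate hi', Nat.mod_eq_of_lt hi, List.getElem?_map,
    List.getElem?_eq_getElem hi', List.getElem?_eq_getElem hi] at h1
  simpa using h1

theorem exists_label_eq_one {S : Picture D G w.n} {Y W : Set D} {L : List D}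
    (hB : S.Base w Y W) (h : S.Hole Y W L) (hL : L ≠ []) : ∃ p ∈ L, S.ℓ p = 1 := by
  have hch := chain_of_map_rotate h.map_φ
  obtain ⟨e, he, he1⟩ := w.free (L.map fun d => (S.τ d, S.ℓ d)) (by simpa using hL)
    (by
      intro e he
      obtain ⟨d, -, rfl⟩ := List.mem_map.1 he
      exact hB.mem d)
    (by
      rw [List.isChain_map]
      refine hch.imp ?_
      rintro a b rfl
      change S.τ a ≠ S.τ (S.φ a)
      rw [hB.τφ]
      simp)
    (by
      rw [List.map_map]
      exact h.prod)
  obtain ⟨d, hd, rfl⟩ := List.mem_map.1 he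
  exact ⟨d, hd, he1⟩

theorem Reads.pow_mem {S : Picture D G w.n} {W : Set D} (h : S.Reads w W) {d : D} (hd : d ∈ W) :
    ∀ i : ℕ, (S.φ ^ i) d ∈ W := by
  intro i
  induction i with
  | zero => exact hd
  | succ i ih =>
    rw [pow_succ', Perm.mul_apply]
    exact h.φ_mem _ ih

theorem exists_pictures_without_hole [Finite D] (N : ℕ) : ∀ (S : Picture D G w.n) (Y W : Set D)
    (L : List D) (d₀ : D), Y.ncard ≤ N → S.Base w Y W → S.Conn Y → S.Planar Y → S.Sole Y d₀ →
    S.Hole Y W L → ∃ (S' : Picture D G w.n) (Y' : Set D) (d' : D), Y' ⊆ Y ∧ Y' ⊆ W ∧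
      S'.Base w Y' W ∧ S'.Conn Y' ∧ S'.Planar Y' ∧ S'.Sole Y' d' := by
  classical
  induction N with
  | zero =>
    intro S Y W L d₀ hN hB hc hp hs hL
    have : Y = ∅ := by
      rw [← Set.ncard_eq_zero (Set.toFinite Y)]
      omega
    exact absurd hs.1 (by rw [this]; exact fun h => h)
  | succ N ih =>
  intro S Y W L d₀ hN hB hc hp hs hL
  by_cases hL0 : L = []
  · subst hL0
    refine ⟨S, Y, d₀, subset_rfl, fun d hd => ?_, hB, hc, hp, hs⟩
    by_contra hdW
    simpa using hL.cover d hd hdW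
  -- rotate so that the label of the first corner is trivial
  obtain ⟨p, hpL, hp1⟩ := exists_label_eq_one hB hL hL0
  obtain ⟨L₁, L₂, rfl⟩ := List.append_of_mem hpL
  have hL' := hL.rotate L₁.length
  rw [List.rotate_append_length_eq] at hL'
  clear hL hpL hL0
  obtain ⟨K, hK⟩ : ∃ K, L₂ ++ L₁ = K := ⟨_, rfl⟩
  rw [List.cons_append, hK] at hL'
  clear hK L₁ L₂
  rename' hL' => hL
  have hrot := hL.map_φ
  rw [List.map_cons, List.rotate_cons_succ, List.rotate_zero] at hrot
  rcases K with _ | ⟨q, M⟩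
  · exfalso
    have h1 : S.φ p = p := by simpa using hrot
    have := hB.τφ p
    rw [h1] at this
    simp at this
  rw [List.map_cons, List.cons_append] at hrot
  obtain ⟨hpq, hrot⟩ := List.cons_eq_cons.1 hrot
  obtain ⟨hpY, hpW⟩ := hL.mem p (by simp)
  obtain ⟨hqY, hqW⟩ := hL.mem q (by simp)
  have hprod := hL.prod
  simp only [List.map_cons, List.prod_cons, hp1, one_mul] at hprod
  have hnd := hL.nodup
  rw [List.nodup_cons, List.nodup_cons] at hnd
  obtain ⟨hpK, hqM, hMnd⟩ := hnd
  have hpq_ne : p ≠ q := fun h => hpK (by simp [h])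
  rcases List.eq_nil_or_concat M with rfl | ⟨M', c, hM⟩
  · have hqp : S.φ q = p := by simpa using hrot
    have hq1 : S.ℓ q = 1 := by simpa using hprod
    obtain ⟨h1, h2, h3, d, h4⟩ := digon hB hc hp hs hpY hqY hpq hqp hp1 hq1
    refine ⟨_, _, d, Set.sdiff_subset, fun d hd => ?_, h1, h2, h3, h4⟩
    by_contra hdW
    have := hL.cover d hd.1 hdW
    exact hd.2 (by simpa using this)
  have hM0 : M = M' ++ [c] := by simpa using hM
  clear hM
  have hφ : S.φ c = p ∧ S.φ q :: M'.map S.φ = M := by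
    rw [hM0, List.map_append, ← List.cons_append, ← hM0] at hrot
    obtain ⟨h1, h2⟩ := List.append_inj' hrot rfl
    exact ⟨by simpa using h2, h1⟩
  obtain ⟨hcp, hM'⟩ := hφ
  have hcM : c ∈ M := by simp [hM0]
  obtain ⟨hcY, hcW⟩ := hL.mem c (by simp [hcM])
  have hcq : c ≠ q := by
    rintro rfl
    exact hqM hcM
  have hpM : p ∉ M := fun h => hpK (by simp [h])
  have hpc : p ≠ c := by
    rintro rfl
    exact hpM hcM
  have hcM' : c ∉ M' := by
    rw [hM0] at hMnd
    have := List.disjoint_of_nodup_append hMnd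
    intro h
    exact this h (by simp)
  have hqM' : q ∉ M' := fun h => hqM (by simp [hM0, h])
  have hτ : S.τ c = S.τ q := by
    rw [← hpq, hB.τφ, ← hcp, hB.τφ, Bool.not_not]
  have hface : sc S.φ c q := ⟨2, by
    rw [show (2 : ℤ) = 1 + 1 from rfl, zpow_add, zpow_one, Perm.mul_apply, hcp, hpq]⟩
  -- data of the cut picture that does not depend on the potential
  have hcut : ∀ t, ({ S with t := t } : Picture D G w.n).Base w Y W → ∀ S', S' = ({ S with t := t } : Picture D G w.n).cut c q →
      S'.Base w Y W ∧ S'.φ p = q ∧ S'.φ q = p ∧ S'.ℓ p = 1 ∧ S'.ℓ q = 1 ∧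
        M.map S'.φ = M.rotate 1 ∧ (M.map S'.ℓ).prod = 1 := by
    rintro t hBt S' rfl
    refine ⟨hBt.cut hcY hqY hτ subset_rfl hcW hqW hB.reads.φ_mem, ?_, ?_, ?_, ?_, ?_, ?_⟩
    · rw [cut_φ_of_ne hpc hpq_ne]
      exact hpq
    · change S.φ (swap c q q) = p
      rw [swap_apply_right, hcp]
    · simp [cut, Function.update_of_ne hpc, Function.update_of_ne hpq_ne, hp1]
    · simp [cut]
    · conv_rhs => rw [← hM']
      rw [List.rotate_cons_succ, List.rotate_zero, hM0, List.map_append]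
      congr 1
      · apply List.map_congr_left
        intro d hd
        exact cut_φ_of_ne (fun h => hcM' (h ▸ hd)) (fun h => hqM' (h ▸ hd))
      · simp [cut]
    · have h1 : M'.map (({ S with t := t } : Picture D G w.n).cut c q).ℓ = M'.map S.ℓ := by
        apply List.map_congr_left
        intro d hd
        have e1 : d ≠ c := fun h => hcM' (h ▸ hd)
        have e2 : d ≠ q := fun h => hqM' (h ▸ hd)
        simp [cut, Function.update_of_ne e1, Function.update_of_ne e2]
      have h2 : (({ S with t := t } : Picture D G w.n).cut c q).ℓ c = S.ℓ c * S.ℓ q := by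
        simp [cut, Function.update_of_ne hcq]
      rw [hM0, List.map_append, List.prod_append, h1]
      rw [hM0, List.map_append, List.prod_append] at hprod
      simp only [List.map_cons, List.map_nil, List.prod_cons, List.prod_nil, mul_one] at hprod ⊢
      rw [h2, ← mul_assoc]
      exact mul_eq_one_iff_eq_inv.2 (eq_inv_of_mul_eq_one_right hprod)
  by_cases hvert : sc S.σ c q
  · -- the cut disconnects the picture
    obtain ⟨hB', hpq', hqp', hp1', hq1', hM1, hM2⟩ := hcut S.t hB (S.cut c q) rfl
    obtain ⟨Y₁, Y₂, hY, hdisj, hcY₁, hqY₂, hcl₁, hcl₂, hc₁, hc₂, hp₁, hp₂⟩ :=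
      split hB.closed hB.αα hc hp hcY hqY hcq hface hvert
    have hsub₁ : Y₁ ⊆ Y := hY ▸ Set.subset_union_left
    have hsub₂ : Y₂ ⊆ Y := hY ▸ Set.subset_union_right
    have hpY₂ : p ∈ Y₂ := hqp' ▸ hcl₂.1 _ hqY₂
    have hMY₁ : ∀ d ∈ M, d ∈ Y₁ := by
      have hlast : ∀ K : List D, ∀ a ∈ K, K.IsChain (fun a b => (S.cut c q).φ a = b) →
          ∀ c', K.getLast? = some c' → sc (S.cut c q).φ a c' := by
        intro K
        induction K with
        | nil => simp
        | cons a K ihK =>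
          intro b hb hch c' hc'
          rcases K with _ | ⟨a', K⟩
          · simp only [List.mem_singleton] at hb
            simp only [List.getLast?_singleton, Option.some.injEq] at hc'
            rw [hb, hc']
          · rw [List.isChain_cons_cons] at hch
            rw [List.getLast?_cons_cons] at hc'
            rcases List.mem_cons.1 hb with rfl | hb
            · have := ihK a' (by simp) hch.2 c' hc'
              refine (sc _).trans ?_ this
              rw [← hch.1]
              exact sc_self _ _
            · exact ihK b hb hch.2 c' hc'
      intro d hd
      have := hlast M d hd (chain_of_map_rotate hM1) c (by simp [hM0])
      exact mem_of_sc hcl₁.1 hcY₁ ((sc _).symm this)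
    have hpos₁ : 0 < Y₁.ncard := (Set.ncard_pos (Set.toFinite _)).2 ⟨c, hcY₁⟩
    have hpos₂ : 0 < Y₂.ncard := (Set.ncard_pos (Set.toFinite _)).2 ⟨q, hqY₂⟩
    have hcard : Y.ncard = Y₁.ncard + Y₂.ncard := by
      rw [hY]
      exact Set.ncard_union_eq hdisj
    rcases hs.split hY hdisj hcY₁ hqY₂ with ⟨d, hd⟩ | ⟨d, hd⟩
    · have hH : (S.cut c q).Hole Y₁ W M := by
        refine ⟨hMnd, fun e he heW => ?_, fun e he => ⟨hMY₁ e he, (hL.mem e (by simp [he])).2⟩,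
          hM1, hM2⟩
        have := hL.cover e (hsub₁ he) heW
        rcases List.mem_cons.1 this with rfl | this
        · exact absurd hpY₂ (Set.disjoint_left.1 hdisj he)
        rcases List.mem_cons.1 this with rfl | this
        · exact absurd hqY₂ (Set.disjoint_left.1 hdisj he)
        exact this
      obtain ⟨S', Y', d', h1, h2⟩ := ih (S.cut c q) Y₁ W M d (by omega) (hB'.restrict hcl₁) hc₁ hp₁
        hd hH
      exact ⟨S', Y', d', h1.trans hsub₁, h2⟩
    · have hH : (S.cut c q).Hole Y₂ W [p, q] := by
        refine ⟨by simp [hpq_ne], fun e he heW => ?_, ?_, ?_, ?_⟩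
        · have := hL.cover e (hsub₂ he) heW
          rcases List.mem_cons.1 this with rfl | this
          · simp
          rcases List.mem_cons.1 this with rfl | this
          · simp
          exact absurd he (Set.disjoint_left.1 hdisj (hMY₁ e this))
        · intro e he
          rcases List.mem_cons.1 he with rfl | he
          · exact ⟨hpY₂, hpW⟩
          · rw [List.mem_singleton.1 he]
            exact ⟨hqY₂, hqW⟩
        · simp [hpq', hqp', List.rotate_cons_succ]
        · simp [hp1', hq1']
      obtain ⟨S', Y', d', h1, h2⟩ := ih (S.cut c q) Y₂ W [p, q] d (by omega) (hB'.restrict hcl₂)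
        hc₂ hp₂ hd hH
      exact ⟨S', Y', d', h1.trans hsub₂, h2⟩
  · -- the cut separates a digon
    set g := S.t (S.σ c) * (S.t q)⁻¹ with hg
    have hBt : (S.shift g q).Base w Y W :=
      { closed := hB.closed, αα := hB.αα, αne := hB.αne, τφ := hB.τφ, τα := hB.τα, mem := hB.mem,
        reads := hB.reads.congr subset_rfl rfl rfl rfl (fun _ _ => rfl) (fun _ _ => rfl)
          hB.reads.φ_mem }
    have hst : (S.shift g q).Sole Y d₀ := ⟨hs.1, (defect_shift g d₀).2 hs.2.1,
      fun d hd h => hs.2.2 d hd ((defect_shift g d).1 h)⟩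
    have htt : (S.shift g q).t ((S.shift g q).σ c) = (S.shift g q).t q := by
      have e1 : (S.shift g q).t (S.σ c) = S.t (S.σ c) := if_neg fun h =>
        hvert ((sc S.σ).trans (sc_self S.σ c) ((sc S.σ).symm h))
      have e2 : (S.shift g q).t q = g * S.t q := if_pos ((sc S.σ).refl q)
      change (S.shift g q).t (S.σ c) = _
      rw [e1, e2, hg]
      group
    obtain ⟨d, hd⟩ := hst.cut hcY hqY hcq htt
    obtain ⟨hB', hpq', hqp', hp1', hq1', hM1, hM2⟩ :=
      hcut (S.shift g q).t hBt ((S.shift g q).cut c q) rfl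
    obtain ⟨hc', hp'⟩ := conn_planar_cut_of_not_vertex (S := S.shift g q) hc hp hcY hqY hcq hface
      hvert
    obtain ⟨h1, h2, h3, d', h4⟩ := digon hB' hc' hp' hd hpY hqY hpq' hqp' hp1' hq1'
    have hcard : (Y \ {p, q}).ncard < Y.ncard :=
      Set.ncard_lt_ncard ⟨Set.sdiff_subset, fun h => (h hpY).2 (Or.inl rfl)⟩ (Set.toFinite _)
    have hH : ((S.shift g q).cut c q).Hole (Y \ {p, q}) W M := by
      refine ⟨hMnd, fun e he heW => ?_, fun e he => ?_, hM1, hM2⟩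
      · have := hL.cover e he.1 heW
        rcases List.mem_cons.1 this with rfl | this
        · exact absurd (Or.inl rfl) he.2
        rcases List.mem_cons.1 this with rfl | this
        · exact absurd (Or.inr rfl) he.2
        exact this
      · refine ⟨⟨(hL.mem e (by simp [he])).1, ?_⟩, (hL.mem e (by simp [he])).2⟩
        rintro (rfl | rfl)
        · exact hpM he
        · exact hqM he
    obtain ⟨S', Y', d'', k1, k2⟩ := ih _ _ W M d' (by omega) h1 h2 h3 h4
      ⟨hH.nodup, hH.cover, hH.mem, hH.map_φ, hH.prod⟩
    exact ⟨S', Y', d'', k1.trans Set.sdiff_subset, k2⟩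

end Picture

end OneRelator

/-! ### Faces reading the cyclic word -/

namespace OneRelator

open Equiv Equiv.Perm

variable {D G : Type*} [Group G] {w : CyclicWord G}

theorem prod_range_mul_prod_range_inv (a b : ℕ → G) (m : ℕ)
    (h : ∀ i < m, b i = (a (m - 1 - i))⁻¹) :
    ((List.range m).map a).prod * ((List.range m).map b).prod = 1 := by
  induction m generalizing b with
  | zero => simp
  | succ m ih =>
    have := ih (fun i => b (i + 1)) fun i hi => by
      rw [h (i + 1) (by omega)]
      congr 2
      omega
    have e1 : ((List.range (m + 1)).map a).prod = ((List.range m).map a).prod * a m := by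
      simp [List.range_succ]
    have e2 : ((List.range (m + 1)).map b).prod =
        (a m)⁻¹ * ((List.range m).map fun i => b (i + 1)).prod := by
      rw [List.range_succ_eq_map, List.map_cons, List.prod_cons, h 0 (by omega), List.map_map]
      rfl
    rw [e1, e2, mul_assoc, mul_inv_cancel_left]
    exact this

namespace Picture

theorem Reads.sg_pow {S : Picture D G w.n} {W : Set D} (h : S.Reads w W) {d : D} (hd : d ∈ W)
    (i : ℕ) : S.sg ((S.φ ^ i) d) = S.sg d := by
  induction i with
  | zero => rfl
  | succ i ih => rw [pow_succ', Perm.mul_apply, h.sg_φ _ (h.pow_mem hd i), ih]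

theorem Reads.pos_pow_of_true {S : Picture D G w.n} {W : Set D} (h : S.Reads w W) {d : D}
    (hd : d ∈ W) (hs : S.sg d = true) (i : ℕ) : S.pos ((S.φ ^ i) d) = S.pos d + i := by
  induction i with
  | zero => simp
  | succ i ih =>
    rw [pow_succ', Perm.mul_apply, h.pos_of_true _ (h.pow_mem hd i) (by rw [h.sg_pow hd, hs]), ih]
    push_cast
    ring

theorem Reads.pos_pow_of_false {S : Picture D G w.n} {W : Set D} (h : S.Reads w W) {d : D}
    (hd : d ∈ W) (hs : S.sg d = false) (i : ℕ) : S.pos ((S.φ ^ i) d) = S.pos d - i := by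
  induction i with
  | zero => simp
  | succ i ih =>
    have := h.pos_of_false _ (h.pow_mem hd i) (by rw [h.sg_pow hd, hs])
    rw [pow_succ', Perm.mul_apply, eq_sub_of_add_eq this, ih]
    push_cast
    ring

/-- No edge joins two faces which are mirror images of each other along that edge. -/
def Reduced (w : CyclicWord G) (S : Picture D G w.n) (Y : Set D) : Prop :=
  ∀ d ∈ Y, S.sg d = true → S.sg (S.α d) = false →
    ¬ ∀ j, w.x (S.pos d + j) = w.x (S.pos (S.α d) + j)

theorem exists_smaller [Finite D] {S : Picture D G w.n} {Y W : Set D} {d₀ d : D}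
    (hB : S.Base w Y W) (hc : S.Conn Y) (hp : S.Planar Y) (hs : S.Sole Y d₀) (hYW : Y ⊆ W)
    (hd : d ∈ Y) (hsd : S.sg d = true) (hsd' : S.sg (S.α d) = false)
    (hx : ∀ j, w.x (S.pos d + j) = w.x (S.pos (S.α d) + j)) :
    ∃ (S' : Picture D G w.n) (Y' W' : Set D) (d' : D), Y'.ncard < Y.ncard ∧
      S'.Base w Y' W' ∧ S'.Conn Y' ∧ S'.Planar Y' ∧ S'.Sole Y' d' ∧ Y' ⊆ W' := by
  classical
  obtain ⟨m, hm⟩ := Nat.exists_eq_succ_of_ne_zero (NeZero.ne w.n)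
  have hR := hB.reads
  obtain ⟨d', hd'⟩ : ∃ d', S.α d = d' := ⟨_, rfl⟩
  rw [hd'] at hsd' hx
  have hd'Y : d' ∈ Y := hd' ▸ hB.closed.2 d hd
  have hper₀ : ∀ e ∈ Y, ∀ k, w.n = k → (S.φ ^ k) e = e := by
    rintro e he _ rfl
    exact hR.period e (hYW he)
  have hper := hper₀ d hd _ hm
  have hper' := hper₀ d' hd'Y _ hm
  rw [Nat.succ_eq_add_one] at hper hper'
  obtain ⟨u, hu⟩ : ∃ u, (S.φ ^ m) d = u := ⟨_, rfl⟩
  have hpowY : ∀ {e}, e ∈ Y → ∀ i : ℕ, (S.φ ^ i) e ∈ Y := by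
    intro e he i
    induction i with
    | zero => exact he
    | succ i ih =>
      rw [pow_succ', Perm.mul_apply]
      exact hB.closed.1 _ ih
  have huY : u ∈ Y := hu ▸ hpowY hd m
  have hφu : S.φ u = d := by rw [← hu, ← Perm.mul_apply, ← pow_succ', hper]
  have hσu : S.σ u = d' := by rw [σ_apply, hφu, hd']
  have hsgu : S.sg u = true := by rw [← hu, hR.sg_pow (hYW hd), hsd]
  have hud' : u ≠ d' := by
    rintro rfl
    rw [hsgu] at hsd'
    exact Bool.noConfusion hsd'
  have hτ : S.τ u = S.τ d' := by
    rw [← hd', hB.τα, ← hφu, hB.τφ, Bool.not_not]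
  have hface : ¬ sc S.φ u d' := by
    intro h
    cases nonempty_fintype D
    obtain ⟨i, -, -, hi⟩ := SameCycle.exists_pow_eq (f := S.φ) h
    have := hR.sg_pow (hYW huY) i
    rw [hi, hsgu, hsd'] at this
    exact Bool.noConfusion this
  have hvert : sc S.σ u d' := hσu ▸ sc_self S.σ u
  obtain ⟨hc', hp'⟩ := conn_planar_cut_of_not_face hc hp huY hd'Y hud' hface hvert
  obtain ⟨d₁, hs'⟩ := hs.cut huY hd'Y hud' (by rw [hσu])
  have hn0 : ((m : ZMod w.n) + 1) = 0 := by
    have : ∀ k, w.n = k → ((k : ℕ) : ZMod w.n) = 0 := by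
      rintro _ rfl
      exact ZMod.natCast_self _
    simpa using this _ hm
  have hinj : ∀ i j : ℕ, i < m + 1 → j < m + 1 → ((i : ℕ) : ZMod w.n) = j → i = j := by
    intro i j hi hj hij
    have := (ZMod.natCast_eq_natCast_iff' i j w.n).1 hij
    rwa [hm, Nat.mod_eq_of_lt hi, Nat.mod_eq_of_lt hj] at this
  have hpos := hR.pos_pow_of_true (hYW hd) hsd
  have hpos' := hR.pos_pow_of_false (hYW hd'Y) hsd'
  set L₁ := (List.range (m + 1)).map fun i => (S.φ ^ i) d with hL₁
  set L₂ := (List.range (m + 1)).map fun i => (S.φ ^ (i + 1)) d' with hL₂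
  have hmem₁ : ∀ i : ℕ, (S.φ ^ i) d ∈ L₁ := by
    intro i
    induction i with
    | zero => exact List.mem_map.2 ⟨0, by simp, rfl⟩
    | succ i ih =>
      obtain ⟨j, hj, hj'⟩ := List.mem_map.1 ih
      rw [pow_succ', Perm.mul_apply, ← hj']
      rw [List.mem_range] at hj
      by_cases hjm : j = m
      · refine List.mem_map.2 ⟨0, by simp, ?_⟩
        change d = S.φ ((S.φ ^ j) d)
        rw [hjm, hu, hφu]
      · refine List.mem_map.2 ⟨j + 1, by simp; omega, ?_⟩
        rw [pow_succ', Perm.mul_apply]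
  have hmem₂ : ∀ i : ℕ, (S.φ ^ i) d' ∈ L₂ := by
    intro i
    induction i with
    | zero => exact List.mem_map.2 ⟨m, by simp, by simpa using hper'⟩
    | succ i ih =>
      obtain ⟨j, hj, hj'⟩ := List.mem_map.1 ih
      rw [pow_succ', Perm.mul_apply, ← hj']
      rw [List.mem_range] at hj
      by_cases hjm : j = m
      · refine List.mem_map.2 ⟨0, by simp, ?_⟩
        rw [hjm, hper']
        simp
      · refine List.mem_map.2 ⟨j + 1, by simp; omega, ?_⟩
        rw [pow_succ', Perm.mul_apply]
  have hsg₁ : ∀ e ∈ L₁, S.sg e = true := by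
    intro e he
    obtain ⟨i, -, rfl⟩ := List.mem_map.1 he
    rw [hR.sg_pow (hYW hd), hsd]
  have hsg₂ : ∀ e ∈ L₂, S.sg e = false := by
    intro e he
    obtain ⟨i, -, rfl⟩ := List.mem_map.1 he
    rw [hR.sg_pow (hYW hd'Y), hsd']
  have hLY : ∀ e ∈ L₁ ++ L₂, e ∈ Y := by
    intro e he
    rcases List.mem_append.1 he with he | he
    · obtain ⟨i, -, rfl⟩ := List.mem_map.1 he
      exact hpowY hd i
    · obtain ⟨i, -, rfl⟩ := List.mem_map.1 he
      exact hpowY hd'Y _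
  have huL : u ∈ L₁ ++ L₂ := List.mem_append_left _ (hu ▸ hmem₁ m)
  have hd'L : d' ∈ L₁ ++ L₂ := List.mem_append_right _ (hmem₂ 0)
  have hback : ∀ e, S.φ e ∈ L₁ ++ L₂ → e ∈ L₁ ++ L₂ := by
    intro e he
    rcases List.mem_append.1 he with he | he
    · obtain ⟨i, -, hi⟩ := List.mem_map.1 he
      have : S.φ e = S.φ ((S.φ ^ (i + m)) d) := by
        rw [← Perm.mul_apply, ← pow_succ', add_assoc, pow_add, Perm.mul_apply, hper, ← hi]
      rw [S.φ.injective this]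
      exact List.mem_append_left _ (hmem₁ _)
    · obtain ⟨i, -, hi⟩ := List.mem_map.1 he
      have : S.φ e = S.φ ((S.φ ^ i) d') := by
        rw [← Perm.mul_apply, ← pow_succ', ← hi]
      rw [S.φ.injective this]
      exact List.mem_append_right _ (hmem₂ _)
  set W' := {e | e ∈ W ∧ e ∉ L₁ ++ L₂} with hW'
  have hB' : (S.cut u d').Base w Y W' := by
    refine hB.cut huY hd'Y hτ (fun e he => he.1) (fun he => he.2 huL) (fun he => he.2 hd'L) ?_
    exact fun e he => ⟨hR.φ_mem e he.1, fun h => he.2 (hback e h)⟩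
  have hcφ : ∀ e, e ≠ u → e ≠ d' → (S.cut u d').φ e = S.φ e := fun e => cut_φ_of_ne
  have hcu : (S.cut u d').φ u = S.φ d' := by simp [Picture.cut]
  have hcd' : (S.cut u d').φ d' = d := by simp [Picture.cut, hφu]
  have hne₁ : ∀ i < m, (S.φ ^ i) d ≠ u ∧ (S.φ ^ i) d ≠ d' := by
    intro i hi
    constructor
    · intro h
      have h1 := hpos i
      rw [h, ← hu, hpos m] at h1
      have := hinj m i (by omega) (by omega) (add_left_cancel h1)
      omega
    · intro h
      have := hR.sg_pow (hYW hd) i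
      rw [h, hsd, hsd'] at this
      exact Bool.noConfusion this
  have hne₂ : ∀ i < m, (S.φ ^ (i + 1)) d' ≠ u ∧ (S.φ ^ (i + 1)) d' ≠ d' := by
    intro i hi
    constructor
    · intro h
      have := hR.sg_pow (hYW hd'Y) (i + 1)
      rw [h, hsgu, hsd'] at this
      exact Bool.noConfusion this
    · intro h
      have h1 := hpos' (i + 1)
      rw [h, eq_comm, sub_eq_self] at h1
      have := hinj (i + 1) 0 (by omega) (by omega) (by rw [h1]; simp)
      omega
  have hH : (S.cut u d').Hole Y W' (L₁ ++ L₂) := by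
    refine ⟨?_, ?_, ?_, ?_, ?_⟩
    · refine List.Nodup.append ?_ ?_ ?_
      · refine List.Nodup.map_on ?_ List.nodup_range
        intro i hi j hj hij
        rw [List.mem_range] at hi hj
        have := congrArg S.pos hij
        rw [hpos, hpos] at this
        exact hinj i j hi hj (add_left_cancel this)
      · refine List.Nodup.map_on ?_ List.nodup_range
        intro i hi j hj hij
        rw [List.mem_range] at hi hj
        have := congrArg S.pos hij
        rw [hpos', hpos', sub_right_inj] at this
        push_cast at this
        exact hinj i j hi hj (add_right_cancel this)
      · intro e he he'
        have := hsg₁ e he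
        rw [hsg₂ e he'] at this
        exact Bool.noConfusion this
    · intro e he he'
      by_contra h
      exact he' ⟨hYW he, h⟩
    · exact fun e he => ⟨hLY e he, fun h => h.2 he⟩
    · have e1 : L₁ = d :: (List.range m).map fun i => (S.φ ^ (i + 1)) d := by
        rw [hL₁, List.range_succ_eq_map, List.map_cons, List.map_map]
        rfl
      have e2 : L₁ = ((List.range m).map fun i => (S.φ ^ i) d) ++ [u] := by
        rw [hL₁, List.range_succ, List.map_append, ← hu]
        rfl
      have e3 : L₂ = S.φ d' :: (List.range m).map fun i => (S.φ ^ (i + 1 + 1)) d' := by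
        rw [hL₂, List.range_succ_eq_map, List.map_cons, List.map_map]
        rfl
      have e4 : L₂ = ((List.range m).map fun i => (S.φ ^ (i + 1)) d') ++ [d'] := by
        rw [hL₂, List.range_succ, List.map_append]
        congr 1
        simpa using hper'
      have r1 : (L₁ ++ L₂).rotate 1 =
          ((List.range m).map fun i => (S.φ ^ (i + 1)) d) ++ L₂ ++ [d] := by
        rw [e1, List.cons_append, List.rotate_cons_succ, List.rotate_zero]
      rw [r1, e3, ← e3, e2, e4, List.map_append, List.map_append, List.map_append, List.map_map,
        List.map_map, ← e4, e3]
      simp only [List.map_cons, List.map_nil, hcu, hcd', List.append_assoc, List.cons_append,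
        List.nil_append]
      congr 1
      · refine List.map_congr_left fun i hi => ?_
        rw [List.mem_range] at hi
        rw [Function.comp_apply, hcφ _ (hne₁ i hi).1 (hne₁ i hi).2, pow_succ' S.φ i,
          Perm.mul_apply]
      · congr 2
        refine List.map_congr_left fun i hi => ?_
        rw [List.mem_range] at hi
        rw [Function.comp_apply, hcφ _ (hne₂ i hi).1 (hne₂ i hi).2, pow_succ' S.φ (i + 1),
          Perm.mul_apply]
    · have hℓ : ∀ e, e ≠ u → e ≠ d' → (S.cut u d').ℓ e = S.ℓ e := by
        intro e h1 h2
        simp only [Picture.cut]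
        rw [Function.update_of_ne h2, Function.update_of_ne h1]
      have hℓd' : (S.cut u d').ℓ d' = 1 := by simp [Picture.cut]
      have hℓu : (S.cut u d').ℓ u = 1 := by
        simp only [Picture.cut]
        rw [Function.update_of_ne hud', Function.update_self, hR.ℓ_of_true u (hYW huY) hsgu,
          hR.ℓ_of_false d' (hYW hd'Y) hsd']
        have h1 := hR.pos_of_true u (hYW huY) hsgu
        have h2 := hR.pos_of_false d' (hYW hd'Y) hsd'
        rw [hφu] at h1
        have := hx (-1)
        rw [h1, ← h2] at this
        simp only [add_neg_cancel_right] at this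
        rw [this, mul_inv_cancel]
      have e1 : (L₁.map (S.cut u d').ℓ).prod =
          ((List.range m).map fun i : ℕ => w.x (S.pos d + i)).prod := by
        rw [hL₁, List.range_succ, List.map_append, List.map_append, List.prod_append, List.map_map]
        simp only [List.map_cons, List.map_nil, hu, hℓu, List.prod_cons, List.prod_nil, mul_one]
        congr 1
        refine List.map_congr_left fun i hi => ?_
        rw [List.mem_range] at hi
        rw [Function.comp_apply, hℓ _ (hne₁ i hi).1 (hne₁ i hi).2,
          hR.ℓ_of_true _ (hR.pow_mem (hYW hd) i) (by rw [hR.sg_pow (hYW hd), hsd]), hpos]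
      have e2 : (L₂.map (S.cut u d').ℓ).prod =
          ((List.range m).map fun i : ℕ => (w.x (S.pos d' - (i + 2)))⁻¹).prod := by
        rw [hL₂, List.range_succ, List.map_append, List.map_append, List.prod_append, List.map_map]
        simp only [List.map_cons, List.map_nil, hper', hℓd', List.prod_cons, List.prod_nil,
          mul_one]
        congr 1
        refine List.map_congr_left fun i hi => ?_
        rw [List.mem_range] at hi
        rw [Function.comp_apply, hℓ _ (hne₂ i hi).1 (hne₂ i hi).2,
          hR.ℓ_of_false _ (hR.pow_mem (hYW hd'Y) _) (by rw [hR.sg_pow (hYW hd'Y), hsd']),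
          ← Perm.mul_apply, ← pow_succ', hpos']
        push_cast
        congr 3
        ring
      rw [List.map_append, List.prod_append, e1, e2]
      refine prod_range_mul_prod_range_inv _ _ m fun i hi => ?_
      rw [hx]
      congr 2
      have : ((m - 1 - i : ℕ) : ZMod w.n) = (m : ZMod w.n) - 1 - i := by
        rw [Nat.cast_sub (by omega), Nat.cast_sub (by omega)]
        simp
      rw [this, eq_sub_of_add_eq hn0]
      ring
  obtain ⟨S', Y', d'', h1, h2, h3, h4, h5, h6⟩ :=
    exists_pictures_without_hole _ _ Y W' _ d₁ le_rfl hB' hc' hp' hs' hH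
  refine ⟨S', Y', W', d'', Set.ncard_lt_ncard ⟨h1, fun h => ?_⟩ (Set.toFinite _), h3, h4, h5, h6,
    h2⟩
  exact (h2 (h huY)).2 huL

theorem exists_reduced [Finite D] (N : ℕ) : ∀ (S : Picture D G w.n) (Y W : Set D) (d₀ : D),
    Y.ncard ≤ N → S.Base w Y W → S.Conn Y → S.Planar Y → S.Sole Y d₀ → Y ⊆ W →
    ∃ (S' : Picture D G w.n) (Y' W' : Set D) (d' : D), S'.Base w Y' W' ∧
      S'.Planar Y' ∧ S'.Sole Y' d' ∧ Y' ⊆ W' ∧ S'.Reduced w Y' := by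
  induction N with
  | zero =>
    intro S Y W d₀ hN hB hc hp hs hYW
    have : Y = ∅ := by
      rw [← Set.ncard_eq_zero (Set.toFinite Y)]
      omega
    exact absurd hs.1 (by rw [this]; exact fun h => h)
  | succ N ih =>
    intro S Y W d₀ hN hB hc hp hs hYW
    by_cases hr : S.Reduced w Y
    · exact ⟨S, Y, W, d₀, hB, hp, hs, hYW, hr⟩
    · unfold Reduced at hr
      push Not at hr
      obtain ⟨d, h1, h2, h3, h4⟩ := hr
      obtain ⟨S', Y', W', d', k1, k2, k3, k4, k5, k6⟩ :=
        exists_smaller hB hc hp hs hYW h1 h2 h3 h4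
      exact ih S' Y' W' d' (by omega) k2 k3 k4 k5 k6

end Picture

end OneRelator

/-! ### Disc pictures and their wedge -/

namespace OneRelator

open Equiv Equiv.Perm

variable {D G : Type*} [Group G] {w : CyclicWord G}

theorem card_le_cls [Finite D] {β : Type*} {f : Perm D} (h : D → β) (hf : ∀ d, h (f d) = h d)
    (hs : Function.Surjective h) : Nat.card β ≤ cls (sc f) Set.univ := by
  have hle : sc f ≤ Setoid.ker h := sc_le fun d => (hf d).symm
  have : cls (sc f) Set.univ = Nat.card (Quotient (sc f)) := by
    rw [cls, Set.image_univ, Set.range_quotient_mk, Set.ncard_univ]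
  rw [this]
  refine Nat.card_le_card_of_surjective (Quotient.lift h fun a b hab => hle hab) fun b => ?_
  obtain ⟨d, rfl⟩ := hs b
  exact ⟨Quotient.mk _ d, rfl⟩

theorem cls_univ (r : Setoid D) : cls r Set.univ = Nat.card (Quotient r) := by
  rw [cls, Set.image_univ, Set.range_quotient_mk, Set.ncard_univ]

theorem add_cls_le_cls_sumCongr {E : Type*} [Finite D] [Finite E] (f : Perm D) (g : Perm E) :
    cls (sc f) Set.univ + cls (sc g) Set.univ ≤ cls (sc (Perm.sumCongr f g)) Set.univ := by
  rw [cls_univ (sc f), cls_univ (sc g), ← Nat.card_sum]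
  refine card_le_cls (Sum.map (Quotient.mk (sc f)) (Quotient.mk (sc g))) ?_
    (Function.Surjective.sumMap Quotient.mk_surjective Quotient.mk_surjective)
  rintro (d | d)
  · exact congrArg Sum.inl (Quotient.sound ((sc f).symm (sc_self f d)))
  · exact congrArg Sum.inr (Quotient.sound ((sc g).symm (sc_self g d)))

namespace Picture

/-- A spherical picture without defects with one face `L` outside `W`. -/
structure Disc (w : CyclicWord G) (S : Picture D G w.n) (W : Set D) (L : List D) : Prop where
  base : S.Base w Set.univ W
  conn : S.Conn Set.univ
  planar : S.Planar Set.univ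
  flat : ∀ d, S.t (S.σ d) = S.t d * S.ℓ d
  nodup : L.Nodup
  cover : ∀ d, d ∉ W → d ∈ L
  notMem : ∀ d ∈ L, d ∉ W
  map_φ : L.map S.φ = L.rotate 1

theorem Disc.rotate {S : Picture D G w.n} {W : Set D} {L : List D}
    (h : S.Disc w W L) (i : ℕ) : S.Disc w W (L.rotate i) :=
  { h with
    nodup := List.nodup_rotate.2 h.nodup
    cover := fun d hd => List.mem_rotate.2 (h.cover d hd)
    notMem := fun d hd => h.notMem d (List.mem_rotate.1 hd)
    map_φ := by rw [List.map_rotate, h.map_φ, List.rotate_rotate, List.rotate_rotate, add_comm] }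

/-- Some disc with boundary word `g` has its base corner of type `b`. -/
def Bounds (w : CyclicWord G) (b : Bool) (g : G) : Prop :=
  ∃ (D : Type) (_ : Finite D) (S : Picture D G w.n) (W : Set D) (L : List D) (x : D),
    S.Disc w W (L ++ [x]) ∧ S.τ x = b ∧ ((L ++ [x]).map S.ℓ).prod = g

section Wedge

variable {E : Type*} [DecidableEq D] [DecidableEq E] {n : ℕ}

/-- Join two pictures at the corners `x` and `y`. -/
def wedge (S : Picture D G n) (T : Picture E G n) (x : D) (y : E) (γ : G) :
    Picture (D ⊕ E) G n where
  φ := Perm.sumCongr S.φ T.φ * swap (Sum.inl x) (Sum.inr y)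
  α := Perm.sumCongr S.α T.α
  ℓ := Sum.elim (Function.update S.ℓ x (S.ℓ x * γ)) (Function.update T.ℓ y (T.ℓ y * γ⁻¹))
  t := Sum.elim S.t fun e => S.t (S.σ x) * γ * (T.t (T.σ y))⁻¹ * T.t e
  τ := Sum.elim S.τ T.τ
  pos := Sum.elim S.pos T.pos
  sg := Sum.elim S.sg T.sg

variable {S : Picture D G n} {T : Picture E G n} {x : D} {y : E} {γ : G}

theorem wedge_φ : (S.wedge T x y γ).φ =
    Perm.sumCongr S.φ T.φ * swap (Sum.inl x) (Sum.inr y) := rfl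

theorem wedge_φ_left : (S.wedge T x y γ).φ (Sum.inl x) = Sum.inr (T.φ y) := by simp [wedge_φ]

theorem wedge_φ_right : (S.wedge T x y γ).φ (Sum.inr y) = Sum.inl (S.φ x) := by simp [wedge_φ]

theorem wedge_φ_inl {d : D} (h : d ≠ x) :
    (S.wedge T x y γ).φ (Sum.inl d) = Sum.inl (S.φ d) := by
  simp [wedge_φ, swap_apply_of_ne_of_ne, h]

theorem wedge_φ_inr {d : E} (h : d ≠ y) :
    (S.wedge T x y γ).φ (Sum.inr d) = Sum.inr (T.φ d) := by
  simp [wedge_φ, swap_apply_of_ne_of_ne, h]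

theorem wedge_σ : (S.wedge T x y γ).σ =
    Perm.sumCongr S.σ T.σ * swap (Sum.inl x) (Sum.inr y) := by
  change Perm.sumCongr S.α T.α * (Perm.sumCongr S.φ T.φ * _) = _
  rw [← mul_assoc, Perm.sumCongr_mul]
  rfl

theorem not_sc_sumCongr [Finite D] [Finite E] (f : Perm D) (g : Perm E) :
    ¬ sc (Perm.sumCongr f g) (Sum.inl x) (Sum.inr y) := by
  intro h
  have := mem_of_sc (f := Perm.sumCongr f g) (Y := Set.range Sum.inl)
    (by rintro _ ⟨d, rfl⟩; exact ⟨f d, rfl⟩) ⟨x, rfl⟩ h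
  simp at this

end Wedge

theorem Disc.wedge {E : Type*} [DecidableEq D] [DecidableEq E] [Finite D] [Finite E] {S : Picture D G w.n}
    {T : Picture E G w.n} {W : Set D} {V : Set E} {L : List D} {M : List E} {x : D} {y : E}
    {γ : G} (hS : S.Disc w W (L ++ [x])) (hT : T.Disc w V (M ++ [y])) (hxy : S.τ x = T.τ y)
    (hγ : γ ∈ w.P (S.τ x)) : (S.wedge T x y γ).Disc w (Sum.inl '' W ∪ Sum.inr '' V)
      ((L ++ [x]).map Sum.inl ++ (M.map Sum.inr ++ [Sum.inr y])) := by
  have hxW : x ∉ W := hS.notMem x (by simp)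
  have hyV : y ∉ V := hT.notMem y (by simp)
  have hφl : ∀ d ∈ W, (S.wedge T x y γ).φ (Sum.inl d) = Sum.inl (S.φ d) := by
    intro d hd
    exact wedge_φ_inl (by rintro rfl; exact hxW hd)
  have hφr : ∀ d ∈ V, (S.wedge T x y γ).φ (Sum.inr d) = Sum.inr (T.φ d) := by
    intro d hd
    exact wedge_φ_inr (by rintro rfl; exact hyV hd)
  have hℓl : ∀ d, d ≠ x → (S.wedge T x y γ).ℓ (Sum.inl d) = S.ℓ d := fun d hd =>
    Function.update_of_ne hd _ _
  have hℓr : ∀ d, d ≠ y → (S.wedge T x y γ).ℓ (Sum.inr d) = T.ℓ d := fun d hd =>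
    Function.update_of_ne hd _ _
  have hτφ : ∀ d, (S.wedge T x y γ).τ ((S.wedge T x y γ).φ d) = !(S.wedge T x y γ).τ d := by
    rintro (d | d)
    · by_cases hd : d = x
      · rw [hd, wedge_φ_left]
        change T.τ (T.φ y) = !S.τ x
        rw [hT.base.τφ, hxy]
      · rw [wedge_φ_inl hd]
        exact hS.base.τφ d
    · by_cases hd : d = y
      · rw [hd, wedge_φ_right]
        change S.τ (S.φ x) = !T.τ y
        rw [hS.base.τφ, hxy]
      · rw [wedge_φ_inr hd]
        exact hT.base.τφ d
  have hbase : (S.wedge T x y γ).Base w Set.univ (Sum.inl '' W ∪ Sum.inr '' V) := by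
    refine
      { closed := ⟨fun _ _ => trivial, fun _ _ => trivial⟩
        αα := ?_
        αne := ?_
        τφ := hτφ
        τα := ?_
        mem := ?_
        reads :=
          { φ_mem := ?_, sg_φ := ?_, pos_of_true := ?_, pos_of_false := ?_, ℓ_of_true := ?_,
            ℓ_of_false := ?_, τ_of_true := ?_, τ_of_false := ?_, period := ?_ } }
    · rintro (d | d)
      · exact congrArg Sum.inl (hS.base.αα d)
      · exact congrArg Sum.inr (hT.base.αα d)
    · rintro (d | d) h
      · exact hS.base.αne d (Sum.inl_injective h)
      · exact hT.base.αne d (Sum.inr_injective h)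
    · rintro (d | d)
      · exact hS.base.τα d
      · exact hT.base.τα d
    · rintro (d | d)
      · by_cases hd : d = x
        · subst hd
          change Function.update S.ℓ d _ d ∈ w.P (S.τ d)
          rw [Function.update_self]
          exact mul_mem (hS.base.mem d) hγ
        · rw [hℓl d hd]
          exact hS.base.mem d
      · by_cases hd : d = y
        · subst hd
          change Function.update T.ℓ d _ d ∈ w.P (T.τ d)
          rw [Function.update_self]
          exact mul_mem (hT.base.mem d) ((w.P _).inv_mem (hxy ▸ hγ))
        · rw [hℓr d hd]
          exact hT.base.mem d
    · rintro _ (⟨d, hd, rfl⟩ | ⟨d, hd, rfl⟩)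
      · rw [hφl d hd]
        exact Or.inl ⟨_, hS.base.reads.φ_mem d hd, rfl⟩
      · rw [hφr d hd]
        exact Or.inr ⟨_, hT.base.reads.φ_mem d hd, rfl⟩
    · rintro _ (⟨d, hd, rfl⟩ | ⟨d, hd, rfl⟩)
      · rw [hφl d hd]
        exact hS.base.reads.sg_φ d hd
      · rw [hφr d hd]
        exact hT.base.reads.sg_φ d hd
    · rintro _ (⟨d, hd, rfl⟩ | ⟨d, hd, rfl⟩)
      · rw [hφl d hd]
        exact hS.base.reads.pos_of_true d hd
      · rw [hφr d hd]
        exact hT.base.reads.pos_of_true d hd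
    · rintro _ (⟨d, hd, rfl⟩ | ⟨d, hd, rfl⟩)
      · rw [hφl d hd]
        exact hS.base.reads.pos_of_false d hd
      · rw [hφr d hd]
        exact hT.base.reads.pos_of_false d hd
    · rintro _ (⟨d, hd, rfl⟩ | ⟨d, hd, rfl⟩)
      · rw [hℓl d (by rintro rfl; exact hxW hd)]
        exact hS.base.reads.ℓ_of_true d hd
      · rw [hℓr d (by rintro rfl; exact hyV hd)]
        exact hT.base.reads.ℓ_of_true d hd
    · rintro _ (⟨d, hd, rfl⟩ | ⟨d, hd, rfl⟩)
      · rw [hφl d hd, hℓl d (by rintro rfl; exact hxW hd)]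
        exact hS.base.reads.ℓ_of_false d hd
      · rw [hφr d hd, hℓr d (by rintro rfl; exact hyV hd)]
        exact hT.base.reads.ℓ_of_false d hd
    · rintro _ (⟨d, hd, rfl⟩ | ⟨d, hd, rfl⟩)
      · exact hS.base.reads.τ_of_true d hd
      · exact hT.base.reads.τ_of_true d hd
    · rintro _ (⟨d, hd, rfl⟩ | ⟨d, hd, rfl⟩)
      · rw [hφl d hd]
        exact hS.base.reads.τ_of_false d hd
      · rw [hφr d hd]
        exact hT.base.reads.τ_of_false d hd
    · rintro _ (⟨d, hd, rfl⟩ | ⟨d, hd, rfl⟩)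
      · have : ∀ i : ℕ, ((S.wedge T x y γ).φ ^ i) (Sum.inl d) = Sum.inl ((S.φ ^ i) d) := by
          intro i
          induction i with
          | zero => rfl
          | succ i ih =>
            rw [pow_succ', Perm.mul_apply, ih, hφl _ (hS.base.reads.pow_mem hd i), pow_succ',
              Perm.mul_apply]
        rw [this, hS.base.reads.period d hd]
      · have : ∀ i : ℕ, ((S.wedge T x y γ).φ ^ i) (Sum.inr d) = Sum.inr ((T.φ ^ i) d) := by
          intro i
          induction i with
          | zero => rfl
          | succ i ih =>
            rw [pow_succ', Perm.mul_apply, ih, hφr _ (hT.base.reads.pow_mem hd i), pow_succ',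
              Perm.mul_apply]
        rw [this, hT.base.reads.period d hd]
  have hxL : ∀ d ∈ L, d ≠ x := by
    rintro d hd rfl
    exact List.disjoint_of_nodup_append hS.nodup hd (by simp)
  have hyM : ∀ d ∈ M, d ≠ y := by
    rintro d hd rfl
    exact List.disjoint_of_nodup_append hT.nodup hd (by simp)
  refine ⟨hbase, ?_, ?_, ?_, ?_, ?_, ?_, ?_⟩
  · set r := gen (S.wedge T x y γ).α (S.wedge T x y γ).φ with hr
    have hrφ : ∀ d, r d ((S.wedge T x y γ).φ d) := gen_right _ _
    have hrα : ∀ d, r d ((S.wedge T x y γ).α d) := gen_left _ _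
    have hxy' : r (Sum.inl x) (Sum.inr y) :=
      (le_sup_right : sc _ ≤ gen _ _) (sc_mul_swap_of_not (not_sc_sumCongr _ _))
    have hl : gen S.α S.φ ≤ Setoid.comap Sum.inl r := by
      refine gen_le (fun d => hrα (Sum.inl d)) fun d => ?_
      rw [Setoid.comap_rel]
      by_cases hd : d = x
      · subst hd
        refine r.trans hxy' ?_
        have := hrφ (Sum.inr y)
        rwa [wedge_φ_right] at this
      · have := hrφ (Sum.inl d)
        rwa [wedge_φ_inl hd] at this
    have hr' : gen T.α T.φ ≤ Setoid.comap Sum.inr r := by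
      refine gen_le (fun d => hrα (Sum.inr d)) fun d => ?_
      rw [Setoid.comap_rel]
      by_cases hd : d = y
      · subst hd
        refine r.trans (r.symm hxy') ?_
        have := hrφ (Sum.inl x)
        rwa [wedge_φ_left] at this
      · have := hrφ (Sum.inr d)
        rwa [wedge_φ_inr hd] at this
    have key : ∀ a, r a (Sum.inl x) := by
      rintro (d | d)
      · exact hl (hS.conn d trivial x trivial)
      · exact r.trans (hr' (hT.conn d trivial y trivial)) (r.symm hxy')
    exact fun a _ b _ => r.trans (key a) (r.symm (key b))
  · have h1 := cls_mul_swap_of_not (Y := Set.univ) (f := Perm.sumCongr S.φ T.φ) (x := Sum.inl x)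
      (y := Sum.inr y) trivial trivial (not_sc_sumCongr _ _)
    have h2 := cls_mul_swap_of_not (Y := Set.univ) (f := Perm.sumCongr S.σ T.σ) (x := Sum.inl x)
      (y := Sum.inr y) trivial trivial (not_sc_sumCongr _ _)
    have h3 := add_cls_le_cls_sumCongr S.φ T.φ
    have h4 := add_cls_le_cls_sumCongr S.σ T.σ
    have h5 := hS.planar
    have h6 := hT.planar
    unfold Planar at h5 h6 ⊢
    rw [wedge_σ]
    change _ ≤ 2 * (cls (sc (Perm.sumCongr S.φ T.φ * _)) _ + _)
    rw [Set.ncard_univ] at h5 h6 ⊢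
    rw [Nat.card_sum]
    omega
  · rintro (d | d)
    · by_cases hd : d = x
      · subst hd
        rw [wedge_σ]
        simp only [Perm.mul_apply, swap_apply_left, Perm.sumCongr_apply, Sum.map_inr]
        change _ * T.t (T.σ y) = S.t d * Function.update S.ℓ d _ d
        rw [Function.update_self, hS.flat]
        group
      · rw [wedge_σ, Perm.mul_apply, swap_apply_of_ne_of_ne (by simpa using hd) (by simp),
          hℓl d hd]
        exact hS.flat d
    · by_cases hd : d = y
      · subst hd
        rw [wedge_σ]
        simp only [Perm.mul_apply, swap_apply_right, Perm.sumCongr_apply, Sum.map_inl]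
        change S.t (S.σ x) = _ * T.t d * Function.update T.ℓ d _ d
        rw [Function.update_self, hT.flat]
        group
      · rw [wedge_σ, Perm.mul_apply, swap_apply_of_ne_of_ne (by simp) (by simpa using hd),
          hℓr d hd]
        change _ * T.t (T.σ d) = _ * T.t d * T.ℓ d
        rw [hT.flat d, ← mul_assoc]
  · rw [← List.map_singleton, ← List.map_append]
    refine List.Nodup.append (hS.nodup.map Sum.inl_injective) (hT.nodup.map Sum.inr_injective) ?_
    intro e he he'
    obtain ⟨a, -, rfl⟩ := List.mem_map.1 he
    obtain ⟨b, -, hb⟩ := List.mem_map.1 he'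
    exact Sum.inr_ne_inl hb
  · rw [← List.map_singleton, ← List.map_append]
    rintro (d | d) hd
    · refine List.mem_append_left _ (List.mem_map.2 ⟨d, hS.cover d fun h => hd ?_, rfl⟩)
      exact Or.inl ⟨d, h, rfl⟩
    · refine List.mem_append_right _ (List.mem_map.2 ⟨d, hT.cover d fun h => hd ?_, rfl⟩)
      exact Or.inr ⟨d, h, rfl⟩
  · rw [← List.map_singleton, ← List.map_append]
    intro d hd hd'
    rcases List.mem_append.1 hd with hd | hd
    · obtain ⟨a, ha, rfl⟩ := List.mem_map.1 hd
      rcases hd' with ⟨b, hb, h⟩ | ⟨b, hb, h⟩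
      · exact hS.notMem a ha (Sum.inl_injective h ▸ hb)
      · exact Sum.inr_ne_inl h
    · obtain ⟨a, ha, rfl⟩ := List.mem_map.1 hd
      rcases hd' with ⟨b, hb, h⟩ | ⟨b, hb, h⟩
      · exact Sum.inl_ne_inr h
      · exact hT.notMem a ha (Sum.inr_injective h ▸ hb)
  · have hSr : L.map S.φ ++ [S.φ x] = (L ++ [x]).rotate 1 := by
      rw [← hS.map_φ, List.map_append]
      rfl
    have hTr : M.map T.φ ++ [T.φ y] = (M ++ [y]).rotate 1 := by
      rw [← hT.map_φ, List.map_append]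
      rfl
    have e1 : L.map ((S.wedge T x y γ).φ ∘ Sum.inl) = (L.map S.φ).map Sum.inl := by
      rw [List.map_map]
      exact List.map_congr_left fun d hd => wedge_φ_inl (hxL d hd)
    have e2 : M.map ((S.wedge T x y γ).φ ∘ Sum.inr) = (M.map T.φ).map Sum.inr := by
      rw [List.map_map]
      exact List.map_congr_left fun d hd => wedge_φ_inr (hyM d hd)
    rw [← List.map_singleton, ← List.map_append]
    obtain ⟨a, L', hL'⟩ : ∃ a L', L ++ [x] = a :: L' := List.exists_cons_of_ne_nil (by simp)
    obtain ⟨b, M', hM'⟩ : ∃ b M', M ++ [y] = b :: M' := List.exists_cons_of_ne_nil (by simp)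
    rw [hL', List.rotate_cons_succ, List.rotate_zero] at hSr
    rw [hM', List.rotate_cons_succ, List.rotate_zero] at hTr
    obtain ⟨h1, h2⟩ := List.append_inj' hSr rfl
    obtain ⟨h3, h4⟩ := List.append_inj' hTr rfl
    have e3 : (((L ++ [x]).map Sum.inl ++ (M ++ [y]).map Sum.inr).rotate 1 : List (D ⊕ E)) =
        L'.map Sum.inl ++ (M ++ [y]).map Sum.inr ++ [Sum.inl a] := by
      rw [hL', List.map_cons, List.cons_append, List.rotate_cons_succ, List.rotate_zero]
    rw [e3, hM', ← hM']
    simp only [List.map_append, List.map_map, List.map_cons, List.map_nil, wedge_φ_left,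
      wedge_φ_right, e1, e2, h1, h3]
    have e4 : (M.map Sum.inr ++ [Sum.inr y] : List (D ⊕ E)) = Sum.inr b :: M'.map Sum.inr := by
      rw [← List.map_singleton, ← List.map_append, hM', List.map_cons]
    rw [e4, List.singleton_inj.1 h2, List.singleton_inj.1 h4]
    simp

end Picture

end OneRelator

/-! ### Pictures for elements of the normal closure -/

namespace OneRelator

open Equiv Equiv.Perm

variable {D G : Type*} [Group G] {w : CyclicWord G}

/-- The product of the letters of a cyclic word. -/
def CyclicWord.word (w : CyclicWord G) : G := ((List.range w.n).map fun i : ℕ => w.x i).prod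

namespace Picture

theorem Disc.prod_wedge {E : Type*} [DecidableEq D] [DecidableEq E] {S : Picture D G w.n}
    {T : Picture E G w.n} {W : Set D} {V : Set E} {L : List D} {M : List E} {x : D} {y : E}
    {γ : G} (hS : S.Disc w W (L ++ [x])) (hT : T.Disc w V (M ++ [y])) :
    ((((L ++ [x]).map Sum.inl ++ (M.map Sum.inr ++ [Sum.inr y]) : List (D ⊕ E))).map
      (S.wedge T x y γ).ℓ).prod =
      ((L ++ [x]).map S.ℓ).prod * (γ * ((M ++ [y]).map T.ℓ).prod * γ⁻¹) := by
  have hxL : ∀ d ∈ L, d ≠ x := by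
    rintro d hd rfl
    exact List.disjoint_of_nodup_append hS.nodup hd (by simp)
  have hyM : ∀ d ∈ M, d ≠ y := by
    rintro d hd rfl
    exact List.disjoint_of_nodup_append hT.nodup hd (by simp)
  have e1 : L.map ((S.wedge T x y γ).ℓ ∘ Sum.inl) = L.map S.ℓ :=
    List.map_congr_left fun d hd => Function.update_of_ne (hxL d hd) _ _
  have e2 : M.map ((S.wedge T x y γ).ℓ ∘ Sum.inr) = M.map T.ℓ :=
    List.map_congr_left fun d hd => Function.update_of_ne (hyM d hd) _ _
  have e3 : (S.wedge T x y γ).ℓ (Sum.inl x) = S.ℓ x * γ := Function.update_self x _ S.ℓ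
  have e4 : (S.wedge T x y γ).ℓ (Sum.inr y) = T.ℓ y * γ⁻¹ := Function.update_self y _ T.ℓ
  simp only [List.map_append, List.map_map, List.map_cons, List.map_nil, e1, e2, e3, e4,
    List.prod_append, List.prod_cons, List.prod_nil, mul_one, mul_assoc]

theorem wedge_ℓ_inl {E : Type*} [DecidableEq D] [DecidableEq E] {n : ℕ} {S : Picture D G n}
    {T : Picture E G n} {x d : D} {y : E} {γ : G} (h : d ≠ x) :
    (S.wedge T x y γ).ℓ (Sum.inl d) = S.ℓ d := Function.update_of_ne h _ _

/-- The picture on the sphere with a single face of length two. -/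
def bigon (w : CyclicWord G) (b : Bool) : Picture Bool G w.n where
  φ := Equiv.boolNot
  α := Equiv.boolNot
  ℓ _ := 1
  t _ := 1
  τ c := xor c !b
  pos _ := 0
  sg _ := true

theorem disc_bigon (w : CyclicWord G) (b : Bool) :
    (bigon w b).Disc w ∅ ([false] ++ [true]) where
  base :=
    { closed := ⟨fun _ _ => trivial, fun _ _ => trivial⟩
      αα := by simp [bigon]
      αne := by simp [bigon]
      τφ := by simp [bigon]
      τα := by simp [bigon]
      mem := fun _ => one_mem _
      reads := by constructor <;> exact fun d hd => hd.elim }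
  conn := by
    have h := gen_left (bigon w b).α (bigon w b).φ
    rintro (_ | _) - (_ | _) -
    · exact (gen _ _).refl _
    · exact h false
    · exact h true
    · exact (gen _ _).refl _
  planar := by
    have h1 : 1 ≤ cls (sc (bigon w b).φ) Set.univ := cls_pos (x := true) trivial
    have h2 : Nat.card Bool ≤ cls (sc (bigon w b).σ) Set.univ :=
      card_le_cls id (by simp [σ, bigon]) Function.surjective_id
    unfold Planar
    rw [Set.ncard_univ]
    simp only [Nat.card_eq_fintype_card, Fintype.card_bool] at h2 ⊢
    omega
  flat := by simp [bigon]
  nodup := by simp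
  cover := by simp
  notMem := by simp
  map_φ := by simp [bigon]

theorem Bounds.one (w : CyclicWord G) (b : Bool) : Bounds w b 1 :=
  ⟨Bool, inferInstance, bigon w b, ∅, [false], true, disc_bigon w b, by simp [bigon],
    by simp [bigon]⟩

theorem Bounds.mul_conj {b : Bool} {g h γ : G} (hg : Bounds w b g) (hh : Bounds w b h)
    (hγ : γ ∈ w.P b) : Bounds w b (g * (γ * h * γ⁻¹)) := by
  classical
  obtain ⟨D, _, S, W, L, x, hS, rfl, rfl⟩ := hg
  obtain ⟨E, _, T, V, M, y, hT, hy, rfl⟩ := hh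
  have h := hS.wedge hT hy.symm hγ
  rw [← List.append_assoc] at h
  refine ⟨_, inferInstance, _, _, _, _, h, hy, ?_⟩
  rw [List.append_assoc]
  exact hS.prod_wedge hT

theorem Bounds.not {b : Bool} {g : G} (hg : Bounds w b g) : Bounds w (!b) g := by
  classical
  obtain ⟨E, _, T, V, M, y, hT, rfl, rfl⟩ := hg
  have hS := disc_bigon w (T.τ y)
  have hτ : (bigon w (T.τ y)).τ true = T.τ y := by simp [bigon]
  have h1 := (hS.wedge hT hτ (one_mem _)).rotate 1
  have h2 := hS.prod_wedge (γ := 1) hT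
  have e1 : ((bigon w (T.τ y)).ℓ true) = 1 := rfl
  have e2 : ((bigon w (T.τ y)).ℓ false) = 1 := rfl
  replace h1 : Disc w _ _ ((Sum.inl true :: (M.map Sum.inr ++ [Sum.inr y])) ++ [Sum.inl false]) :=
    h1
  replace h2 : ((Sum.inl false :: Sum.inl true :: (M.map Sum.inr ++ [Sum.inr y])).map _).prod = _ :=
    h2
  refine ⟨_, inferInstance, _, _, _, _, h1, ?_, ?_⟩
  · change xor false (!T.τ y) = !T.τ y
    simp
  · rw [List.map_append, List.prod_append, List.map_singleton, List.prod_singleton]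
    rw [List.map_cons, List.prod_cons] at h2
    rw [wedge_ℓ_inl Bool.false_ne_true, e2, one_mul] at h2
    rw [wedge_ℓ_inl Bool.false_ne_true, e2, mul_one, h2]
    simp [e1, e2]

theorem Bounds.any {b c : Bool} {g : G} (h : Bounds w b g) : Bounds w c g := by
  by_cases hbc : c = b
  · rwa [hbc]
  · rw [Bool.eq_not_of_ne hbc]
    exact h.not

/-- The picture on the sphere with two faces, both reading the cyclic word. -/
def sphere (w : CyclicWord G) : Picture (Bool × ZMod w.n) G w.n where
  φ :=
    { toFun := fun d => (d.1, if d.1 then d.2 + 1 else d.2 - 1)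
      invFun := fun d => (d.1, if d.1 then d.2 - 1 else d.2 + 1)
      left_inv := by rintro ⟨_ | _, p⟩ <;> simp
      right_inv := by rintro ⟨_ | _, p⟩ <;> simp }
  α := Equiv.prodCongr Equiv.boolNot (Equiv.refl _)
  ℓ d := if d.1 then w.x d.2 else (w.x (d.2 - 1))⁻¹
  t d := if d.1 then 1 else w.x (d.2 - 1)
  τ d := w.par (if d.1 then d.2 else d.2 - 1)
  pos := Prod.snd
  sg := Prod.fst

theorem par_sub_one (w : CyclicWord G) (p : ZMod w.n) : w.par (p - 1) = !w.par p := by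
  have := w.par_succ (p - 1)
  rw [sub_add_cancel] at this
  rw [this, Bool.not_not]

theorem sphere_φ_true (p : ZMod w.n) : (sphere w).φ (true, p) = (true, p + 1) := rfl

theorem sphere_φ_false (p : ZMod w.n) : (sphere w).φ (false, p) = (false, p - 1) := rfl

theorem sphere_σ_true (p : ZMod w.n) : (sphere w).σ (true, p) = (false, p + 1) := rfl

theorem sphere_σ_false (p : ZMod w.n) : (sphere w).σ (false, p) = (true, p - 1) := rfl

theorem base_sphere (w : CyclicWord G) : (sphere w).Base w Set.univ Set.univ where
  closed := ⟨fun _ _ => trivial, fun _ _ => trivial⟩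
  αα := by simp [sphere]
  αne := by simp [sphere]
  τφ := by
    rintro ⟨_ | _, p⟩
    · change w.par (p - 1 - 1) = !w.par (p - 1)
      exact par_sub_one _ _
    · exact w.par_succ _
  τα := by
    rintro ⟨_ | _, p⟩
    · change w.par p = !w.par (p - 1)
      rw [par_sub_one, Bool.not_not]
    · exact par_sub_one _ _
  mem := by
    rintro ⟨_ | _, p⟩
    · exact (w.P _).inv_mem (w.mem _)
    · exact w.mem _
  reads :=
    { φ_mem := fun _ _ => trivial
      sg_φ := fun _ _ => rfl
      pos_of_true := by
        rintro ⟨_ | _, p⟩ - h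
        · exact Bool.noConfusion h
        · rfl
      pos_of_false := by
        rintro ⟨_ | _, p⟩ - h
        · exact sub_add_cancel _ _
        · exact Bool.noConfusion h
      ℓ_of_true := by
        rintro ⟨_ | _, p⟩ - h
        · exact Bool.noConfusion h
        · rfl
      ℓ_of_false := by
        rintro ⟨_ | _, p⟩ - h
        · rfl
        · exact Bool.noConfusion h
      τ_of_true := by
        rintro ⟨_ | _, p⟩ - h
        · exact Bool.noConfusion h
        · rfl
      τ_of_false := by
        rintro ⟨_ | _, p⟩ - h
        · rfl
        · exact Bool.noConfusion h
      period := by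
        rintro ⟨_ | _, p⟩ -
        · have : ∀ i : ℕ, ((sphere w).φ ^ i) (false, p) = (false, p - i) := by
            intro i
            induction i with
            | zero => simp
            | succ i ih =>
              rw [pow_succ', Perm.mul_apply, ih, sphere_φ_false]
              push_cast
              congr 1
              ring
          simp [this]
        · have : ∀ i : ℕ, ((sphere w).φ ^ i) (true, p) = (true, p + i) := by
            intro i
            induction i with
            | zero => simp
            | succ i ih =>
              rw [pow_succ', Perm.mul_apply, ih, sphere_φ_true]
              push_cast
              congr 1
              ring
          simp [this] }

theorem disc_sphere (w : CyclicWord G) (c : Bool) {L : List (Bool × ZMod w.n)} (hn : L.Nodup)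
    (hL : ∀ d, d ∈ L ↔ d.1 = c) (hφ : L.map (sphere w).φ = L.rotate 1) :
    (sphere w).Disc w {d | d.1 ≠ c} L where
  base := 
    { base_sphere w with
      reads := (base_sphere w).reads.congr (Set.subset_univ _) rfl rfl rfl (fun _ _ => rfl)
        (fun _ _ => rfl) (fun _ hd => hd) }
  conn := by
    have hα := gen_left (sphere w).α (sphere w).φ
    have hφ := gen_right (sphere w).α (sphere w).φ
    set r := gen (sphere w).α (sphere w).φ
    have h1 : ∀ i : ℕ, r (true, 0) (true, (i : ZMod w.n)) := by
      intro i
      induction i with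
      | zero => simp
      | succ i ih =>
        have := r.trans ih (hφ _)
        rw [sphere_φ_true] at this
        exact_mod_cast this
    have h2 : ∀ d, r (true, 0) d := by
      have h3 : ∀ p, r (true, 0) (true, p) := fun p => by simpa using h1 p.val
      rintro ⟨_ | _, p⟩
      · exact r.trans (h3 p) (hα (true, p))
      · exact h3 p
    exact fun a _ b _ => r.trans (r.symm (h2 a)) (h2 b)
  planar := by
    have h1 : Nat.card Bool ≤ cls (sc (sphere w).φ) Set.univ :=
      card_le_cls Prod.fst (fun _ => rfl) fun c => ⟨(c, 0), rfl⟩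
    have h2 : Nat.card (ZMod w.n) ≤ cls (sc (sphere w).σ) Set.univ := by
      refine card_le_cls (fun d => if d.1 then d.2 else d.2 - 1) ?_ fun p => ⟨(true, p), rfl⟩
      rintro ⟨_ | _, p⟩
      · rfl
      · simp [sphere_σ_true]
    unfold Planar
    rw [Set.ncard_univ, Nat.card_prod]
    simp only [Nat.card_eq_fintype_card, Fintype.card_bool, ZMod.card] at h1 h2 ⊢
    omega
  flat := by
    rintro ⟨_ | _, p⟩
    · rw [sphere_σ_false]
      exact (mul_inv_cancel _).symm
    · rw [sphere_σ_true]
      change w.x (p + 1 - 1) = 1 * w.x p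
      rw [add_sub_cancel_right, one_mul]
  nodup := hn
  cover d hd := (hL d).2 (by simpa using hd)
  notMem d hd := by simpa using (hL d).1 hd
  map_φ := hφ

theorem Bounds.base (w : CyclicWord G) (b : Bool) : Bounds w b w.word ∧ Bounds w b w.word⁻¹ := by
  obtain ⟨m, hm⟩ := Nat.exists_eq_succ_of_ne_zero (NeZero.ne w.n)
  have hr : List.range w.n = List.range (m + 1) := by rw [hm]
  have hn0 : ((m : ZMod w.n) + 1) = 0 := by
    have : ∀ k, w.n = k → ((k : ℕ) : ZMod w.n) = 0 := by
      rintro _ rfl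
      exact ZMod.natCast_self _
    simpa using this _ hm
  have hinj : ∀ i < w.n, ∀ j < w.n, ((i : ℕ) : ZMod w.n) = j → i = j := by
    intro i hi j hj hij
    have := (ZMod.natCast_eq_natCast_iff' i j w.n).1 hij
    rwa [Nat.mod_eq_of_lt hi, Nat.mod_eq_of_lt hj] at this
  constructor
  · have h := disc_sphere w true (L := (List.range w.n).map fun i : ℕ => (true, (i : ZMod w.n)))
      (List.Nodup.map_on (fun i hi j hj hij => hinj i (by simpa using hi) j (by simpa using hj)
        (congrArg Prod.snd hij)) List.nodup_range)
      (fun d => by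
        rw [List.mem_map]
        constructor
        · rintro ⟨i, -, rfl⟩
          rfl
        · intro hd
          exact ⟨d.2.val, List.mem_range.2 (ZMod.val_lt _), by simp [← hd]⟩)
      (by
        conv_lhs => rw [hr, List.range_succ]
        conv_rhs => rw [hr, List.range_succ_eq_map, List.map_cons, List.rotate_cons_succ,
          List.rotate_zero]
        simp [sphere_φ_true, hn0, Function.comp_def])
    have e : ((List.range w.n).map fun i : ℕ => (true, (i : ZMod w.n))) =
        ((List.range m).map fun i : ℕ => (true, (i : ZMod w.n))) ++ [(true, (m : ZMod w.n))] := by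
      rw [hr, List.range_succ, List.map_append, List.map_singleton]
    rw [e] at h
    refine Bounds.any ⟨_, inferInstance, _, _, _, _, h, rfl, ?_⟩
    rw [← e, List.map_map]
    rfl
  · have h := disc_sphere w false
      (L := (List.range w.n).map fun i : ℕ => (false, -(i : ZMod w.n)))
      (List.Nodup.map_on (fun i hi j hj hij => hinj i (by simpa using hi) j (by simpa using hj)
        (neg_injective (congrArg Prod.snd hij))) List.nodup_range)
      (fun d => by
        rw [List.mem_map]
        constructor
        · rintro ⟨i, -, rfl⟩
          rfl
        · intro hd
          exact ⟨(-d.2).val, List.mem_range.2 (ZMod.val_lt _), by simp [← hd]⟩)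
      (by
        conv_lhs => rw [hr, List.range_succ]
        conv_rhs => rw [hr, List.range_succ_eq_map, List.map_cons, List.rotate_cons_succ,
          List.rotate_zero]
        have : -(m : ZMod w.n) - 1 = 0 := by
          rw [← neg_zero, ← hn0]
          ring
        simp [sphere_φ_false, this, Function.comp_def, add_comm, sub_eq_add_neg])
    have e : ((List.range w.n).map fun i : ℕ => (false, -(i : ZMod w.n))) =
        ((List.range m).map fun i : ℕ => (false, -(i : ZMod w.n))) ++
          [(false, -(m : ZMod w.n))] := by
      rw [hr, List.range_succ, List.map_append, List.map_singleton]
    rw [e] at h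
    refine Bounds.any ⟨_, inferInstance, _, _, _, _, h, rfl, ?_⟩
    rw [← e, List.map_map]
    refine eq_inv_of_mul_eq_one_right (prod_range_mul_prod_range_inv _ _ _ fun i hi => ?_)
    change (w.x (-(i : ZMod w.n) - 1))⁻¹ = _
    have e1 : ((w.n - 1 - i : ℕ) : ZMod w.n) = -(i : ZMod w.n) - 1 := by
      have : (w.n - 1 - i) + 1 + i = w.n := by omega
      have := congrArg (Nat.cast : ℕ → ZMod w.n) this
      push_cast at this
      rw [ZMod.natCast_self] at this
      linear_combination this
    rw [e1]

theorem Bounds.of_mem_normalClosure (htop : w.P false ⊔ w.P true = ⊤) {b : Bool} {g : G}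
    (hg : g ∈ Subgroup.normalClosure {w.word}) : Bounds w b g := by
  have hmul : ∀ {g h}, Bounds w b g → Bounds w b h → Bounds w b (g * h) := by
    intro g h hg hh
    simpa using hg.mul_conj hh (one_mem _)
  have hconj : ∀ {c γ g}, γ ∈ w.P c → Bounds w b g → Bounds w b (γ * g * γ⁻¹) := by
    intro c γ g hγ hg
    refine Bounds.any (b := c) ?_
    simpa using (Bounds.one w c).mul_conj hg.any hγ
  have hconj' : ∀ γ g, Bounds w b g → Bounds w b (γ * g * γ⁻¹) := by
    intro γ
    have hγ : γ ∈ w.P false ⊔ w.P true := htop ▸ trivial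
    rw [← Subgroup.closure_eq (w.P false), ← Subgroup.closure_eq (w.P true),
      ← Subgroup.closure_union] at hγ
    induction hγ using Subgroup.closure_induction'' with
    | mem γ h =>
      intro g hg
      rcases h with h | h
      · exact hconj h hg
      · exact hconj h hg
    | one =>
      intro g hg
      simpa using hg
    | inv_mem γ h =>
      intro g hg
      rcases h with h | h
      · exact hconj ((w.P _).inv_mem h) hg
      · exact hconj ((w.P _).inv_mem h) hg
    | mul γ γ' _ _ h h' =>
      intro g hg
      have := h _ (h' _ hg)
      rwa [show γ * (γ' * g * γ'⁻¹) * γ⁻¹ = γ * γ' * g * (γ * γ')⁻¹ by group] at this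
  rw [Subgroup.normalClosure] at hg
  induction hg using Subgroup.closure_induction'' with
  | one => exact Bounds.one w b
  | mul g h _ _ hg hh => exact hmul hg hh
  | mem g h =>
    obtain ⟨_, rfl, h⟩ := Group.mem_conjugatesOfSet_iff.1 h
    obtain ⟨c, rfl⟩ := isConj_iff.1 h
    exact hconj' _ _ (Bounds.base w b).1
  | inv_mem g h =>
    obtain ⟨_, rfl, h⟩ := Group.mem_conjugatesOfSet_iff.1 h
    obtain ⟨c, rfl⟩ := isConj_iff.1 h
    rw [conj_inv]
    exact hconj' _ _ (Bounds.base w b).2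

end Picture

end OneRelator

/-! ### Heights on a cyclic word and the index argument -/

namespace OneRelator

open Equiv Equiv.Perm

variable {D G : Type*} [Group G] {w : CyclicWord G}

theorem cls_le_of_forall_exists [Finite D] {r : Setoid D} {Y Z : Set D}
    (h : ∀ y ∈ Y, ∃ z ∈ Z, r y z) : cls r Y ≤ Z.ncard := by
  refine le_trans (Set.ncard_le_ncard ?_ (Set.toFinite _)) (cls_le_ncard r Z)
  rintro _ ⟨y, hy, rfl⟩
  obtain ⟨z, hz, hyz⟩ := h y hy
  exact ⟨z, hz, Quotient.sound (r.symm hyz)⟩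

theorem exists_switch [Finite D] {f : Perm D} {o : D → Prop} {d a b : D} (ha : sc f d a)
    (hb : sc f d b) (hoa : o a) (hob : ¬ o b) : ∃ z, sc f d z ∧ o z ∧ ¬ o (f z) := by
  by_contra! h
  obtain ⟨i, rfl⟩ := SameCycle.exists_nat_pow_eq ((sc f).trans ((sc f).symm ha) hb)
  have : ∀ i : ℕ, o ((f ^ i) a) := by
    intro i
    induction i with
    | zero => exact hoa
    | succ i ih =>
      rw [pow_succ', Perm.mul_apply]
      exact h _ ((sc f).trans ha ⟨i, by simp⟩) ih
  exact hob (this i)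

/-- Two compatible height functions on the positions of a cyclic word, one for each of the two
subgroups, with values in linear orders on which the letters act. -/
structure Heights (w : CyclicWord G) (Ω : Bool → Type*) [∀ b, LinearOrder (Ω b)] where
  H : Subgroup G
  mem : ∀ p, w.x p ∈ H
  act : ∀ b, H →* (Ω b ≃o Ω b)
  f : ∀ b, ZMod w.n → Ω b
  lt_iff : ∀ p q, f false p < f false q ↔ f true p < f true q
  step : ∀ p, f (w.par p) (p + 1) = (act (w.par p) ⟨w.x p, mem p⟩)⁻¹ (f (w.par p) p)
  eq_of_tie : ∀ p q, f false p = f false q → w.par p = w.par q ∧ ∀ j, w.x (p + j) = w.x (q + j)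

theorem Heights.lt_iff' {Ω : Bool → Type*} [∀ b, LinearOrder (Ω b)] (F : Heights w Ω) (b c : Bool)
    (p q : ZMod w.n) : F.f b p < F.f b q ↔ F.f c p < F.f c q := by
  cases b <;> cases c
  · rfl
  · exact F.lt_iff p q
  · exact (F.lt_iff p q).symm
  · rfl

namespace Picture

theorem Bounds.exists_reduced {a : G} {b : Bool} (h : Bounds w b a) (ha : a ∈ w.P b) (ha1 : a ≠ 1) :
    ∃ (D : Type) (_ : Finite D) (S : Picture D G w.n) (Y W : Set D) (d : D), S.Base w Y W ∧
      S.Planar Y ∧ S.Sole Y d ∧ Y ⊆ W ∧ S.Reduced w Y := by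
  classical
  obtain ⟨D, _, S, W, L, x, hS, rfl, rfl⟩ := h
  have hxL : ∀ d ∈ L, d ≠ x := by
    rintro d hd rfl
    exact List.disjoint_of_nodup_append hS.nodup hd (by simp)
  have hxW : x ∉ W := hS.notMem x (by simp)
  set a := ((L ++ [x]).map S.ℓ).prod with hadef
  let T : Picture D G w.n := { S with ℓ := Function.update S.ℓ x (S.ℓ x * a⁻¹) }
  have hT1 : T.ℓ x = S.ℓ x * a⁻¹ := Function.update_self x _ S.ℓ
  have hT2 : ∀ d ≠ x, T.ℓ d = S.ℓ d := fun d hd => Function.update_of_ne hd _ S.ℓ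
  have hB : T.Base w Set.univ W := by
    refine { hS.base with
      mem := fun d => ?_
      reads := hS.base.reads.congr subset_rfl rfl rfl rfl (fun _ _ => rfl) (fun d hd => hT2 d ?_)
        hS.base.reads.φ_mem }
    · by_cases hd : d = x
      · rw [hd, hT1]
        exact mul_mem (hS.base.mem x) ((w.P _).inv_mem ha)
      · rw [hT2 d hd]
        exact hS.base.mem d
    · rintro rfl
      exact hxW hd
  have hs : T.Sole Set.univ x := by
    refine ⟨trivial, ?_, fun d _ hd => ?_⟩
    · change S.t (S.σ x) ≠ S.t x * T.ℓ x
      rw [hS.flat, hT1]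
      simpa using ha1
    · by_contra hdx
      refine hd ?_
      rw [hT2 d hdx]
      exact hS.flat d
  have hH : T.Hole Set.univ W (L ++ [x]) :=
    { nodup := hS.nodup
      cover := fun d _ => hS.cover d
      mem := fun d hd => ⟨trivial, hS.notMem d hd⟩
      map_φ := hS.map_φ
      prod := by
        have e : L.map T.ℓ = L.map S.ℓ := List.map_congr_left fun d hd => hT2 d (hxL d hd)
        rw [List.map_append, List.prod_append, e, List.map_singleton, List.prod_singleton, hT1,
          ← mul_assoc, mul_inv_eq_one, hadef, List.map_append, List.prod_append,
          List.map_singleton, List.prod_singleton] }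
  obtain ⟨S', Y', d', -, hYW, hB', hc', hp', hs'⟩ := exists_pictures_without_hole _ T Set.univ W _ x
    le_rfl hB hS.conn hS.planar hs hH
  obtain ⟨S'', Y'', W'', d'', h⟩ := Picture.exists_reduced _ S' Y' W d' le_rfl hB' hc' hp' hs' hYW
  exact ⟨D, inferInstance, S'', Y'', W'', d'', h⟩

section Index

variable {S : Picture D G w.n} {Y W : Set D} {Ω : Bool → Type*} [∀ b, LinearOrder (Ω b)]

theorem Reads.step (F : Heights w Ω) (hR : S.Reads w W) {d : D} (hd : d ∈ W) (hℓ : S.ℓ d ∈ F.H) :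
    F.act (S.τ d) ⟨S.ℓ d, hℓ⟩ (F.f (S.τ d) (S.pos (S.φ d))) = F.f (S.τ d) (S.pos d) := by
  cases h : S.sg d with
  | true =>
    have e : (⟨S.ℓ d, hℓ⟩ : F.H) = ⟨w.x (S.pos d), F.mem _⟩ := Subtype.ext (hR.ℓ_of_true d hd h)
    rw [hR.pos_of_true d hd h, hR.τ_of_true d hd h, e, F.step]
    exact OrderIso.apply_symm_apply _ _
  | false =>
    have e : (⟨S.ℓ d, hℓ⟩ : F.H) = ⟨w.x (S.pos (S.φ d)), F.mem _⟩⁻¹ :=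
      Subtype.ext (hR.ℓ_of_false d hd h)
    rw [← hR.pos_of_false d hd h, hR.τ_of_false d hd h, e, F.step, map_inv]

theorem Reads.ℓ_mem (F : Heights w Ω) (hR : S.Reads w W) {d : D} (hd : d ∈ W) : S.ℓ d ∈ F.H := by
  cases h : S.sg d with
  | true =>
    rw [hR.ℓ_of_true d hd h]
    exact F.mem _
  | false =>
    rw [hR.ℓ_of_false d hd h]
    exact F.H.inv_mem (F.mem _)

theorem Reads.exists_pos (hR : S.Reads w W) {d : D} (hd : d ∈ W) (p : ZMod w.n) :
    ∃ e, sc S.φ d e ∧ S.pos e = p := by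
  cases h : S.sg d with
  | true =>
    refine ⟨(S.φ ^ (p - S.pos d).val) d, ⟨_, by rw [zpow_natCast]⟩, ?_⟩
    rw [hR.pos_pow_of_true hd h]
    simp
  | false =>
    refine ⟨(S.φ ^ (S.pos d - p).val) d, ⟨_, by rw [zpow_natCast]⟩, ?_⟩
    rw [hR.pos_pow_of_false hd h]
    simp

theorem tie_ne (F : Heights w Ω) (hB : S.Base w Y W) (hYW : Y ⊆ W) (hr : S.Reduced w Y) {d : D}
    (hd : d ∈ Y) (b : Bool) : F.f b (S.pos d) ≠ F.f b (S.pos (S.α d)) := by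
  intro h
  replace h : F.f false (S.pos d) = F.f false (S.pos (S.α d)) := by
    apply le_antisymm <;> rw [← not_lt, F.lt_iff' false b, h] <;> exact lt_irrefl _
  have hα := hB.closed.2 d hd
  obtain ⟨hp, hx⟩ := F.eq_of_tie _ _ h
  have hτ := hB.τα d
  have hR := hB.reads
  have key : ∀ e ∈ Y, S.sg e = false → w.par (S.pos e) = !S.τ e := by
    intro e he hse
    rw [← hR.pos_of_false e (hYW he) hse, w.par_succ, hR.τ_of_false e (hYW he) hse]
  cases h1 : S.sg d <;> cases h2 : S.sg (S.α d)
  · rw [key d hd h1, key _ hα h2, hτ] at hp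
    simp at hp
  · refine hr _ hα h2 (by rw [hB.αα, h1]) fun j => ?_
    rw [hB.αα, hx]
  · exact hr d hd h1 h2 hx
  · rw [← hR.τ_of_true d (hYW hd) h1, ← hR.τ_of_true _ (hYW hα) h2, hτ] at hp
    simp at hp

theorem exists_not_rel [Finite D] (F : Heights w Ω) (hB : S.Base w Y W) (hYW : Y ⊆ W) {d : D}
    (hd : d ∈ Y) (hdef : ∀ e, sc S.σ d e → ¬ S.Defect e) (R : Ω (S.τ d) → Ω (S.τ d) → Prop)
    (hR1 : ∀ a, ¬ R a a) (hR2 : ∀ {a b c}, R a b → R b c → R a c)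
    (hR3 : ∀ g {a b}, R a b → R (F.act _ g a) (F.act _ g b)) :
    ∃ e, sc S.σ d e ∧
      ¬ R (F.f (S.τ d) (S.pos (S.φ e))) (F.f (S.τ d) (S.pos (S.σ e))) := by
  by_contra! h
  have hτ : ∀ i : ℕ, S.τ ((S.σ ^ i) d) = S.τ d := by
    intro i
    induction i with
    | zero => rfl
    | succ i ih => rw [pow_succ', Perm.mul_apply, σ_apply, hB.τα, hB.τφ, Bool.not_not, ih]
  have hY : ∀ i : ℕ, (S.σ ^ i) d ∈ Y := fun i =>
    mem_of_sc (f := S.σ) (fun e he => hB.closed.σ_mem he) hd ⟨i, by simp⟩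
  have key : ∀ i : ℕ, ∃ g : F.H, S.t ((S.σ ^ (i + 1)) d) = S.t d * g ∧
      R (F.f (S.τ d) (S.pos d)) (F.act _ g (F.f (S.τ d) (S.pos ((S.σ ^ (i + 1)) d)))) := by
    have base : ∀ i : ℕ, ∃ g : F.H, S.t ((S.σ ^ (i + 1)) d) = S.t ((S.σ ^ i) d) * g ∧
        R (F.f (S.τ d) (S.pos ((S.σ ^ i) d)))
          (F.act _ g (F.f (S.τ d) (S.pos ((S.σ ^ (i + 1)) d)))) := by
      intro i
      have hsc : sc S.σ d ((S.σ ^ i) d) := ⟨i, by simp⟩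
      have hℓ := hB.reads.ℓ_mem F (hYW (hY i))
      refine ⟨⟨_, hℓ⟩, ?_, ?_⟩
      · rw [pow_succ', Perm.mul_apply]
        exact not_not.1 (hdef _ hsc)
      · have h1 := hB.reads.step F (hYW (hY i)) hℓ
        have h2 := hR3 ⟨_, hℓ⟩ (h _ hsc)
        rw [hτ] at h1
        rw [h1] at h2
        rwa [pow_succ', Perm.mul_apply]
    intro i
    induction i with
    | zero => simpa using base 0
    | succ i ih =>
      obtain ⟨g, hg1, hg2⟩ := ih
      obtain ⟨k, hk1, hk2⟩ := base (i + 1)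
      refine ⟨g * k, ?_, hR2 hg2 ?_⟩
      · rw [hk1, hg1, Subgroup.coe_mul, mul_assoc]
      · rw [map_mul]
        exact hR3 g hk2
  obtain ⟨g, hg1, hg2⟩ := key (orderOf S.σ - 1)
  rw [Nat.sub_add_cancel (orderOf_pos S.σ), pow_orderOf_eq_one, Perm.one_apply] at hg1 hg2
  have : g = 1 := Subtype.ext (by simpa using hg1)
  rw [this, map_one] at hg2
  exact hR1 _ hg2

theorem not_sole_of_reduced [Finite D] (F : Heights w Ω) (hB : S.Base w Y W) (hp : S.Planar Y)
    (hYW : Y ⊆ W) (hr : S.Reduced w Y) (d₀ : D) : ¬ S.Sole Y d₀ := by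
  rintro ⟨-, -, hs⟩
  set o : D → Prop := fun d => F.f false (S.pos d) < F.f false (S.pos (S.α d)) with ho
  have hob : ∀ b d, o d ↔ F.f b (S.pos d) < F.f b (S.pos (S.α d)) := fun b d => F.lt_iff' _ _ _ _
  have hoα : ∀ d ∈ Y, (o (S.α d) ↔ ¬ o d) := by
    intro d hd
    simp only [ho, hB.αα, not_lt]
    exact ⟨le_of_lt, fun h => lt_of_le_of_ne h (tie_ne F hB hYW hr hd false).symm⟩
  have hoσ : ∀ d ∈ Y, (o (S.σ d) ↔ ¬ o (S.φ d)) := fun d hd => hoα _ (hB.closed.1 d hd)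
  have hφY : ∀ {d e}, d ∈ Y → sc S.φ d e → e ∈ Y := mem_of_sc hB.closed.1
  have hσY : ∀ {d e}, d ∈ Y → sc S.σ d e → e ∈ Y := mem_of_sc fun d hd => hB.closed.σ_mem hd
  have hφ : ∀ d ∈ Y, (∃ e, sc S.φ d e ∧ o e) ∧ ∃ e, sc S.φ d e ∧ ¬ o e := by
    intro d hd
    obtain ⟨p, hp⟩ := Finite.exists_min (F.f false)
    obtain ⟨q, hq⟩ := Finite.exists_max (F.f false)
    obtain ⟨e, he, rfl⟩ := hB.reads.exists_pos (hYW hd) p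
    obtain ⟨e', he', rfl⟩ := hB.reads.exists_pos (hYW hd) q
    exact ⟨⟨e, he, lt_of_le_of_ne (hp _) (tie_ne F hB hYW hr (hφY hd he) false)⟩,
      e', he', not_lt.2 (hq _)⟩
  have hσ : ∀ d ∈ Y, ¬ sc S.σ d d₀ → (∃ e, sc S.σ d e ∧ o e) ∧ ∃ e, sc S.σ d e ∧ ¬ o e := by
    intro d hd hd₀
    have hdef : ∀ e, sc S.σ d e → ¬ S.Defect e := by
      intro e he hde
      rw [hs e (hσY hd he) hde] at he
      exact hd₀ he
    have hstep : ∀ e, sc S.σ d e → sc S.σ d (S.σ e) := fun e he => (sc S.σ).trans he (sc_self _ e)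
    constructor
    · obtain ⟨e, he, h⟩ := exists_not_rel F hB hYW hd hdef (· < ·) (fun a => lt_irrefl a) lt_trans
        (fun g _ _ h => (F.act _ g).lt_iff_lt.2 h)
      exact ⟨S.σ e, hstep e he, (hoσ e (hσY hd he)).2 fun h' => h ((hob _ _).1 h')⟩
    · obtain ⟨e, he, h⟩ := exists_not_rel F hB hYW hd hdef (· > ·) (fun a => lt_irrefl a)
        (fun h h' => lt_trans h' h) (fun g _ _ h => (F.act _ g).lt_iff_lt.2 h)
      refine ⟨S.σ e, hstep e he, fun h' => h ?_⟩
      rw [hob (S.τ d), σ_apply, hB.αα] at h'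
      exact h'
  have a1 : cls (sc S.φ) Y ≤ {d ∈ Y | o d ∧ ¬ o (S.φ d)}.ncard := by
    refine cls_le_of_forall_exists fun d hd => ?_
    obtain ⟨⟨a, ha, hoa⟩, b, hb, hob⟩ := hφ d hd
    obtain ⟨z, hz, h⟩ := exists_switch ha hb hoa hob
    exact ⟨z, ⟨hφY hd hz, h⟩, hz⟩
  have a2 : cls (sc S.φ) Y ≤ {d ∈ Y | ¬ o d ∧ o (S.φ d)}.ncard := by
    refine cls_le_of_forall_exists fun d hd => ?_
    obtain ⟨⟨a, ha, hoa⟩, b, hb, hob⟩ := hφ d hd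
    obtain ⟨z, hz, h⟩ := exists_switch (o := fun d => ¬ o d) hb ha hob (not_not.2 hoa)
    exact ⟨z, ⟨hφY hd hz, h.1, not_not.1 h.2⟩, hz⟩
  have b1 : cls (sc S.σ) Y ≤ {d ∈ Y | o d ∧ o (S.φ d)}.ncard + 1 := by
    refine le_trans (cls_le_of_forall_exists fun d hd => ?_) (Set.ncard_insert_le d₀ _)
    by_cases hd₀ : sc S.σ d d₀
    · exact ⟨d₀, Set.mem_insert _ _, hd₀⟩
    obtain ⟨⟨a, ha, hoa⟩, b, hb, hob⟩ := hσ d hd hd₀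
    obtain ⟨z, hz, h⟩ := exists_switch ha hb hoa hob
    refine ⟨z, Set.mem_insert_of_mem _ ⟨hσY hd hz, h.1, ?_⟩, hz⟩
    by_contra h'
    exact h.2 ((hoσ z (hσY hd hz)).2 h')
  have b2 : cls (sc S.σ) Y ≤ {d ∈ Y | ¬ o d ∧ ¬ o (S.φ d)}.ncard + 1 := by
    refine le_trans (cls_le_of_forall_exists fun d hd => ?_) (Set.ncard_insert_le d₀ _)
    by_cases hd₀ : sc S.σ d d₀
    · exact ⟨d₀, Set.mem_insert _ _, hd₀⟩
    obtain ⟨⟨a, ha, hoa⟩, b, hb, hob⟩ := hσ d hd hd₀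
    obtain ⟨z, hz, h⟩ := exists_switch (o := fun d => ¬ o d) hb ha hob (not_not.2 hoa)
    exact ⟨z, Set.mem_insert_of_mem _ ⟨hσY hd hz, h.1,
      (hoσ z (hσY hd hz)).1 (not_not.1 h.2)⟩, hz⟩
  have split : ∀ (Z : Set D) (P : D → Prop),
      {d ∈ Z | P d}.ncard + {d ∈ Z | ¬ P d}.ncard = Z.ncard := by
    intro Z P
    rw [← Set.ncard_union_eq _ (Set.toFinite _) (Set.toFinite _)]
    · congr 1
      ext d
      simp only [Set.mem_union, Set.mem_ofPred_eq]
      by_cases P d <;> simp [*]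
    · rw [Set.disjoint_left]
      exact fun d h h' => h'.2 h.2
  have s0 := split Y o
  have s1 := split {d ∈ Y | o d} fun d => o (S.φ d)
  have s2 := split {d ∈ Y | ¬ o d} fun d => o (S.φ d)
  simp only [Set.mem_ofPred_eq, and_assoc] at s1 s2
  unfold Planar at hp
  omega

end Index

/-- A cyclic word with heights does not normally generate. -/
theorem _root_.OneRelator.Heights.eq_one {Ω : Bool → Type*} [∀ b, LinearOrder (Ω b)]
    (F : Heights w Ω) (htop : w.P false ⊔ w.P true = ⊤) {b : Bool} {a : G} (ha : a ∈ w.P b)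
    (h : a ∈ Subgroup.normalClosure {w.word}) : a = 1 := by
  by_contra ha1
  obtain ⟨D, _, S, Y, W, d, hB, hp, hs, hYW, hr⟩ :=
    (Bounds.of_mem_normalClosure (b := b) htop h).exists_reduced ha ha1
  exact not_sole_of_reduced F hB hp hYW hr d hs

end Picture

end OneRelator

/-! ### Actions of countable left-ordered groups on the line -/

namespace OneRelator

/-- An action by monotone maps, as a homomorphism to the group of order automorphisms. -/
def orderAction {K α : Type*} [Group K] [LinearOrder α] (a : K → α → α) (one : ∀ x, a 1 x = x)
    (mul : ∀ g h x, a (g * h) x = a g (a h x)) (mono : ∀ g x y, x ≤ y → a g x ≤ a g y) :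
    K →* (α ≃o α) where
  toFun g :=
    { toFun := a g
      invFun := a g⁻¹
      left_inv := fun x => by rw [← mul, inv_mul_cancel, one]
      right_inv := fun x => by rw [← mul, mul_inv_cancel, one]
      map_rel_iff' := fun {x y} => ⟨fun h => by
        have := mono g⁻¹ _ _ h
        change a g⁻¹ (a g x) ≤ a g⁻¹ (a g y) at this
        rwa [← mul, ← mul, inv_mul_cancel, one, one] at this, mono g x y⟩ }
  map_one' := by
    ext x
    exact one x
  map_mul' g h := by
    ext x
    exact mul g h x

section Extension

/-- The extension of an order automorphism of `ℚ` to `ℝ`. -/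
noncomputable def extendReal (φ : ℚ ≃o ℚ) (r : ℝ) : ℝ :=
  sSup ((fun q : ℚ => ((φ q : ℚ) : ℝ)) '' {q : ℚ | (q : ℝ) < r})

theorem lt_extendReal {φ : ℚ ≃o ℚ} {r : ℝ} {q : ℚ} :
    (q : ℝ) < extendReal φ r ↔ ((φ.symm q : ℚ) : ℝ) < r := by
  have hne : ((fun q : ℚ => ((φ q : ℚ) : ℝ)) '' {q : ℚ | (q : ℝ) < r}).Nonempty := by
    obtain ⟨q, hq⟩ := exists_rat_lt r
    exact ⟨_, q, hq, rfl⟩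
  have hbdd : BddAbove ((fun q : ℚ => ((φ q : ℚ) : ℝ)) '' {q : ℚ | (q : ℝ) < r}) := by
    obtain ⟨q, hq⟩ := exists_rat_gt r
    refine ⟨(φ q : ℚ), ?_⟩
    rintro _ ⟨p, hp, rfl⟩
    have : p < q := by exact_mod_cast lt_trans hp hq
    change ((φ p : ℚ) : ℝ) ≤ (φ q : ℚ)
    exact_mod_cast (φ.lt_iff_lt.2 this).le
  rw [extendReal, lt_csSup_iff hbdd hne]
  constructor
  · rintro ⟨_, ⟨p, hp, rfl⟩, h⟩
    change (q : ℝ) < ((φ p : ℚ) : ℝ) at h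
    have h' : q < φ p := by exact_mod_cast h
    refine lt_trans ?_ hp
    exact_mod_cast φ.symm_apply_lt.2 h'
  · intro h
    obtain ⟨p, hp, hpr⟩ := exists_rat_btwn h
    have hp' : φ.symm q < p := by exact_mod_cast hp
    refine ⟨_, ⟨p, hpr, rfl⟩, ?_⟩
    change (q : ℝ) < ((φ p : ℚ) : ℝ)
    exact_mod_cast φ.symm_apply_lt.1 hp'

theorem le_of_forall_rat {r s : ℝ} (h : ∀ q : ℚ, (q : ℝ) < r → (q : ℝ) < s) : r ≤ s := by
  by_contra! hlt
  obtain ⟨q, hq, hq'⟩ := exists_rat_btwn hlt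
  exact lt_asymm hq (h q hq')

theorem extendReal_mono (φ : ℚ ≃o ℚ) {r s : ℝ} (h : r ≤ s) : extendReal φ r ≤ extendReal φ s :=
  le_of_forall_rat fun _ hq => lt_extendReal.2 (lt_of_lt_of_le (lt_extendReal.1 hq) h)

theorem extendReal_one (r : ℝ) : extendReal 1 r = r :=
  le_antisymm (le_of_forall_rat fun _ hq => lt_extendReal.1 hq)
    (le_of_forall_rat fun _ hq => lt_extendReal.2 hq)

theorem extendReal_mul (φ ψ : ℚ ≃o ℚ) (r : ℝ) :
    extendReal (φ * ψ) r = extendReal φ (extendReal ψ r) := by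
  have h : ∀ q : ℚ, (q : ℝ) < extendReal (φ * ψ) r ↔ (q : ℝ) < extendReal φ (extendReal ψ r) := by
    intro q
    rw [lt_extendReal, lt_extendReal, lt_extendReal]
    rfl
  exact le_antisymm (le_of_forall_rat fun q => (h q).1) (le_of_forall_rat fun q => (h q).2)

theorem extendReal_ratCast (φ : ℚ ≃o ℚ) (q : ℚ) : extendReal φ q = (φ q : ℚ) := by
  have h : ∀ p : ℚ, (p : ℝ) < extendReal φ q ↔ (p : ℝ) < ((φ q : ℚ) : ℝ) := by
    intro p
    rw [lt_extendReal]
    norm_cast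
    exact φ.symm_apply_lt
  exact le_antisymm (le_of_forall_rat fun q => (h q).1) (le_of_forall_rat fun q => (h q).2)

theorem abs_extendReal_sub_le {φ : ℚ ≃o ℚ} {a b : ℚ} (hab : a ≤ b) (ha : ∀ q ≤ a, φ q = q)
    (hb : ∀ q, b ≤ q → φ q = q) (r : ℝ) : |extendReal φ r - r| ≤ b - a := by
  have hs : ∀ q, φ q = q → φ.symm q = q := fun q h => by rw [φ.symm_apply_eq, h]
  have hea : extendReal φ a = a := by rw [extendReal_ratCast, ha a le_rfl]
  have heb : extendReal φ b = b := by rw [extendReal_ratCast, hb b le_rfl]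
  have hab' : (a : ℝ) ≤ b := by exact_mod_cast hab
  have fixed : (∀ q : ℚ, (q : ℝ) < extendReal φ r ↔ (q : ℝ) < r) →
      |extendReal φ r - r| ≤ b - a := by
    intro h
    rw [le_antisymm (le_of_forall_rat fun q => (h q).1) (le_of_forall_rat fun q => (h q).2)]
    simpa using hab'
  rcases lt_or_ge r a with h | h
  · refine fixed fun q => ?_
    rcases le_or_gt q a with hq | hq
    · rw [lt_extendReal, hs q (ha q hq)]
    · have hq' : (a : ℝ) < q := by exact_mod_cast hq
      have h1 := extendReal_mono φ h.le
      rw [hea] at h1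
      exact ⟨fun h2 => by linarith, fun h2 => by linarith⟩
  rcases lt_or_ge (b : ℝ) r with h' | h'
  · refine fixed fun q => ?_
    rcases le_or_gt b q with hq | hq
    · rw [lt_extendReal, hs q (hb q hq)]
    · have hq' : (q : ℝ) < b := by exact_mod_cast hq
      have h1 := extendReal_mono φ h'.le
      rw [heb] at h1
      exact ⟨fun h2 => by linarith, fun h2 => by linarith⟩
  · have h1 := extendReal_mono φ h
    have h2 := extendReal_mono φ h'
    rw [hea] at h1
    rw [heb] at h2
    rw [abs_le]
    constructor <;> linarith

end Extension

/-- A countable left-ordered group acts on the line with bounded displacement, freely at `0`. -/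
theorem exists_action_real (K : Type*) [Group K] [Countable K] [LinearOrder K]
    (hK : ∀ g a b : K, a < b → g * a < g * b) :
    ∃ (ρ : K →* (ℝ ≃o ℝ)) (C : ℝ), (∀ k, ρ k 0 = 0 → k = 1) ∧ ∀ k r, |ρ k r - r| ≤ C := by
  have : Countable (WithTop K) := inferInstanceAs (Countable (Option K))
  have : Countable (WithBot (WithTop K)) := inferInstanceAs (Countable (Option (WithTop K)))
  have : Countable (WithBot (WithTop K) ×ₗ ℚ) := inferInstanceAs (Countable (_ × ℚ))
  obtain ⟨e₀⟩ := Order.iso_of_countable_dense (WithBot (WithTop K) ×ₗ ℚ) ℚ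
  let e := e₀.trans (OrderIso.addRight (-e₀ (toLex (((1 : K) : WithTop K), 0))))
  have he : e (toLex (((1 : K) : WithTop K), 0)) = 0 := add_neg_cancel _
  let m : K → WithBot (WithTop K) → WithBot (WithTop K) := fun k => WithBot.map (WithTop.map (k * ·))
  have m_one : ∀ x, m 1 x = x := by rintro (_ | _ | x) <;> simp [m] <;> rfl
  have m_mul : ∀ g h x, m (g * h) x = m g (m h x) := by
    rintro g h (_ | _ | x)
    · rfl
    · rfl
    · change (((g * h * x : K) : WithTop K) : WithBot (WithTop K)) = ((g * (h * x) : K) : WithTop K)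
      rw [mul_assoc]
  have m_mono : ∀ g, StrictMono (m g) := fun g =>
    (StrictMono.withTop_map fun a b h => hK g a b h).withBot_map
  let a : K → ℚ → ℚ := fun k q => e (toLex (m k (ofLex (e.symm q)).1, (ofLex (e.symm q)).2))
  let A : K →* (ℚ ≃o ℚ) := orderAction a (fun x => by simp [a, m_one]) (fun g h x => by simp [a, m_mul])
    (fun g x y h => by
      refine e.le_iff_le.2 ?_
      have h' := e.symm.le_iff_le.2 h
      rw [Prod.Lex.le_iff] at h' ⊢
      exact h'.imp (fun h => m_mono g h) fun h => ⟨congrArg (m g) h.1, h.2⟩)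
  have hA : ∀ k q, A k q = a k q := fun _ _ => rfl
  let R : K →* (ℝ ≃o ℝ) := orderAction (fun k => extendReal (A k))
    (fun x => by rw [map_one, extendReal_one]) (fun g h x => by rw [map_mul, extendReal_mul])
    (fun g x y h => extendReal_mono _ h)
  have hR : ∀ k r, R k r = extendReal (A k) r := fun _ _ => rfl
  have fix : ∀ k q, m k (ofLex (e.symm q)).1 = (ofLex (e.symm q)).1 → A k q = q := by
    intro k q h
    rw [hA]
    simp only [a, h]
    exact e.apply_symm_apply q
  refine ⟨R, (e (toLex (((⊤ : WithTop K) : WithBot (WithTop K)), 0)) : ℚ) - (e (toLex (⊥, 0)) : ℚ),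
    fun k hk => ?_, fun k r => abs_extendReal_sub_le ?_ ?_ ?_ r⟩
  · rw [hR, ← Rat.cast_zero, extendReal_ratCast, hA, Rat.cast_inj] at hk
    have h0 : e.symm 0 = toLex ((((1 : K) : WithTop K) : WithBot (WithTop K)), (0 : ℚ)) :=
      e.symm_apply_eq.2 he.symm
    replace hk : toLex (m k (ofLex (e.symm 0)).1, (ofLex (e.symm 0)).2) = e.symm 0 :=
      e.eq_symm_apply.2 hk
    rw [h0] at hk
    have := congrArg Prod.fst (toLex.injective hk)
    change (((k * 1 : K) : WithTop K) : WithBot (WithTop K)) = ((1 : K) : WithTop K) at this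
    simpa using this
  · refine e.le_iff_le.2 ?_
    rw [Prod.Lex.le_iff]
    exact Or.inl (WithBot.bot_lt_coe _)
  · intro q hq
    refine fix k q ?_
    have h := e.symm.le_iff_le.2 hq
    rw [e.symm_apply_apply, Prod.Lex.le_iff] at h
    have : (ofLex (e.symm q)).1 = ⊥ := h.elim (fun h => absurd h not_lt_bot) fun h => h.1
    rw [this]
    rfl
  · intro q hq
    refine fix k q ?_
    have h := e.symm.le_iff_le.2 hq
    rw [e.symm_apply_apply, Prod.Lex.le_iff] at h
    have : (ofLex (e.symm q)).1 = ((⊤ : WithTop K) : WithBot (WithTop K)) :=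
      h.elim (fun h => absurd h not_top_lt) fun h => h.1.symm
    rw [this]
    rfl

end OneRelator

/-! ### Configurations of heights and their refinements -/

namespace OneRelator

/-- The components on one side: ties are joined, and so are consecutive positions on that side. -/
def comp {n : ℕ} (par : ZMod n → Bool) (tie : Setoid (ZMod n)) (b : Bool) : Setoid (ZMod n) :=
  tie ⊔ Relation.EqvGen.setoid fun p q => par p = b ∧ q = p + 1

section Comp

variable {n : ℕ} {par : ZMod n → Bool} {tie : Setoid (ZMod n)} {b : Bool} {p q : ZMod n}

theorem comp_of_tie (h : tie p q) : comp par tie b p q := (le_sup_left : tie ≤ comp par tie b) h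

theorem comp_succ (h : par p = b) : comp par tie b p (p + 1) :=
  (le_sup_right : _ ≤ comp par tie b) (Relation.EqvGen.rel _ _ ⟨h, rfl⟩)

theorem comp_le {r : Setoid (ZMod n)} (h : tie ≤ r) (h' : ∀ p, par p = b → r p (p + 1)) :
    comp par tie b ≤ r := by
  refine sup_le h (Setoid.eqvGen_le ?_)
  rintro p _ ⟨hp, rfl⟩
  exact h' p hp

end Comp

variable {K : Type*} [Group K] {n : ℕ} [NeZero n]

/-- Heights in linear orders with an action of `K`, allowing arbitrary ties. -/
structure Config (par : ZMod n → Bool) (x : ZMod n → K) where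
  Ω : Bool → Type
  ord : ∀ b, LinearOrder (Ω b)
  act : ∀ b, K →* (Ω b ≃o Ω b)
  f : ∀ b, ZMod n → Ω b
  lt_iff : ∀ p q, f false p < f false q ↔ f true p < f true q
  step : ∀ p, f (par p) (p + 1) = act (par p) (x p)⁻¹ (f (par p) p)

attribute [instance] Config.ord

namespace Config

variable {par : ZMod n → Bool} {x : ZMod n → K}

/-- Positions of the same height. -/
def tie (C : Config par x) : Setoid (ZMod n) := Setoid.ker (C.f false)

theorem eq_iff (C : Config par x) (b : Bool) (p q : ZMod n) : C.f b p = C.f b q ↔ C.tie p q := by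
  cases b with
  | false => rfl
  | true =>
    change _ ↔ C.f false p = C.f false q
    simp only [le_antisymm_iff, ← not_lt, C.lt_iff]

/-- The configuration in which all positions have the same height. -/
def trivial (par : ZMod n → Bool) (x : ZMod n → K) : Config par x where
  Ω _ := Unit
  ord _ := inferInstance
  act _ := 1
  f _ _ := ()
  lt_iff _ _ := Iff.rfl
  step _ := rfl

open Classical in
theorem exists_refine (C : Config par x) (ρ : Bool → ZMod n → K →* (ℝ ≃o ℝ))
    (hρ : ∀ b p q, comp par C.tie b p q → ρ b p = ρ b q) (r : Bool → ZMod n → ℝ)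
    (hr : ∀ p, r (par p) (p + 1) = ρ (par p) p (x p)⁻¹ (r (par p) p))
    (hlt : ∀ p q, C.tie p q → (r false p < r false q ↔ r true p < r true q)) :
    ∃ C' : Config par x, ∀ p q, C'.tie p q ↔ C.tie p q ∧ r false p = r false q := by
  let rep : Bool → ZMod n → ℕ := fun b p => (Quotient.mk (comp par C.tie b) p).out.val
  have rep_eq : ∀ {b p q}, comp par C.tie b p q → rep b p = rep b q := fun h =>
    congrArg (fun z => (Quotient.out z).val) (Quotient.sound h)
  have hrep : ∀ b p, ρ b ((rep b p : ℕ) : ZMod n) = ρ b p := by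
    intro b p
    simp only [rep, ZMod.natCast_val, ZMod.cast_id', id]
    exact hρ b _ _ (Quotient.mk_out (s := comp par C.tie b) p)
  let a : ∀ b, K → C.Ω b ×ₗ (ℕ ×ₗ ℝ) → C.Ω b ×ₗ (ℕ ×ₗ ℝ) := fun b g z =>
    toLex (C.act b g (ofLex z).1, toLex ((ofLex (ofLex z).2).1,
      ρ b ((ofLex (ofLex z).2).1 : ℕ) g (ofLex (ofLex z).2).2))
  let F : ∀ b, ZMod n → C.Ω b ×ₗ (ℕ ×ₗ ℝ) := fun b p => toLex (C.f b p, toLex (rep b p, r b p))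
  have hF : ∀ b p q, F b p < F b q ↔ C.f b p < C.f b q ∨ C.tie p q ∧ r b p < r b q := by
    intro b p q
    simp only [F, Prod.Lex.toLex_lt_toLex, C.eq_iff]
    refine or_congr_right (and_congr_right fun h => ?_)
    simp [rep_eq (comp_of_tie h)]
  let C' : Config par x :=
    { Ω := fun b => C.Ω b ×ₗ (ℕ ×ₗ ℝ)
      ord := fun b => inferInstance
      act := fun b => orderAction (a b) (fun z => by simp [a]) (fun g h z => by simp [a])
        (fun g y z h => by
          simp only [a, Prod.Lex.le_iff, ofLex_toLex] at h ⊢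
          rcases h with h | ⟨h1, h | ⟨h2, h3⟩⟩
          · exact Or.inl ((C.act b g).lt_iff_lt.2 h)
          · exact Or.inr ⟨congrArg _ h1, Or.inl h⟩
          · refine Or.inr ⟨congrArg _ h1, Or.inr ⟨h2, ?_⟩⟩
            rw [h2]
            exact (ρ b _ g).le_iff_le.2 h3)
      f := F
      lt_iff := fun p q => by
        rw [hF, hF, C.lt_iff]
        exact or_congr_right (and_congr_right (hlt p q))
      step := fun p => by
        change F (par p) (p + 1) = a (par p) (x p)⁻¹ (F (par p) p)
        simp only [F, a, ofLex_toLex, C.step, hr, hrep]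
        rw [rep_eq (comp_succ rfl)] }
  refine ⟨C', fun p q => ?_⟩
  change F false p = F false q ↔ _
  simp only [F, EmbeddingLike.apply_eq_iff_eq, Prod.mk.injEq, C.eq_iff]
  refine and_congr_right fun h => ?_
  simp [rep_eq (comp_of_tie h)]

theorem exists_rigid (par : ZMod n → Bool) (x : ZMod n → K) : ∃ C : Config par x,
    ∀ (ρ : Bool → ZMod n → K →* (ℝ ≃o ℝ)), (∀ b p q, comp par C.tie b p q → ρ b p = ρ b q) →
    ∀ r : Bool → ZMod n → ℝ, (∀ p, r (par p) (p + 1) = ρ (par p) p (x p)⁻¹ (r (par p) p)) →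
    (∀ p q, C.tie p q → (r false p < r false q ↔ r true p < r true q)) →
    ∀ p q, C.tie p q → r false p = r false q := by
  let m : Config par x → ℕ := fun C => {z : ZMod n × ZMod n | C.tie z.1 z.2}.ncard
  have hne : (Set.range m).Nonempty := ⟨_, trivial par x, rfl⟩
  obtain ⟨C, hC⟩ := Nat.sInf_mem hne
  refine ⟨C, fun ρ hρ r hr hlt p q hpq => ?_⟩
  by_contra hne'
  obtain ⟨C', hC'⟩ := C.exists_refine ρ hρ r hr hlt
  have h1 : m C' < m C := by
    refine Set.ncard_lt_ncard ⟨fun z hz => ((hC' _ _).1 hz).1, fun h => hne' ?_⟩ (Set.toFinite _)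
    exact ((hC' p q).1 (h (a := (p, q)) hpq)).2
  have h2 : sInf (Set.range m) ≤ m C' := Nat.sInf_le ⟨C', rfl⟩
  omega

end Config

section Scale

variable (ρ : K →* (ℝ ≃o ℝ))

/-- The action `ρ` rescaled by `s`; it is trivial for `s = 0`. -/
noncomputable def scale (s : ℝ) : K →* (ℝ ≃o ℝ) :=
  orderAction (fun k r => r + s * (ρ k (r / s) - r / s)) (fun r => by simp)
    (fun g h r => by
      by_cases hs : s = 0
      · simp [hs]
      · have e : ∀ (k : K) (r : ℝ), r + s * (ρ k (r / s) - r / s) = s * ρ k (r / s) := by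
          intro k r
          field_simp
          ring
        rw [e, e, e, mul_div_cancel_left₀ _ hs, map_mul]
        rfl)
    (fun g r t h => by
      by_cases hs : s = 0
      · simpa [hs] using h
      · have e : ∀ (k : K) (r : ℝ), r + s * (ρ k (r / s) - r / s) = s * ρ k (r / s) := by
          intro k r
          field_simp
          ring
        rw [e, e]
        rcases lt_or_gt_of_ne hs with h' | h'
        · exact mul_le_mul_of_nonpos_left
            ((ρ g).le_iff_le.2 (div_le_div_of_nonpos_of_le h'.le h)) h'.le
        · exact mul_le_mul_of_nonneg_left
            ((ρ g).le_iff_le.2 (div_le_div_of_nonneg_right h h'.le)) h'.le)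

theorem scale_apply (s : ℝ) (k : K) (r : ℝ) :
    scale ρ s k r = r + s * (ρ k (r / s) - r / s) := rfl

theorem scale_zero (k : K) (r : ℝ) : scale ρ 0 k r = r := by simp [scale_apply]

theorem scale_neg (s : ℝ) (k : K) (r : ℝ) : scale ρ (-s) k (-r) = -scale ρ s k r := by
  simp only [scale_apply, neg_div_neg_eq]
  ring

theorem eq_one_of_scale {s : ℝ} (hs : s ≠ 0) (h0 : ∀ k, ρ k 0 = 0 → k = 1) {k : K}
    (h : scale ρ s k 0 = 0) : k = 1 := by
  refine h0 k ?_
  simpa [scale_apply, hs] using h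

theorem continuous_scale {C : ℝ} (hC : ∀ k r, |ρ k r - r| ≤ C) (k : K) :
    Continuous fun z : ℝ × ℝ => scale ρ z.1 k z.2 := by
  simp only [scale_apply]
  refine continuous_snd.add (continuous_iff_continuousAt.2 fun z => ?_)
  by_cases hz : z.1 = 0
  · have e : z.1 * (ρ k (z.2 / z.1) - z.2 / z.1) = 0 := by rw [hz, zero_mul]
    rw [ContinuousAt, e]
    have h1 : Filter.Tendsto (fun z : ℝ × ℝ => |z.1| * C) (nhds z) (nhds 0) := by
      have : Continuous fun z : ℝ × ℝ => |z.1| * C := by fun_prop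
      simpa [hz] using this.tendsto z
    refine squeeze_zero_norm (fun y => ?_) h1
    rw [Real.norm_eq_abs, abs_mul]
    exact mul_le_mul_of_nonneg_left (hC k _) (abs_nonneg _)
  · have h1 : ContinuousAt (fun z : ℝ × ℝ => z.2 / z.1) z :=
      continuousAt_snd.div continuousAt_fst hz
    exact continuousAt_fst.mul (((ρ k).continuous.continuousAt.comp h1).sub h1)

end Scale

end OneRelator

/-! ### Dynamics around the cycle of a rigid configuration -/

namespace OneRelator

section Walk

variable {n : ℕ} [NeZero n]

/-- The walk driven by `g` around the cycle, starting from `0` at the position `p₀`. -/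
def walk (g : ZMod n → ℝ → ℝ) (p₀ : ZMod n) : ℕ → ℝ
  | 0 => 0
  | i + 1 => g (p₀ + i) (walk g p₀ i)

theorem exists_of_walk {g : ZMod n → ℝ → ℝ} {p₀ : ZMod n} (h : walk g p₀ n = 0) :
    ∃ r : ZMod n → ℝ, r p₀ = 0 ∧ (∀ p, r p = walk g p₀ (p - p₀).val) ∧
      ∀ p, r (p + 1) = g p (r p) := by
  refine ⟨fun p => walk g p₀ (p - p₀).val, by simp [walk], fun _ => rfl, fun p => ?_⟩
  have e : p₀ + (((p - p₀).val : ℕ) : ZMod n) = p := by simp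
  have h1 : walk g p₀ ((p - p₀).val + 1) = g p (walk g p₀ (p - p₀).val) := by rw [walk, e]
  rw [← h1]
  have e' : p + 1 - p₀ = (((p - p₀).val + 1 : ℕ) : ZMod n) := by
    push_cast
    rw [ZMod.natCast_zmod_val]
    ring
  rcases lt_or_eq_of_le (Nat.succ_le_of_lt (ZMod.val_lt (p - p₀))) with hlt | heq
  · change walk g p₀ (p + 1 - p₀).val = _
    rw [e', ZMod.val_natCast_of_lt hlt]
  · change walk g p₀ (p + 1 - p₀).val = _
    rw [e']
    change _ = walk g p₀ ((p - p₀).val.succ)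
    have e0 : (((p - p₀).val + 1 : ℕ) : ZMod n) = 0 := by
      rw [← ZMod.natCast_self n]
      exact congrArg _ heq
    rw [heq, h, e0, ZMod.val_zero]
    rfl

theorem sum_range_eq_sum (g : ZMod n → ℝ) : ∑ i ∈ Finset.range n, g i = ∑ p, g p := by
  refine Finset.sum_bij (fun i _ => (i : ZMod n)) (fun _ _ => Finset.mem_univ _) ?_ ?_ fun _ _ => rfl
  · intro i hi j hj hij
    have := (ZMod.natCast_eq_natCast_iff' i j n).1 hij
    rwa [Nat.mod_eq_of_lt (Finset.mem_range.1 hi), Nat.mod_eq_of_lt (Finset.mem_range.1 hj)] at this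
  · intro p _
    exact ⟨p.val, Finset.mem_range.2 (ZMod.val_lt p), by simp⟩

end Walk

variable {K : Type*} [Group K] {n : ℕ} [NeZero n]

/-- Scaling parameters and translation parameters, on both sides. -/
abbrev Params (n : ℕ) := (Bool → ZMod n → ℝ) × (Bool → ZMod n → ℝ)

section

variable (par : ZMod n → Bool) (x : ZMod n → K) (ρ : K →* (ℝ ≃o ℝ))

/-- One step of the dynamics with parameters `d`. -/
noncomputable def move (d : Params n) (p : ZMod n) (r : ℝ) : ℝ :=
  scale ρ (d.1 (par p) p) (x p)⁻¹ (r + d.2 (par p) p) - d.2 (par p) (p + 1)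

/-- The parameters are compatible with the ties. -/
def Admissible (tie : Setoid (ZMod n)) (d : Params n) : Prop :=
  (∀ b p q, comp par tie b p q → d.1 b p = d.1 b q) ∧ ∀ b p q, tie p q → d.2 b p = d.2 b q

/-- Dynamics with admissible parameters cannot separate ties. -/
def Rigid (tie : Setoid (ZMod n)) : Prop :=
  ∀ d, Admissible par tie d → ∀ r : ZMod n → ℝ, (∀ p, r (p + 1) = move par x ρ d p (r p)) →
    ∀ p q, tie p q → r p = r q

theorem exists_rigid_tie : ∃ C : Config par x, Rigid par x ρ C.tie := by
  obtain ⟨C, hC⟩ := Config.exists_rigid par x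
  refine ⟨C, fun d hd r hr p q hpq => ?_⟩
  have h := hC (fun b p => scale ρ (d.1 b p)) (fun b p q h => by rw [hd.1 b p q h])
    (fun b p => r p + d.2 b p) (fun p => by simp [hr, move]) (fun p q h => by
      simp [hd.2 _ p q h]) p q hpq
  simpa [hd.2 _ p q hpq] using h

/-- The component of `p₀` on the side `b` carries a potential. -/
def HasPotential (tie : Setoid (ZMod n)) (b : Bool) (p₀ : ZMod n) : Prop :=
  ∃ k : ZMod n → K, (∀ p q, comp par tie b p₀ p → tie p q → k p = k q) ∧
    ∀ p, comp par tie b p₀ p → par p = b → k (p + 1) = (x p)⁻¹ * k p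

open Classical in
/-- The parameters scaling by `1` on one component and trivial elsewhere. -/
noncomputable def single (tie : Setoid (ZMod n)) (b : Bool) (p : ZMod n) : Params n :=
  (fun c q => if c = b ∧ comp par tie b p q then 1 else 0, 0)

end

variable {par : ZMod n → Bool} {x : ZMod n → K} {ρ : K →* (ℝ ≃o ℝ)} {tie : Setoid (ZMod n)}
  {d d' : Params n} {b : Bool} {p₀ : ZMod n}

theorem Admissible.add (h : Admissible par tie d) (h' : Admissible par tie d') :
    Admissible par tie (d + d') :=
  ⟨fun b p q hpq => congrArg₂ (· + ·) (h.1 b p q hpq) (h'.1 b p q hpq),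
    fun b p q hpq => congrArg₂ (· + ·) (h.2 b p q hpq) (h'.2 b p q hpq)⟩

theorem Admissible.smul (h : Admissible par tie d) (t : ℝ) : Admissible par tie (t • d) :=
  ⟨fun b p q hpq => congrArg (t * ·) (h.1 b p q hpq),
    fun b p q hpq => congrArg (t * ·) (h.2 b p q hpq)⟩

open Classical in
theorem admissible_single (b : Bool) (p : ZMod n) :
    Admissible par tie (single par tie b p) := by
  refine ⟨fun c q s h => ?_, fun _ _ _ _ => rfl⟩
  by_cases hc : c = b
  · subst hc
    have : comp par tie c p q ↔ comp par tie c p s :=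
      ⟨fun h' => (comp par tie c).trans h' h,
        fun h' => (comp par tie c).trans h' ((comp par tie c).symm h)⟩
    exact if_congr (and_congr_right fun _ => this) rfl rfl
  · simp [single, hc]

theorem walk_neg (d : Params n) (p₀ : ZMod n) (i : ℕ) :
    walk (move par x ρ (-d)) p₀ i = -walk (move par x ρ d) p₀ i := by
  induction i with
  | zero => simp [walk]
  | succ i ih =>
    simp only [walk, ih, move, Prod.fst_neg, Prod.snd_neg, Pi.neg_apply, ← neg_add, scale_neg]
    ring

theorem continuous_walk {C : ℝ} (hC : ∀ k r, |ρ k r - r| ≤ C) {d : ℝ → Params n}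
    (hd : Continuous d) (p₀ : ZMod n) (i : ℕ) :
    Continuous fun t => walk (move par x ρ (d t)) p₀ i := by
  induction i with
  | zero => exact continuous_const
  | succ i ih =>
    have h1 : ∀ b p, Continuous fun t => (d t).1 b p := fun b p => by fun_prop
    have h2 : ∀ b p, Continuous fun t => (d t).2 b p := fun b p => by fun_prop
    exact ((continuous_scale ρ hC _).comp ((h1 _ _).prodMk (ih.add (h2 _ _)))).sub (h2 _ _)

theorem exists_closed {C : ℝ} (hC : ∀ k r, |ρ k r - r| ≤ C)
    (h : walk (move par x ρ d) p₀ n ≠ 0) (h' : walk (move par x ρ d') p₀ n ≠ 0) :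
    ∃ s t : ℝ, s ≠ 0 ∧ walk (move par x ρ (s • d + t • d')) p₀ n = 0 := by
  have key : ∀ d d' : Params n, walk (move par x ρ d) p₀ n < 0 → 0 < walk (move par x ρ d') p₀ n →
      ∃ s t : ℝ, s ≠ 0 ∧ t ≠ 0 ∧ walk (move par x ρ (s • d + t • d')) p₀ n = 0 := by
    intro d d' h h'
    have hc := continuous_walk (par := par) (x := x) hC
      (d := fun t : ℝ => (1 - t) • d + t • d') (by fun_prop) p₀ n
    obtain ⟨t, -, ht⟩ := intermediate_value_Icc zero_le_one hc.continuousOn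
      (show (0 : ℝ) ∈ Set.Icc _ _ by simpa using ⟨h.le, h'.le⟩)
    refine ⟨1 - t, t, ?_, ?_, ht⟩
    · intro h0
      have : t = 1 := by linarith
      subst this
      simp [h'.ne'] at ht
    · rintro rfl
      simp [h.ne] at ht
  have hneg : ∀ d : Params n, walk (move par x ρ (-d)) p₀ n = -walk (move par x ρ d) p₀ n :=
    fun d => walk_neg d p₀ n
  rcases lt_or_gt_of_ne h with h1 | h1 <;> rcases lt_or_gt_of_ne h' with h2 | h2
  · obtain ⟨s, t, hs, -, e⟩ := key d (-d') h1 (by rw [hneg]; linarith)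
    exact ⟨s, -t, hs, by rwa [neg_smul, ← smul_neg]⟩
  · obtain ⟨s, t, hs, -, e⟩ := key d d' h1 h2
    exact ⟨s, t, hs, e⟩
  · obtain ⟨s, t, -, ht, e⟩ := key d' d h2 h1
    exact ⟨t, s, ht, by rwa [add_comm]⟩
  · obtain ⟨s, t, -, ht, e⟩ := key (-d') d (by rw [hneg]; linarith) h1
    exact ⟨t, -s, ht, by rwa [neg_smul, ← smul_neg, add_comm]⟩

section Rigid

variable (hR : Rigid par x ρ tie) (h0 : ∀ k, ρ k 0 = 0 → k = 1)
include hR h0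

open Classical in
theorem Rigid.hasPotential (hd : Admissible par tie d) {r : ZMod n → ℝ}
    (hr : ∀ p, r (p + 1) = move par x ρ d p (r p)) (hs : d.1 b p₀ ≠ 0) (hc : ∀ p, d.2 b p = 0)
    {g : K} (hg : r p₀ = scale ρ (d.1 b p₀) g 0) : HasPotential par x tie b p₀ := by
  have htie := hR d hd r hr
  have hstep : ∀ p, par p = b → r (p + 1) = scale ρ (d.1 b p) (x p)⁻¹ (r p) := by
    rintro p rfl
    simp [hr, move, hc]
  let O : ZMod n → Prop := fun p => ∃ k, r p = scale ρ (d.1 b p) k 0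
  let R : Setoid (ZMod n) := ⟨fun p q => O p ↔ O q, fun _ => Iff.rfl, Iff.symm, Iff.trans⟩
  have hO : comp par tie b ≤ R := by
    refine comp_le ?_ ?_
    · intro p q h
      change O p ↔ O q
      simp only [O, htie p q h, hd.1 b p q (comp_of_tie h)]
    · intro p hp
      change O p ↔ O (p + 1)
      simp only [O, hstep p hp, ← hd.1 b p _ (comp_succ hp)]
      constructor
      · rintro ⟨k, hk⟩
        exact ⟨(x p)⁻¹ * k, by rw [hk, map_mul]; rfl⟩
      · rintro ⟨k, hk⟩
        refine ⟨x p * k, ?_⟩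
        rw [map_mul, RelIso.mul_apply, ← hk, ← RelIso.mul_apply, ← map_mul, mul_inv_cancel,
          map_one]
        rfl
  have hO' : ∀ p, comp par tie b p₀ p → O p := fun p hp => (hO hp).1 ⟨g, hg⟩
  have hs' : ∀ p, comp par tie b p₀ p → d.1 b p = d.1 b p₀ := fun p hp => (hd.1 b _ _ hp).symm
  let k : ZMod n → K := fun p => if h : O p then h.choose else 1
  have hk : ∀ p, comp par tie b p₀ p → r p = scale ρ (d.1 b p₀) (k p) 0 := by
    intro p hp
    have h := hO' p hp
    rw [← hs' p hp]
    simp only [k, dif_pos h]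
    exact h.choose_spec
  have inj : ∀ k k' : K, scale ρ (d.1 b p₀) k 0 = scale ρ (d.1 b p₀) k' 0 → k = k' := by
    intro k k' h
    have : k'⁻¹ * k = 1 := by
      refine eq_one_of_scale ρ hs h0 ?_
      rw [map_mul, RelIso.mul_apply, h, ← RelIso.mul_apply, ← map_mul, inv_mul_cancel, map_one]
      rfl
    exact (inv_mul_eq_one.1 this).symm
  refine ⟨k, fun p q hp h => inj _ _ ?_, fun p hp hpb => inj _ _ ?_⟩
  · rw [← hk p hp, ← hk q ((comp par tie b).trans hp (comp_of_tie h)), htie p q h]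
  · rw [← hk _ ((comp par tie b).trans hp (comp_succ hpb)), hstep p hpb, hs' p hp, hk p hp, map_mul]
    rfl

theorem Rigid.walk_single_ne (p : ZMod n) (h : ¬ HasPotential par x tie b p) :
    walk (move par x ρ (single par tie b p)) p₀ n ≠ 0 := by
  intro hw
  obtain ⟨r, -, hrw, hr⟩ := exists_of_walk hw
  have horb : ∀ i, ∃ k, walk (move par x ρ (single par tie b p)) p₀ i = scale ρ 1 k 0 := by
    intro i
    induction i with
    | zero => exact ⟨1, by rw [map_one]; rfl⟩
    | succ i ih =>
      obtain ⟨k, hk⟩ := ih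
      rw [walk, hk, move]
      simp only [single, Pi.zero_apply, add_zero, sub_zero]
      split_ifs
      · exact ⟨(x (p₀ + i))⁻¹ * k, by rw [map_mul]; rfl⟩
      · exact ⟨k, scale_zero _ _ _⟩
  obtain ⟨g, hg⟩ := horb (p - p₀).val
  have hs : (single par tie b p).1 b p = 1 := if_pos ⟨rfl, (comp par tie b).refl p⟩
  refine h (hR.hasPotential h0 (admissible_single b p) hr (by rw [hs]; exact one_ne_zero)
    (fun _ => rfl) (g := g) ?_)
  rw [hs, hrw, hg]

theorem Rigid.walk_eq_zero {C : ℝ} (hC : ∀ k r, |ρ k r - r| ≤ C) (hd : Admissible par tie d)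
    (h : ¬ HasPotential par x tie b p₀) (hs : d.1 b p₀ = 0) (hc : ∀ p, d.2 b p = 0) :
    walk (move par x ρ d) p₀ n = 0 := by
  by_contra hw
  obtain ⟨s, t, hs', hw'⟩ := exists_closed hC (hR.walk_single_ne h0 p₀ h) hw
  obtain ⟨r, hr0, -, hr⟩ := exists_of_walk hw'
  have hs1 : (single par tie b p₀).1 b p₀ = 1 := if_pos ⟨rfl, (comp par tie b).refl p₀⟩
  refine h (hR.hasPotential h0 (((admissible_single b p₀).smul s).add (hd.smul t)) hr (g := 1)
    ?_ ?_ ?_)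
  · simpa [hs, hs1] using hs'
  · intro p
    simp [hc, single]
  · rw [hr0, map_one]
    rfl

theorem Rigid.eq_of_not_hasPotential {C : ℝ} (hC : ∀ k r, |ρ k r - r| ≤ C) {c : Bool}
    {p q : ZMod n} (h : ¬ HasPotential par x tie b p) (h' : ¬ HasPotential par x tie c q) :
    b = c ∧ comp par tie c q p := by
  by_contra hne
  refine hR.walk_single_ne h0 (p₀ := p) q h' (hR.walk_eq_zero h0 hC (admissible_single c q) h
    (if_neg hne) fun _ => rfl)

theorem Rigid.exists_translation {C : ℝ} (hC : ∀ k r, |ρ k r - r| ≤ C)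
    (h : ¬ HasPotential par x tie b p₀) {c : ZMod n → ℝ} (hc : ∀ p q, tie p q → c p = c q) :
    ∃ r : ZMod n → ℝ, ∀ p, r (p + 1) = if par p then r p + c p - c (p + 1) else r p := by
  cases b with
  | false =>
    let d : Params n := (0, fun b p => if b then c p else 0)
    have hw := hR.walk_eq_zero h0 hC (d := d)
      ⟨fun _ _ _ _ => rfl, fun b p q h => by simp [d, hc p q h]⟩ h rfl (fun _ => by simp [d])
    obtain ⟨r, -, -, hr⟩ := exists_of_walk hw
    refine ⟨r, fun p => ?_⟩
    rw [hr, move]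
    cases par p <;> simp [d, scale_zero, -map_inv]
  | true =>
    let d : Params n := (0, fun b p => if b then 0 else -c p)
    have hw := hR.walk_eq_zero h0 hC (d := d)
      ⟨fun _ _ _ _ => rfl, fun b p q h => by simp [d, hc p q h]⟩ h rfl (fun _ => by simp [d])
    obtain ⟨r, -, -, hr⟩ := exists_of_walk hw
    refine ⟨fun p => r p - c p, fun p => ?_⟩
    simp only [hr, move]
    cases par p <;> simp [d, scale_zero, -map_inv, sub_eq_add_neg]

omit h0 in
theorem Rigid.exists_coboundary {c r : ZMod n → ℝ} (hc : ∀ p q, tie p q → c p = c q)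
    (hr : ∀ p, r (p + 1) = if par p then r p + c p - c (p + 1) else r p) :
    (∀ p q, comp par tie false p q → r p = r q) ∧
      ∀ p q, comp par tie true p q → r p + c p = r q + c q := by
  let d : Params n := (0, fun b p => if b then c p else 0)
  have htie := hR d ⟨fun _ _ _ _ => rfl, fun b p q h => by simp [d, hc p q h]⟩ r fun p => by
    rw [hr, move]
    cases par p <;> simp [d, scale_zero, -map_inv]
  constructor
  · refine fun p q h => comp_le (r := Setoid.ker r) (fun p q h => htie p q h) (fun p hp => ?_) h
    change r p = r (p + 1)
    simp [hr, hp]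
  · refine fun p q h => comp_le (r := Setoid.ker fun p => r p + c p) (fun p q h => ?_)
      (fun p hp => ?_) h
    · change r p + c p = r q + c q
      rw [htie p q h, hc p q h]
    · change r p + c p = r (p + 1) + c (p + 1)
      simp [hr, hp]

end Rigid

end OneRelator

/-! ### Counting components: ties of a rigid configuration are periods -/

namespace OneRelator

section Count

variable {n : ℕ} [NeZero n]

theorem exists_succ_eq_add {g : ZMod n → ℝ} (h : ∑ p, g p = 0) :
    ∃ r : ZMod n → ℝ, ∀ p, r (p + 1) = r p + g p := by
  have hw : ∀ i, walk (fun p r => r + g p) 0 i = ∑ j ∈ Finset.range i, g j := by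
    intro i
    induction i with
    | zero => simp [walk]
    | succ i ih => rw [walk, ih, Finset.sum_range_succ, zero_add]
  obtain ⟨r, -, -, hr⟩ := exists_of_walk ((hw n).trans ((sum_range_eq_sum g).trans h))
  exact ⟨r, hr⟩

variable (par : ZMod n → Bool) (tie : Setoid (ZMod n))

/-- The component of a tie class. -/
def toComp (b : Bool) : Quotient tie → Quotient (comp par tie b) :=
  Quotient.lift (fun p => Quotient.mk _ p) fun _ _ h => Quotient.sound (comp_of_tie h)

/-- The coboundary from functions on components to functions on tie classes. -/
def coboundary : (Quotient (comp par tie false) → ℝ) × (Quotient (comp par tie true) → ℝ) →ₗ[ℝ]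
    (Quotient tie → ℝ) :=
  LinearMap.funLeft ℝ ℝ (toComp par tie true) ∘ₗ LinearMap.snd ℝ _ _ -
    LinearMap.funLeft ℝ ℝ (toComp par tie false) ∘ₗ LinearMap.fst ℝ _ _

/-- The total increment around the cycle. -/
noncomputable def total : (Quotient tie → ℝ) →ₗ[ℝ] ℝ :=
  ∑ p : ZMod n, if par p then LinearMap.proj (R := ℝ) (φ := fun _ => ℝ) (Quotient.mk tie p) -
    LinearMap.proj (R := ℝ) (φ := fun _ => ℝ) (Quotient.mk tie (p + 1)) else 0

theorem total_apply (c : Quotient tie → ℝ) : total par tie c =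
    ∑ p : ZMod n, if par p then c (Quotient.mk tie p) - c (Quotient.mk tie (p + 1)) else 0 := by
  simp only [total, LinearMap.sum_apply]
  refine Finset.sum_congr rfl fun p _ => ?_
  split_ifs <;> rfl

theorem finrank_range_coboundary_lt : Module.finrank ℝ (LinearMap.range (coboundary par tie)) + 1 ≤
    Nat.card (Quotient (comp par tie false)) + Nat.card (Quotient (comp par tie true)) := by
  classical
  have := Fintype.ofFinite (Quotient (comp par tie false))
  have := Fintype.ofFinite (Quotient (comp par tie true))
  have h := LinearMap.finrank_range_add_finrank_ker (coboundary par tie)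
  rw [Module.finrank_prod, Module.finrank_fintype_fun_eq_card,
    Module.finrank_fintype_fun_eq_card, ← Nat.card_eq_fintype_card,
    ← Nat.card_eq_fintype_card] at h
  have hker : 0 < Module.finrank ℝ (LinearMap.ker (coboundary par tie)) := by
    rw [Module.finrank_pos_iff_exists_ne_zero]
    refine ⟨⟨(1, 1), LinearMap.mem_ker.2 ?_⟩, fun h => ?_⟩
    · ext q
      simp [coboundary, LinearMap.funLeft_apply]
    · have := congrFun (congrArg (fun z => z.1.1) h) (Quotient.mk _ 0)
      simp at this
  omega

end Count

variable {K : Type*} [Group K] {n : ℕ} [NeZero n]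
  {par : ZMod n → Bool} {x : ZMod n → K} {ρ : K →* (ℝ ≃o ℝ)} {tie : Setoid (ZMod n)}
  {b : Bool} {p₀ p q : ZMod n}

theorem Rigid.ker_total_le (hR : Rigid par x ρ tie) :
    LinearMap.ker (total par tie) ≤ LinearMap.range (coboundary par tie) := by
  intro c hc
  rw [LinearMap.mem_ker, total_apply] at hc
  obtain ⟨r, hr⟩ := exists_succ_eq_add hc
  obtain ⟨h1, h2⟩ := hR.exists_coboundary (c := fun p => c (Quotient.mk tie p)) (r := r)
    (fun p q h => congrArg c (Quotient.sound h)) fun p => by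
      rw [hr]
      split_ifs <;> ring
  refine ⟨(Quotient.lift r h1, Quotient.lift _ h2), ?_⟩
  ext q
  induction q using Quotient.inductionOn
  simp [coboundary, LinearMap.funLeft_apply, toComp]

theorem Rigid.card_le (hR : Rigid par x ρ tie) : Nat.card (Quotient tie) ≤
    Nat.card (Quotient (comp par tie false)) + Nat.card (Quotient (comp par tie true)) := by
  classical
  have := Fintype.ofFinite (Quotient tie)
  have h1 := LinearMap.finrank_range_add_finrank_ker (total par tie)
  rw [Module.finrank_fintype_fun_eq_card, ← Nat.card_eq_fintype_card] at h1
  have h2 := Submodule.finrank_mono hR.ker_total_le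
  have h3 := Submodule.finrank_le (LinearMap.range (total par tie))
  rw [Module.finrank_self] at h3
  have h4 := finrank_range_coboundary_lt par tie
  omega

theorem Rigid.card_lt (hR : Rigid par x ρ tie) (h0 : ∀ k, ρ k 0 = 0 → k = 1) {C : ℝ}
    (hC : ∀ k r, |ρ k r - r| ≤ C) (h : ¬ HasPotential par x tie b p₀) :
    Nat.card (Quotient tie) <
      Nat.card (Quotient (comp par tie false)) + Nat.card (Quotient (comp par tie true)) := by
  classical
  have := Fintype.ofFinite (Quotient tie)
  have hz : total par tie = 0 := by
    refine LinearMap.ext fun c => ?_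
    obtain ⟨r, hr⟩ := hR.exists_translation h0 hC h (c := fun p => c (Quotient.mk tie p))
      fun p q h => congrArg c (Quotient.sound h)
    have e : ∀ p, (if par p then c (Quotient.mk tie p) - c (Quotient.mk tie (p + 1)) else 0) =
        r (p + 1) - r p := by
      intro p
      rw [hr]
      split_ifs <;> ring
    rw [total_apply, Finset.sum_congr rfl fun p _ => e p, Finset.sum_sub_distrib]
    exact sub_eq_zero.2 (Equiv.sum_comp (Equiv.addRight (1 : ZMod n)) r)
  have h1 := LinearMap.finrank_range_add_finrank_ker (total par tie)
  rw [Module.finrank_fintype_fun_eq_card, ← Nat.card_eq_fintype_card] at h1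
  have h2 := Submodule.finrank_mono hR.ker_total_le
  have h3 : Module.finrank ℝ (LinearMap.range (total par tie)) = 0 := by
    rw [hz, LinearMap.range_zero, finrank_bot]
  have h4 := finrank_range_coboundary_lt par tie
  omega

section Fiber

variable (hpar : ∀ p, par (p + 1) = !par p) (hx : ∀ p, x p ≠ 1)
include hpar hx

omit hpar in
theorem HasPotential.not_tie (h : HasPotential par x tie b p₀) (hp : comp par tie b p₀ p)
    (hb : par p = b) : ¬ tie p (p + 1) := by
  obtain ⟨k, h1, h2⟩ := h
  intro ht
  have e := h2 p hp hb
  rw [← h1 p _ hp ht] at e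
  exact hx p (inv_eq_one.1 (right_eq_mul.1 e))

open Classical in
theorem HasPotential.one_lt_card [Fintype (Quotient tie)] (h : HasPotential par x tie b p) :
    1 < (Finset.univ.filter fun z => toComp par tie b z = Quotient.mk _ p).card := by
  obtain ⟨q, hq, hb⟩ : ∃ q, comp par tie b p q ∧ par q = b := by
    by_cases hb : par p = b
    · exact ⟨p, (comp par tie b).refl p, hb⟩
    · have e : par (p - 1) = b := by
        have := hpar (p - 1)
        rw [sub_add_cancel] at this
        rw [this] at hb
        cases h : par (p - 1) <;> cases b <;> simp_all
      refine ⟨p - 1, ?_, e⟩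
      have := comp_succ (tie := tie) e
      rw [sub_add_cancel] at this
      exact (comp par tie b).symm this
  have hs := comp_succ (tie := tie) hb
  refine Finset.one_lt_card.2 ⟨Quotient.mk _ q, ?_, Quotient.mk _ (q + 1), ?_, fun e =>
    h.not_tie hx hq hb (Quotient.exact e)⟩
  · exact Finset.mem_filter.2 ⟨Finset.mem_univ _, Quotient.sound ((comp par tie b).symm hq)⟩
  · exact Finset.mem_filter.2 ⟨Finset.mem_univ _,
      Quotient.sound ((comp par tie b).symm ((comp par tie b).trans hq hs))⟩

theorem two_mul_card_le (T : Finset (Quotient (comp par tie b)))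
    (hT : ∀ p, ¬ HasPotential par x tie b p → Quotient.mk _ p ∈ T) :
    2 * Nat.card (Quotient (comp par tie b)) ≤ Nat.card (Quotient tie) + T.card := by
  classical
  have := Fintype.ofFinite (Quotient tie)
  have := Fintype.ofFinite (Quotient (comp par tie b))
  have h1 := Finset.card_eq_sum_card_fiberwise (f := toComp par tie b) (s := Finset.univ)
    (t := Finset.univ) fun _ _ => Finset.mem_coe.2 (Finset.mem_univ _)
  have h2 : T.card = ∑ v : Quotient (comp par tie b), if v ∈ T then 1 else 0 := by simp
  rw [Nat.card_eq_fintype_card, Nat.card_eq_fintype_card, ← Finset.card_univ (α := Quotient tie),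
    h1, h2, ← Finset.sum_add_distrib, mul_comm, ← smul_eq_mul, ← Finset.card_univ,
    ← Finset.sum_const]
  refine Finset.sum_le_sum fun v _ => ?_
  induction v using Quotient.inductionOn with
  | h p =>
    by_cases hp : HasPotential par x tie b p
    · have := hp.one_lt_card hpar hx
      omega
    · rw [if_pos (hT p hp)]
      have : 0 < (Finset.univ.filter fun z => toComp par tie b z = Quotient.mk _ p).card :=
        Finset.card_pos.2 ⟨Quotient.mk _ p, Finset.mem_filter.2 ⟨Finset.mem_univ _, rfl⟩⟩
      omega

theorem Rigid.hasPotential_all (hR : Rigid par x ρ tie) (h0 : ∀ k, ρ k 0 = 0 → k = 1) {C : ℝ}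
    (hC : ∀ k r, |ρ k r - r| ≤ C) (b : Bool) (p : ZMod n) : HasPotential par x tie b p := by
  classical
  by_contra h
  have h1 := hR.card_lt h0 hC h
  have h2 := two_mul_card_le (b := b) hpar hx {Quotient.mk _ p} fun q hq =>
    Finset.mem_singleton.2 (Quotient.sound (hR.eq_of_not_hasPotential h0 hC h hq).2)
  have h3 := two_mul_card_le (b := !b) hpar hx ∅ fun q hq => by
    have := (hR.eq_of_not_hasPotential h0 hC h hq).1
    cases b <;> cases this
  rw [Finset.card_singleton] at h2
  rw [Finset.card_empty] at h3
  cases b <;> simp only [Bool.not_false, Bool.not_true] at h3 <;> omega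

theorem Rigid.tie_of_comp (hR : Rigid par x ρ tie) (h0 : ∀ k, ρ k 0 = 0 → k = 1) {C : ℝ}
    (hC : ∀ k r, |ρ k r - r| ≤ C) {s : ZMod n} (hq : comp par tie b p q)
    (hs : comp par tie b p s) : tie p q ∨ tie p s ∨ tie q s := by
  classical
  have := Fintype.ofFinite (Quotient tie)
  have := Fintype.ofFinite (Quotient (comp par tie b))
  have hpot := hR.hasPotential_all hpar hx h0 hC
  have hE : Nat.card (Quotient tie) = 2 * Nat.card (Quotient (comp par tie b)) := by
    have h1 := hR.card_le
    have h2 := two_mul_card_le (b := false) hpar hx ∅ fun q hq => absurd (hpot _ _) hq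
    have h3 := two_mul_card_le (b := true) hpar hx ∅ fun q hq => absurd (hpot _ _) hq
    rw [Finset.card_empty] at h2 h3
    cases b <;> omega
  have h1 := Finset.card_eq_sum_card_fiberwise (f := toComp par tie b) (s := Finset.univ)
    (t := Finset.univ) fun _ _ => Finset.mem_coe.2 (Finset.mem_univ _)
  rw [Nat.card_eq_fintype_card, Nat.card_eq_fintype_card, ← Finset.card_univ (α := Quotient tie),
    h1, mul_comm, ← smul_eq_mul, ← Finset.card_univ, ← Finset.sum_const] at hE
  have h2 := (Finset.sum_eq_sum_iff_of_le fun v _ => by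
    induction v using Quotient.inductionOn with
    | h p => exact (hpot b p).one_lt_card hpar hx).1 hE.symm (Quotient.mk _ p) (Finset.mem_univ _)
  by_contra! hne
  have h3 : 2 < (Finset.univ.filter fun z => toComp par tie b z = Quotient.mk _ p).card :=
    Finset.two_lt_card.2 ⟨Quotient.mk tie p, Finset.mem_filter.2 ⟨Finset.mem_univ _, rfl⟩,
    Quotient.mk tie q, Finset.mem_filter.2 ⟨Finset.mem_univ _,
      Quotient.sound ((comp par tie b).symm hq)⟩,
    Quotient.mk tie s, Finset.mem_filter.2 ⟨Finset.mem_univ _,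
      Quotient.sound ((comp par tie b).symm hs)⟩,
    fun e => hne.1 (Quotient.exact e), fun e => hne.2.1 (Quotient.exact e),
    fun e => hne.2.2 (Quotient.exact e)⟩
  exact absurd h3 (by rw [← h2]; exact lt_irrefl 2)

theorem Rigid.eq_of_tie (hR : Rigid par x ρ tie) (h0 : ∀ k, ρ k 0 = 0 → k = 1) {C : ℝ}
    (hC : ∀ k r, |ρ k r - r| ≤ C) (h : tie p q) :
    par p = par q ∧ ∀ j, x (p + j) = x (q + j) := by
  have hpot := hR.hasPotential_all hpar hx h0 hC
  have hnt : ∀ p, ¬ tie p (p + 1) := fun p =>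
    (hpot (par p) p).not_tie hx ((comp par tie _).refl p) rfl
  have hfib := fun {b p q s} => hR.tie_of_comp (b := b) (p := p) (q := q) (s := s) hpar hx h0 hC
  have same : ∀ p q, par p = par q → tie p q → x p = x q ∧ tie (p + 1) (q + 1) := by
    intro p q hb ht
    have c1 : comp par tie (par p) p (p + 1) := comp_succ rfl
    have c2 : comp par tie (par p) p q := comp_of_tie ht
    have c3 := comp_succ (tie := tie) hb.symm
    have ht' : tie (p + 1) (q + 1) := by
      rcases hfib c1 ((comp par tie _).trans c2 c3) with h | h | h
      · exact absurd h (hnt p)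
      · exact absurd (tie.trans (tie.symm ht) h) (hnt q)
      · exact h
    refine ⟨?_, ht'⟩
    obtain ⟨k, h1, h2⟩ := hpot (par p) p
    have e1 := h2 p ((comp par tie _).refl p) rfl
    have e2 := h2 q c2 hb.symm
    rw [← h1 _ _ c1 ht', e1, ← h1 _ _ ((comp par tie _).refl p) ht] at e2
    exact inv_injective (mul_right_cancel e2)
  have opp : ∀ p q, par p = par q → tie p (q + 1) → tie (p + 1) q := by
    intro p q hb ht
    have c1 : comp par tie (par p) p (p + 1) := comp_succ rfl
    have c2 : comp par tie (par p) p (q + 1) := comp_of_tie ht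
    have c3 := comp_succ (tie := tie) hb.symm
    rcases hfib c1 ((comp par tie _).trans c2 ((comp par tie _).symm c3)) with h | h | h
    · exact absurd h (hnt p)
    · exact absurd (tie.trans (tie.symm h) ht) (hnt q)
    · exact h
  have heven : ∀ (m : ℕ) p, par (p + (m + m : ℕ)) = par p := by
    intro m p
    induction m with
    | zero => simp
    | succ m ih =>
      have e : p + ((m + 1 + (m + 1) : ℕ) : ZMod n) = p + (m + m : ℕ) + 1 + 1 := by
        push_cast
        ring
      rw [e, hpar, hpar, Bool.not_not, ih]
  have hq : q = p + ((q - p).val : ℕ) := by simp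
  have hpq : par p = par q := by
    rcases Nat.even_or_odd' (q - p).val with ⟨m, hm | hm⟩
    · rw [hm, two_mul] at hq
      rw [hq, heven]
    · exfalso
      have key : ∀ i j : ℕ, i + j = m → tie (p + i) (p + i + (j + j : ℕ) + 1) := by
        intro i
        induction i with
        | zero =>
          rintro j hj
          rw [hq, hm, ← hj] at h
          convert h using 1 <;>
          · push_cast
            ring
        | succ i ih =>
          intro j hj
          convert opp _ _ (heven (j + 1) (p + i)).symm (ih (j + 1) (by omega)) using 1 <;>
          · push_cast
            ring
      refine hnt (p + m) ?_
      have := key m 0 rfl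
      simpa using this
  refine ⟨hpq, fun j => ?_⟩
  have key : ∀ i : ℕ, par (p + i) = par (q + i) ∧ tie (p + i) (q + i) := by
    intro i
    induction i with
    | zero => simpa using ⟨hpq, h⟩
    | succ i ih =>
      push_cast
      rw [← add_assoc, ← add_assoc, hpar, hpar, ih.1]
      exact ⟨rfl, (same _ _ ih.1 ih.2).2⟩
  have := (same _ _ (key j.val).1 (key j.val).2).1
  simpa using this

end Fiber

end OneRelator

/-! ### Free products of left-orderable groups -/

namespace OneRelator

theorem isLeftOrderable_prod {A B : Type*} [Group A] [Group B] (hA : IsLeftOrderable A)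
    (hB : IsLeftOrderable B) : IsLeftOrderable (A × B) := by
  classical
  obtain ⟨r, _, hr⟩ := hA
  obtain ⟨s, _, hs⟩ := hB
  let _ := linearOrderOfSTO r
  let _ := linearOrderOfSTO s
  refine ⟨fun p q => toLex p < toLex q,
    inferInstanceAs (IsStrictTotalOrder (A ×ₗ B) (· < ·)), fun f g h hfg => ?_⟩
  simp only [Prod.Lex.toLex_lt_toLex] at hfg ⊢
  rcases hfg with hfg | ⟨h1, h2⟩
  · exact Or.inl (hr _ _ _ hfg)
  · exact Or.inr ⟨congrArg (h.1 * ·) h1, hs _ _ _ h2⟩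

theorem CyclicWord.par_add_eq {G : Type*} [Group G] (w : CyclicWord G) {p q : ZMod w.n}
    (h : w.par p = w.par q) (j : ZMod w.n) : w.par (p + j) = w.par (q + j) := by
  have : ∀ i : ℕ, w.par (p + i) = w.par (q + i) := by
    intro i
    induction i with
    | zero => simpa using h
    | succ i ih =>
      push_cast
      rw [← add_assoc, ← add_assoc, w.par_succ, w.par_succ, ih]
  simpa using this j.val

theorem CyclicWord.eq_one_of_mem {G K : Type*} [Group G] [Group K] (w : CyclicWord G)
    (htop : w.P false ⊔ w.P true = ⊤) (hK : IsLeftOrderable K) (π : G →* K)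
    (hinj : ∀ b, ∀ a ∈ w.P b, π a = 1 → a = 1) (hx : ∀ p, w.x p ≠ 1) {b : Bool} {a : G}
    (ha : a ∈ w.P b) (h : a ∈ Subgroup.normalClosure {w.word}) : a = 1 := by
  classical
  obtain ⟨r, _, hr⟩ := hK
  let _ := linearOrderOfSTO r
  let lift := FreeGroup.lift fun p => π (w.x p)
  let K₀ := lift.range
  have hmem : ∀ p, π (w.x p) ∈ K₀ := fun p => ⟨FreeGroup.of p, FreeGroup.lift_apply_of⟩
  have : Countable K₀ := by
    have : Countable (FreeGroup (ZMod w.n)) :=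
      (Quot.mk_surjective (r := @FreeGroup.Red.Step (ZMod w.n))).countable
    exact lift.rangeRestrict_surjective.countable
  obtain ⟨ρ, C, h0, hC⟩ := exists_action_real K₀ fun g a b hab => hr _ _ (g : K) hab
  let x : ZMod w.n → K₀ := fun p => ⟨π (w.x p), hmem p⟩
  obtain ⟨F, hF⟩ := exists_rigid_tie w.par x ρ
  have hx' : ∀ p, x p ≠ 1 := fun p e => hx p (hinj _ _ (w.mem p) (congrArg Subtype.val e))
  let F' : Heights w F.Ω :=
    { H := K₀.comap π
      mem := hmem
      act := fun b => (F.act b).comp (π.subgroupComap K₀)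
      f := F.f
      lt_iff := F.lt_iff
      step := fun p => by
        change F.f _ _ = (F.act (w.par p) (x p))⁻¹ _
        rw [← map_inv]
        exact F.step p
      eq_of_tie := fun p q hpq => by
        obtain ⟨h1, h2⟩ := hF.eq_of_tie w.par_succ hx' h0 hC (p := p) (q := q) hpq
        refine ⟨h1, fun j => ?_⟩
        have e : π (w.x (p + j)) = π (w.x (q + j)) := congrArg Subtype.val (h2 j)
        have hm := w.mem (q + j)
        rw [← w.par_add_eq h1] at hm
        refine mul_inv_eq_one.1 (hinj _ _ ((w.P _).mul_mem (w.mem _) ((w.P _).inv_mem hm)) ?_)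
        rw [map_mul, map_inv, e, mul_inv_cancel] }
  exact F'.eq_one htop ha h

section Coprod

open Monoid

variable {A B : Type*} [Group A] [Group B]

/-- The two factors of a free product. -/
def factor (A B : Type*) [Group A] [Group B] (b : Bool) : Subgroup (Coprod A B) :=
  cond b Coprod.inr.range Coprod.inl.range

/-- A word with letters in the two factors. -/
def Typed (l : List (Bool × Coprod A B)) : Prop := ∀ e ∈ l, e.2 ∈ factor A B e.1

theorem exists_typed (g : Coprod A B) : ∃ l, Typed l ∧ (l.map Prod.snd).prod = g := by
  induction g using Coprod.induction_on with
  | inl a => exact ⟨[(false, Coprod.inl a)], by simp [Typed, factor], by simp⟩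
  | inr a => exact ⟨[(true, Coprod.inr a)], by simp [Typed, factor], by simp⟩
  | mul g h hg hh =>
    obtain ⟨l, hl, rfl⟩ := hg
    obtain ⟨l', hl', rfl⟩ := hh
    refine ⟨l ++ l', fun e he => ?_, by simp⟩
    rcases List.mem_append.1 he with he | he
    · exact hl e he
    · exact hl' e he

theorem exists_eq_one_of_prod_eq_one {l : List (Bool × Coprod A B)} (hl : l ≠ []) (ht : Typed l)
    (hc : l.IsChain fun e e' => e.1 ≠ e'.1) (h : (l.map Prod.snd).prod = 1) :
    ∃ e ∈ l, e.2 = 1 := by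
  let θ : Coprod A B →* CoprodI fun b => factor A B b := Coprod.lift
    ((CoprodI.of (M := fun b => factor A B b) (i := false)).comp
      (MonoidHom.rangeRestrict (Coprod.inl : A →* Coprod A B)))
    ((CoprodI.of (M := fun b => factor A B b) (i := true)).comp
      (MonoidHom.rangeRestrict (Coprod.inr : B →* Coprod A B)))
  have hθ : ∀ s : Σ b, factor A B b, θ s.2 =
      CoprodI.of (M := fun b => factor A B b) (i := s.1) s.2 := by
    rintro ⟨b, a, ha⟩
    cases b with
    | false =>
      obtain ⟨a, rfl⟩ := ha
      exact Coprod.lift_apply_inl _ _ _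
    | true =>
      obtain ⟨a, rfl⟩ := ha
      exact Coprod.lift_apply_inr _ _ _
  rw [Typed] at ht
  obtain ⟨m, rfl⟩ : ∃ m : List (Σ b, factor A B b),
      m.map (fun s => (s.1, (s.2 : Coprod A B))) = l := by
    refine ⟨l.pmap (fun e he => ⟨e.1, e.2, he⟩) ht, ?_⟩
    rw [List.map_pmap]
    simp
  by_contra! hne
  let W : CoprodI.Word fun b => factor A B b :=
    { toList := m
      ne_one := fun s hs e => hne _ (List.mem_map_of_mem hs) (congrArg Subtype.val e)
      chain_ne := (List.isChain_map (R := fun e e' : Bool × Coprod A B => e.1 ≠ e'.1) _).1 hc }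
  have hW : W.prod = (CoprodI.Word.empty : CoprodI.Word fun b => factor A B b).prod := by
    have e := congrArg θ h
    rw [map_one, map_list_prod, List.map_map, List.map_map] at e
    rw [CoprodI.Word.prod_empty, ← e, CoprodI.Word.prod]
    congr 1
    exact List.map_congr_left fun s _ => (hθ s).symm
  classical
  have := congrArg CoprodI.Word.toList (CoprodI.Word.equiv.symm.injective (a₁ := W)
    (a₂ := CoprodI.Word.empty) hW)
  exact hl (by rw [show m = [] from this]; rfl)

theorem isConj_prod_rotate {G : Type*} [Group G] (l : List G) (i : ℕ) :
    IsConj (l.rotate i).prod l.prod := by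
  rw [List.rotate_eq_drop_append_take_mod]
  refine isConj_iff.2 ⟨(l.take (i % l.length)).prod, ?_⟩
  conv_rhs => rw [← List.take_append_drop (i % l.length) l]
  rw [List.prod_append, List.prod_append]
  group

/-- A typed word none of whose rotations is shorter after the obvious reductions. -/
theorem exists_minimal (g : Coprod A B) : ∃ l : List (Bool × Coprod A B), Typed l ∧
    IsConj (l.map Prod.snd).prod g ∧ ∀ i e e' t, l.rotate i = e :: e' :: t →
      e.2 ≠ 1 ∧ e.1 ≠ e'.1 := by
  let s : Set ℕ := {k | ∃ l : List (Bool × Coprod A B), Typed l ∧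
    IsConj (l.map Prod.snd).prod g ∧ l.length = k}
  obtain ⟨l, hl, hg, hk⟩ : sInf s ∈ s := Nat.sInf_mem (by
    obtain ⟨l, hl, rfl⟩ := exists_typed g
    exact ⟨_, l, hl, IsConj.refl _, rfl⟩)
  refine ⟨l, hl, hg, fun i e e' t h => ?_⟩
  have hmin : ∀ l', Typed l' → (l'.map Prod.snd).prod = ((e :: e' :: t).map Prod.snd).prod →
      l.length ≤ l'.length := by
    intro l' h1 h2
    rw [hk]
    refine Nat.sInf_le ⟨l', h1, ?_, rfl⟩
    rw [h2, ← h, List.map_rotate]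
    exact (isConj_prod_rotate _ i).trans hg
  have hlen : l.length = t.length + 2 := by
    rw [← List.length_rotate l i, h]
    rfl
  have ht : Typed (e :: e' :: t) := fun z hz => hl z (List.mem_rotate.1 (h ▸ hz))
  constructor
  · intro he
    have := hmin (e' :: t) (fun z hz => ht z (List.mem_cons_of_mem _ hz)) (by simp [he])
    simp only [List.length_cons] at this
    omega
  · intro he
    have := hmin ((e.1, e.2 * e'.2) :: t) (fun z hz => ?_) (by simp [mul_assoc])
    · simp only [List.length_cons] at this
      omega
    · rcases List.mem_cons.1 hz with rfl | hz
      · refine (factor A B _).mul_mem (ht e (by simp)) ?_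
        have := ht e' (by simp)
        rwa [← he] at this
      · exact ht z (by simp [hz])

theorem normalClosure_eq_of_isConj {G : Type*} [Group G] {g h : G} (e : IsConj g h) :
    Subgroup.normalClosure {g} = Subgroup.normalClosure {h} := by
  have key : ∀ {g h : G}, IsConj g h →
      Subgroup.normalClosure {g} ≤ Subgroup.normalClosure {h} := by
    intro g h e
    obtain ⟨c, hc⟩ := isConj_iff.1 e.symm
    refine Subgroup.normalClosure_le_normal (Set.singleton_subset_iff.2 ?_)
    rw [SetLike.mem_coe, ← hc]
    exact (Subgroup.normalClosure_normal (s := {h})).conj_mem h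
      (Subgroup.subset_normalClosure (Set.mem_singleton h)) c
  exact le_antisymm (key e) (key e.symm)

theorem normalClosure_ne_top_of_hom {G H : Type*} [Group G] [Group H] [Nontrivial H] {f : G →* H}
    (hf : Function.Surjective f) {g : G} (hg : f g = 1) : Subgroup.normalClosure {g} ≠ ⊤ := by
  intro h
  obtain ⟨a, ha⟩ := exists_ne (1 : H)
  obtain ⟨z, rfl⟩ := hf a
  have : Subgroup.normalClosure {g} ≤ f.ker :=
    Subgroup.normalClosure_le_normal (Set.singleton_subset_iff.2 hg)
  rw [h] at this
  exact ha (this (Subgroup.mem_top z))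

theorem eq_one_of_mem_factor {b : Bool} {a : Coprod A B} (ha : a ∈ factor A B b)
    (h : Coprod.toProd a = 1) : a = 1 := by
  cases b with
  | false =>
    obtain ⟨a, rfl⟩ := ha
    rw [Coprod.toProd_apply_inl] at h
    rw [show a = 1 from congrArg Prod.fst h, map_one]
  | true =>
    obtain ⟨a, rfl⟩ := ha
    rw [Coprod.toProd_apply_inr] at h
    rw [show a = 1 from congrArg Prod.snd h, map_one]

theorem normalClosure_ne_top [Nontrivial A] [Nontrivial B] (hA : IsLeftOrderable A)
    (hB : IsLeftOrderable B) (g : Coprod A B) : Subgroup.normalClosure {g} ≠ ⊤ := by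
  obtain ⟨l, hl, hg, hmin⟩ := exists_minimal g
  rw [← normalClosure_eq_of_isConj hg]
  rcases l with - | ⟨e, - | ⟨e', t⟩⟩
  · exact normalClosure_ne_top_of_hom Coprod.fst_surjective (by simp)
  · have he := hl e (by simp)
    rcases e with ⟨b, a⟩
    cases b with
    | false =>
      obtain ⟨a, rfl⟩ := he
      exact normalClosure_ne_top_of_hom Coprod.snd_surjective (by simp)
    | true =>
      obtain ⟨a, rfl⟩ := he
      exact normalClosure_ne_top_of_hom Coprod.fst_surjective (by simp)
  · generalize hm : e :: e' :: t = m at *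
    have h2 : 2 ≤ m.length := by
      rw [← hm]
      simp
    have : NeZero m.length := ⟨by omega⟩
    have hlt : ∀ p : ZMod m.length, p.val < m.length := ZMod.val_lt
    have hrot : ∀ p : ZMod m.length, ∃ t, m.rotate p.val = m[p.val]'(hlt p) ::
        m[(p + 1).val]'(hlt _) :: t := by
      intro p
      have hlen : 2 ≤ (m.rotate p.val).length := by rwa [List.length_rotate]
      refine ⟨(m.rotate p.val).drop 2, List.ext_getElem (by simp; omega) fun i h1 h2 => ?_⟩
      rcases i with - | - | i
      · simp [List.getElem_rotate, Nat.mod_eq_of_lt (hlt p)]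
      · have e : (p + 1).val = (1 + p.val) % m.length := by
          rw [ZMod.val_add, ZMod.val_one'' (by omega), add_comm]
        simp [List.getElem_rotate, e]
      · simp only [List.getElem_cons_succ, List.getElem_drop]
        congr 1
        omega
    let w : CyclicWord (Coprod A B) :=
      { P := factor A B
        n := m.length
        n_ne := this
        x := fun p => (m[p.val]'(hlt p)).2
        par := fun p => (m[p.val]'(hlt p)).1
        par_succ := fun p => by
          obtain ⟨t, ht⟩ := hrot p
          exact (Bool.eq_not_of_ne (hmin _ _ _ _ ht).2.symm)
        mem := fun p => hl _ (List.getElem_mem _)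
        free := fun l h1 h2 h3 h4 => exists_eq_one_of_prod_eq_one h1 h2 h3 h4 }
    have hw : w.word = (m.map Prod.snd).prod := by
      rw [CyclicWord.word]
      congr 1
      refine List.ext_getElem (by simp [w]) fun i h1 h2 => ?_
      have : i < m.length := by simpa using h2
      simp [w, ZMod.val_natCast, Nat.mod_eq_of_lt this]
    rw [← hw]
    intro htop
    obtain ⟨a, ha⟩ := exists_ne (1 : A)
    refine ha (Coprod.inl_injective (N := B) ?_)
    rw [map_one]
    refine w.eq_one_of_mem (b := false) Coprod.range_inl_sup_range_inr
      (isLeftOrderable_prod hA hB) Coprod.toProd (fun b a => eq_one_of_mem_factor) (fun p => ?_)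
      ⟨a, rfl⟩ (by rw [htop]; exact Subgroup.mem_top _)
    obtain ⟨t, ht⟩ := hrot p
    exact (hmin _ _ _ _ ht).1

end Coprod

end OneRelator

/-- The free product of two nontrivial left-orderable groups has normal rank
greater than one: no single element normally generates it. -/
theorem freeProduct_normal_rank_gt_one
    {A B : Type*} [Group A] [Group B] [Nontrivial A] [Nontrivial B]
    (hA : IsLeftOrderable A) (hB : IsLeftOrderable B) :
    ∀ w : Monoid.Coprod A B, Subgroup.normalClosure {w} ≠ ⊤ := by
  exact fun w => OneRelator.normalClosure_ne_top hA hB w
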